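/- arXiv:1809.00422 — 6 statements merged into one kernel-verified Lean document; each statement's English description precedes it below -/
import Mathlib

section
/- (Feldman–Moore) If E is a countable Borel equivalence relation on a standard Borel space X, then there exist a countable group G and an action of G on X by Borel automorphisms such that E is the orbit equivalence relation of this action, i.e., (x, y) ∈ E if and only if there is g ∈ G with g · x = y. -/
open MeasureTheory Set Filter Topology

section LusinNovikov

variable {Z Y : Type*} {f : Z → Y}

/-- An analytic set on which a continuous map is injective is contained in a Borel set with the
same property. -/
theorem MeasureTheory.AnalyticSet.exists_measurableSet_injOn [TopologicalSpace Z] [PolishSpace Z]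
    [MeasurableSpace Z] [BorelSpace Z] [TopologicalSpace Y] [T2Space Y] (hf : Continuous f)
    {A : Set Z} (hA : AnalyticSet A) (hinj : InjOn f A) :
    ∃ B, A ⊆ B ∧ MeasurableSet B ∧ InjOn f B := by
  have hrel : MeasurableSet {p : Z × Z | f p.1 = f p.2 ∧ p.1 ≠ p.2} :=
    (isClosed_eq (by fun_prop) (by fun_prop)).measurableSet.inter
      (isClosed_eq continuous_fst continuous_snd).measurableSet.compl
  have hnbhd : ∀ C : Set Z, AnalyticSet C →
      AnalyticSet {z | ∃ a ∈ C, f a = f z ∧ a ≠ z} := by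
    intro C hC
    have h : AnalyticSet (Prod.fst ⁻¹' C ∩ {p : Z × Z | f p.1 = f p.2 ∧ p.1 ≠ p.2}) := by
      rw [inter_eq_iInter]
      refine AnalyticSet.iInter fun b => ?_
      cases b
      · exact hrel.analyticSet
      · exact hC.preimage continuous_fst
    convert h.image_of_continuous continuous_snd using 1
    ext z
    simp
  obtain ⟨B₀, hAB₀, hdisj₀, hB₀⟩ := hA.measurablySeparable (hnbhd A hA) (by
    rw [disjoint_left]
    rintro z hz ⟨a, ha, haz, hne⟩
    exact hne (hinj ha hz haz))
  obtain ⟨B₁, hAB₁, hdisj₁, hB₁⟩ := hA.measurablySeparable (hnbhd B₀ hB₀.analyticSet) (by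
    rw [disjoint_left]
    rintro z hz ⟨a, ha, haz, hne⟩
    exact disjoint_left.1 hdisj₀ ⟨z, hz, haz.symm, hne.symm⟩ ha)
  refine ⟨B₀ ∩ B₁, subset_inter hAB₀ hAB₁, hB₀.inter hB₁, ?_⟩
  intro a ha b hb hab
  by_contra hne
  exact disjoint_left.1 hdisj₁ ⟨a, ha.1, hab, hne⟩ hb.2

/-- `IsLargeTuple f n U` says that the tuples `(z 0, …, z n) ∈ U 0 × ⋯ × U n` lying in a common
fiber of `f` cannot all be blocked by countably many Borel sets on which `f` is injective. -/
def IsLargeTuple [MeasurableSpace Z] (f : Z → Y) (n : ℕ) (U : ℕ → Set Z) : Prop :=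
  ∀ S : Set (Set Z), S.Countable → (∀ B ∈ S, MeasurableSet B ∧ InjOn f B) →
    ∃ z : ℕ → Z, ∀ k ≤ n, z k ∈ U k ∧ f (z k) = f (z 0) ∧ z k ∉ ⋃₀ S

/-- A large tuple of closed sets can be shrunk and its `i`-th entry split in two. -/
theorem IsLargeTuple.exists_split [MetricSpace Z] [CompleteSpace Z] [SecondCountableTopology Z]
    [MeasurableSpace Z] [BorelSpace Z] [TopologicalSpace Y] [T2Space Y] (hf : Continuous f)
    {n : ℕ} {U : ℕ → Set Z} (hU : IsLargeTuple f n U) (hclosed : ∀ k, IsClosed (U k))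
    {i : ℕ} (hi : i ≤ n) {ε : ℝ} (hε : 0 < ε) :
    ∃ V : ℕ → Set Z, IsLargeTuple f (n + 1) V ∧ (∀ k, IsClosed (V k)) ∧ (∀ k ≤ n, V k ⊆ U k) ∧
      V (n + 1) ⊆ U i ∧ Disjoint (V i) (V (n + 1)) ∧
      ∀ k ≤ n + 1, ∀ a ∈ V k, ∀ b ∈ V k, dist a b ≤ ε := by
  obtain ⟨z₀, -⟩ := hU ∅ countable_empty (by simp)
  have : Nonempty Z := ⟨z₀ 0⟩
  let W : ℕ × ℕ → Set Z := fun a =>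
    Metric.closedBall (TopologicalSpace.denseSeq Z a.1) (1 / ((a.2 : ℝ) + 1))
  have hW : ∀ (x : Z) (δ : ℝ), 0 < δ → ∃ a, x ∈ W a ∧ ∀ u ∈ W a, ∀ v ∈ W a, dist u v ≤ δ := by
    intro x δ hδ
    obtain ⟨m, hm⟩ := exists_nat_one_div_lt (half_pos hδ)
    obtain ⟨l, hl⟩ := (TopologicalSpace.denseRange_denseSeq Z).exists_dist_lt x
      (Nat.one_div_pos_of_nat (α := ℝ) (n := m))
    refine ⟨(l, m), hl.le, fun u hu v hv => ?_⟩
    have := dist_triangle_right u v (TopologicalSpace.denseSeq Z l)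
    simp only [W, Metric.mem_closedBall] at hu hv
    linarith
  let V : (Fin (n + 2) → ℕ × ℕ) → ℕ → Set Z := fun c k =>
    U (if k = n + 1 then i else k) ∩ W (c (Fin.ofNat (n + 2) k))
  have hVclosed : ∀ c k, IsClosed (V c k) := fun c k =>
    (hclosed _).inter Metric.isClosed_closedBall
  by_contra! hcon
  have hblock : ∀ c : Fin (n + 2) → ℕ × ℕ, ∃ S : Set (Set Z), S.Countable ∧
      (∀ B ∈ S, MeasurableSet B ∧ InjOn f B) ∧
      (Disjoint (V c i) (V c (n + 1)) →
        (∀ k ≤ n + 1, ∀ a ∈ V c k, ∀ b ∈ V c k, dist a b ≤ ε) →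
        ∀ z : ℕ → Z, ¬ ∀ k ≤ n + 1, z k ∈ V c k ∧ f (z k) = f (z 0) ∧ z k ∉ ⋃₀ S) := by
    intro c
    by_cases hlarge : IsLargeTuple f (n + 1) (V c)
    · refine ⟨∅, countable_empty, by simp, fun hd hdist => ?_⟩
      obtain ⟨k, hk, a, ha, b, hb, hab⟩ := hcon (V c) hlarge (hVclosed c)
        (fun k hk => by simp [V, show k ≠ n + 1 by omega])
        (by simp [V]) hd
      exact absurd (hdist k hk a ha b hb) hab.not_ge
    · unfold IsLargeTuple at hlarge
      push Not at hlarge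
      obtain ⟨S, hS, hSB, h⟩ := hlarge
      refine ⟨S, hS, hSB, fun _ _ z hz => ?_⟩
      obtain ⟨k, hk, h⟩ := h z
      exact (hz k hk).2.2 (h (hz k hk).1 (hz k hk).2.1)
  choose S hScount hSB hS using hblock
  let T : Set (Set Z) := ⋃ c, S c
  have hT : T.Countable := countable_iUnion hScount
  have hTB : ∀ B ∈ T, MeasurableSet B ∧ InjOn f B := by
    intro B hB
    obtain ⟨c, hc⟩ := mem_iUnion.1 hB
    exact hSB c B hc
  have hTmeas : MeasurableSet (⋃₀ T) := .sUnion hT fun B hB => (hTB B hB).1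
  let P : Set (ℕ → Z) := {z | ∀ k ≤ n, z k ∈ U k ∧ f (z k) = f (z 0) ∧ z k ∉ ⋃₀ T}
  have hP : MeasurableSet P := by
    have : P = ⋂ k, ⋂ (_ : k ≤ n), ((fun z : ℕ → Z => z k) ⁻¹' U k ∩
        ({z | f (z k) = f (z 0)} ∩ (fun z : ℕ → Z => z k) ⁻¹' (⋃₀ T)ᶜ)) := by
      ext z
      simp [P]
    rw [this]
    exact .iInter fun k => .iInter fun _ =>
      (measurable_pi_apply k (hclosed k).measurableSet).inter
        ((isClosed_eq (by fun_prop) (by fun_prop)).measurableSet.inter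
          (measurable_pi_apply k hTmeas.compl))
  have hA : AnalyticSet ((fun z : ℕ → Z => z i) '' P) :=
    hP.analyticSet.image_of_continuous (continuous_apply i)
  have hinj : InjOn f ((fun z : ℕ → Z => z i) '' P) := by
    rintro _ ⟨z, hz, rfl⟩ _ ⟨z', hz', rfl⟩ hzz'
    by_contra hne
    simp only at hzz' hne
    have hdist : 0 < dist (z i) (z' i) := dist_pos.2 hne
    let w : ℕ → Z := Function.update z (n + 1) (z' i)
    have hwz : ∀ k ≤ n, w k = z k := fun k hk =>
      Function.update_of_ne (by omega) _ _
    have hwn : w (n + 1) = z' i := Function.update_self _ _ _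
    choose c hcmem hcdist using fun k : Fin (n + 2) =>
      hW (w k) (min ε (dist (z i) (z' i) / 3)) (by positivity)
    have hcast : ∀ k ≤ n + 1, ((Fin.ofNat (n + 2) k : Fin (n + 2)) : ℕ) = k := fun k hk =>
      Nat.mod_eq_of_lt (by omega)
    have hwW : ∀ k ≤ n + 1, w k ∈ W (c (Fin.ofNat (n + 2) k)) := by
      intro k hk
      have := hcmem (Fin.ofNat (n + 2) k)
      rwa [hcast k hk] at this
    refine hS c ?_ ?_ w ?_
    · rw [disjoint_left]
      intro u hu hu'
      have h₁ := hcdist _ u hu.2 _ (hwW i (by omega))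
      have h₂ := hcdist _ u hu'.2 _ (hwW (n + 1) le_rfl)
      rw [hwz i hi] at h₁
      rw [hwn] at h₂
      have := dist_triangle_left (z i) (z' i) u
      have h₃ := h₁.trans (min_le_right _ _)
      have h₄ := h₂.trans (min_le_right _ _)
      linarith
    · intro k _ a ha b hb
      exact (hcdist _ a ha.2 b hb.2).trans (min_le_left _ _)
    · have hsub : ∀ x, x ∉ ⋃₀ T → x ∉ ⋃₀ S c := fun x hx hx' =>
        hx (sUnion_subset_sUnion (subset_iUnion S c) hx')
      intro k hk
      rw [hwz 0 (Nat.zero_le n)]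
      rcases Nat.le_succ_iff.1 hk with hk' | rfl
      · have hWk := hwW k hk
        rw [hwz k hk'] at hWk ⊢
        refine ⟨⟨?_, hWk⟩, (hz k hk').2.1, hsub _ (hz k hk').2.2⟩
        rw [if_neg (by omega)]
        exact (hz k hk').1
      · have hWk := hwW (n + 1) le_rfl
        rw [Nat.succ_eq_add_one]
        rw [hwn] at hWk ⊢
        refine ⟨⟨?_, hWk⟩, ?_, hsub _ (hz' i hi).2.2⟩
        · rw [if_pos rfl]
          exact (hz' i hi).1
        · rw [← hzz', (hz i hi).2.1]
  obtain ⟨B, hAB, hB, hBinj⟩ := hA.exists_measurableSet_injOn hf hinj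
  obtain ⟨z, hz⟩ := hU (insert B T) (hT.insert B) (by
    rintro C (rfl | hC)
    · exact ⟨hB, hBinj⟩
    · exact hTB C hC)
  refine (hz i hi).2.2 ⟨B, mem_insert _ _, hAB ⟨z, fun k hk => ?_, rfl⟩⟩
  exact ⟨(hz k hk).1, (hz k hk).2.1,
    fun h => (hz k hk).2.2 (sUnion_subset_sUnion (subset_insert B T) h)⟩

/-- **Lusin–Novikov theorem** for continuous maps. -/
theorem Continuous.exists_countable_injOn_cover [MetricSpace Z] [CompleteSpace Z]
    [SecondCountableTopology Z] [MeasurableSpace Z] [BorelSpace Z] [TopologicalSpace Y] [T2Space Y]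
    (hf : Continuous f) (hfib : ∀ y, (f ⁻¹' {y}).Countable) :
    ∃ S : Set (Set Z), S.Countable ∧ (∀ B ∈ S, MeasurableSet B ∧ InjOn f B) ∧ ⋃₀ S = univ := by
  by_contra! hcon
  let State (n : ℕ) := {U : ℕ → Set Z // IsLargeTuple f n U ∧ ∀ k, IsClosed (U k)}
  let start : State 0 := ⟨fun _ => univ, fun S hS hSB => by
    obtain ⟨x, hx⟩ := (ne_univ_iff_exists_notMem _).1 (hcon S hS hSB)
    exact ⟨fun _ => x, fun k _ => ⟨mem_univ _, rfl, hx⟩⟩, fun _ => isClosed_univ⟩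
  have hstep : ∀ (n : ℕ) (U : State n), ∃ V : State (n + 1), (∀ k ≤ n, V.1 k ⊆ U.1 k) ∧
      V.1 (n + 1) ⊆ U.1 n.unpair.1 ∧ Disjoint (V.1 n.unpair.1) (V.1 (n + 1)) ∧
      ∀ k ≤ n + 1, ∀ a ∈ V.1 k, ∀ b ∈ V.1 k, dist a b ≤ 1 / ((n : ℝ) + 1) := by
    intro n U
    obtain ⟨V, h₁, h₂, h⟩ := U.2.1.exists_split hf U.2.2 (Nat.unpair_left_le n)
      (Nat.one_div_pos_of_nat (α := ℝ) (n := n))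
    exact ⟨⟨V, h₁, h₂⟩, h⟩
  choose nextState hmono hnew hdisj hdist using hstep
  let U : (n : ℕ) → State n := fun n => Nat.rec start nextState n
  have hanti : ∀ k m n, k ≤ m → m ≤ n → (U n).1 k ⊆ (U m).1 k := by
    intro k m n hk hmn
    induction n, hmn using Nat.le_induction with
    | base => exact Subset.rfl
    | succ n hn ih => exact (hmono n (U n) k (by omega)).trans ih
  choose w hw using fun n => (U n).2.1 ∅ countable_empty (by simp)
  have hwmem : ∀ k m n, k ≤ m → m ≤ n → w n k ∈ (U m).1 k := fun k m n hk hmn =>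
    hanti k m n hk hmn (hw n k (by omega)).1
  have hlim : ∀ k, ∃ x, Tendsto (fun n => w n k) atTop (𝓝 x) := by
    intro k
    refine cauchySeq_tendsto_of_complete (Metric.cauchySeq_iff.2 fun ε hε => ?_)
    obtain ⟨m, hm⟩ := exists_nat_one_div_lt hε
    refine ⟨max k m + 1, fun a ha b hb => ?_⟩
    refine (hdist _ (U (max k m)) k (by omega) _ (hwmem k (max k m + 1) a (by omega) ha) _
      (hwmem k (max k m + 1) b (by omega) hb)).trans_lt (lt_of_le_of_lt ?_ hm)
    exact Nat.one_div_le_one_div (le_max_right k m)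
  choose z hz using hlim
  have hzmem : ∀ k m, k ≤ m → z k ∈ (U m).1 k := fun k m hk =>
    ((U m).2.2 k).mem_of_tendsto (hz k) ((eventually_ge_atTop m).mono fun n hn =>
      hwmem k m n hk hn)
  have hzfib : ∀ k, f (z k) = f (z 0) := fun k =>
    tendsto_nhds_unique_of_eventuallyEq ((hf.tendsto _).comp (hz k)) ((hf.tendsto _).comp (hz 0))
      ((eventually_ge_atTop k).mono fun n hn => (hw n k hn).2.1)
  have hperf : Preperfect (range z) := by
    rintro _ ⟨k, rfl⟩
    rw [accPt_iff_nhds]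
    intro N hN
    obtain ⟨ε, hε, hεN⟩ := Metric.mem_nhds_iff.1 hN
    obtain ⟨m, hm⟩ := exists_nat_one_div_lt hε
    -- the stage at which the `k`-th entry is split and has diameter less than `ε`
    obtain ⟨n, hkn, hmn, hnk⟩ : ∃ n, k ≤ n ∧ m ≤ n ∧ (n + 1).unpair.1 = k := by
      have h₁ := Nat.left_le_pair k (k + m + 1)
      have h₂ := Nat.right_le_pair k (k + m + 1)
      exact ⟨Nat.pair k (k + m + 1) - 1, by omega, by omega, by
        rw [Nat.sub_add_cancel (by omega), Nat.unpair_pair]⟩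
    have hsplit := hnew (n + 1) (U (n + 1)) (hzmem (n + 2) (n + 2) le_rfl)
    have hne := disjoint_left.1 (hdisj (n + 1) (U (n + 1)))
    rw [hnk] at hsplit hne
    refine ⟨z (n + 2), ⟨hεN ?_, n + 2, rfl⟩, fun h => ?_⟩
    · refine (hdist n (U n) k (by omega) _ hsplit _ (hzmem k (n + 1) (by omega))).trans_lt
        (lt_of_le_of_lt ?_ hm)
      exact Nat.one_div_le_one_div hmn
    · refine hne (hzmem k (n + 2) (by omega)) ?_
      rw [← h]
      exact hzmem (n + 2) (n + 2) le_rfl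
  obtain ⟨g, hg, -, hginj⟩ := hperf.perfect_closure.exists_nat_bool_injection
    (range_nonempty z).closure
  have hsub : range g ⊆ f ⁻¹' {f (z 0)} := hg.trans <| by
    refine closure_minimal ?_ (isClosed_singleton.preimage hf)
    rintro _ ⟨k, rfl⟩
    exact hzfib k
  have hcount : Countable (ℕ → Bool) := by
    rw [← countable_univ_iff, ← preimage_range g]
    exact ((hfib _).mono hsub).preimage_of_injOn hginj.injOn
  rw [← Cardinal.mk_le_aleph0_iff] at hcount
  simpa using hcount.trans_lt (Cardinal.cantor _)

/-- **Lusin–Novikov theorem**: a Borel map with countable fibers is injective on each piece of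
some countable Borel cover of its domain. -/
theorem Measurable.exists_countable_injOn_cover [MeasurableSpace Z] [StandardBorelSpace Z]
    [MeasurableSpace Y] [StandardBorelSpace Y] (hf : Measurable f)
    (hfib : ∀ y, (f ⁻¹' {y}).Countable) :
    ∃ S : Set (Set Z), S.Countable ∧ (∀ B ∈ S, MeasurableSet B ∧ InjOn f B) ∧ ⋃₀ S = univ := by
  let := upgradeStandardBorel Y
  obtain ⟨t, ht, htp⟩ := StandardBorelSpace.polish (α := Z)
  obtain ⟨t', hle, hcont, hpol⟩ := hf.exists_continuous
  have hb : @BorelSpace Z t' _ :=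
    ⟨by rw [borel_eq_borel_of_le hpol htp hle]; exact ht.measurable_eq⟩
  clear hle
  let := t'
  let := TopologicalSpace.upgradeIsCompletelyMetrizable Z
  exact Continuous.exists_countable_injOn_cover hcont hfib

end LusinNovikov

/-- Two Borel maps that are injective on a Borel set `R` and have disjoint images there are
exchanged by a Borel involution supported on these images. -/
theorem exists_measurable_involutive_of_injOn {X Z : Type*} [MeasurableSpace X]
    [StandardBorelSpace X] [MeasurableSpace Z] [StandardBorelSpace Z] {f g : Z → X}
    (hf : Measurable f) (hg : Measurable g) {R : Set Z} (hR : MeasurableSet R)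
    (hfR : InjOn f R) (hgR : InjOn g R) (hfg : Disjoint (f '' R) (g '' R)) :
    ∃ φ : X → X, Measurable φ ∧ Function.Involutive φ ∧ (∀ z ∈ R, φ (f z) = g z) ∧
      ∀ x, φ x = x ∨ ∃ z ∈ R, (x = f z ∧ φ x = g z) ∨ (x = g z ∧ φ x = f z) := by
  have hex : ∀ x, ∃ y, (∃ z ∈ R, (x = f z ∧ y = g z) ∨ (x = g z ∧ y = f z)) ∨
      (x ∉ f '' R ∪ g '' R ∧ y = x) := by
    intro x
    by_cases hx : x ∈ f '' R ∪ g '' R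
    · rcases hx with ⟨z, hz, rfl⟩ | ⟨z, hz, rfl⟩
      · exact ⟨g z, .inl ⟨z, hz, .inl ⟨rfl, rfl⟩⟩⟩
      · exact ⟨f z, .inl ⟨z, hz, .inr ⟨rfl, rfl⟩⟩⟩
    · exact ⟨x, .inr ⟨hx, rfl⟩⟩
  choose φ hφ using hex
  have hne : ∀ z ∈ R, ∀ z' ∈ R, f z ≠ g z' := fun z hz z' hz' h =>
    disjoint_left.1 hfg ⟨z, hz, rfl⟩ ⟨z', hz', h.symm⟩
  have hφf : ∀ z ∈ R, φ (f z) = g z := by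
    intro z hz
    rcases hφ (f z) with ⟨z', hz', ⟨h₁, h₂⟩ | ⟨h₁, -⟩⟩ | ⟨h, -⟩
    · rw [h₂, hfR hz hz' h₁]
    · exact absurd h₁ (hne z hz z' hz')
    · exact absurd (.inl ⟨z, hz, rfl⟩) h
  have hφg : ∀ z ∈ R, φ (g z) = f z := by
    intro z hz
    rcases hφ (g z) with ⟨z', hz', ⟨h₁, -⟩ | ⟨h₁, h₂⟩⟩ | ⟨h, -⟩
    · exact absurd h₁.symm (hne z' hz' z hz)
    · rw [h₂, hgR hz hz' h₁]
    · exact absurd (.inr ⟨z, hz, rfl⟩) h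
  have hfix : ∀ x, x ∉ f '' R ∪ g '' R → φ x = x := by
    intro x hx
    rcases hφ x with ⟨z, hz, ⟨rfl, -⟩ | ⟨rfl, -⟩⟩ | ⟨-, h⟩
    · exact absurd (.inl ⟨z, hz, rfl⟩) hx
    · exact absurd (.inr ⟨z, hz, rfl⟩) hx
    · exact h
  refine ⟨φ, fun T hT => ?_, fun x => ?_, hφf, fun x => ?_⟩
  · have hpre : φ ⁻¹' T = f '' (R ∩ g ⁻¹' T) ∪ g '' (R ∩ f ⁻¹' T) ∪
        (T \ (f '' R ∪ g '' R)) := by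
      ext x
      by_cases hx : x ∈ f '' R ∪ g '' R
      · rcases hx with ⟨z, hz, rfl⟩ | ⟨z, hz, rfl⟩
        · grind
        · grind
      · grind
    rw [hpre]
    exact (((hR.inter (hg hT)).image_of_measurable_injOn hf (hfR.mono inter_subset_left)).union
      ((hR.inter (hf hT)).image_of_measurable_injOn hg (hgR.mono inter_subset_left))).union
      (hT.diff ((hR.image_of_measurable_injOn hf hfR).union (hR.image_of_measurable_injOn hg hgR)))
  · by_cases hx : x ∈ f '' R ∪ g '' R
    · rcases hx with ⟨z, hz, rfl⟩ | ⟨z, hz, rfl⟩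
      · rw [hφf z hz, hφg z hz]
      · rw [hφg z hz, hφf z hz]
    · rw [hfix x hx, hfix x hx]
  · exact (hφ x).symm.imp And.right id

/-- Feldman–Moore: If E is a countable Borel equivalence relation on a standard
Borel space X, then there exist a countable group G of Borel automorphisms of X such that E is
the orbit equivalence relation of the action of G: (x, y) ∈ E iff g · x = y for some g ∈ G. -/
theorem feldman_moore
    {X : Type*} [MeasurableSpace X] [StandardBorelSpace X]
    (E : X → X → Prop) (hEquiv : Equivalence E)
    (hBorel : MeasurableSet {p : X × X | E p.1 p.2})
    (hCtble : ∀ x, {y | E x y}.Countable) :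
    ∃ G : Subgroup (Equiv.Perm X), Countable G ∧
      (∀ g ∈ G, Measurable g) ∧
      (∀ x y, E x y ↔ ∃ g ∈ G, g x = y) := by
  let Z := {p : X × X | E p.1 p.2}
  have : StandardBorelSpace Z := hBorel.standardBorel
  let s : Z → X := fun p => p.1.1
  let t : Z → X := fun p => p.1.2
  have hs : Measurable s := measurable_fst.comp measurable_subtype_coe
  have ht : Measurable t := measurable_snd.comp measurable_subtype_coe
  have hst : ∀ p : Z, E (s p) (t p) := fun p => p.2
  obtain ⟨S, hScount, hS, hScover⟩ := hs.exists_countable_injOn_cover fun x => by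
    refine MapsTo.countable_of_injOn (f := t) (t := {y | E x y}) ?_ ?_ (hCtble x)
    · rintro p rfl
      exact hst p
    · exact fun p hp q hq h => Subtype.ext (Prod.ext (Eq.trans hp (Eq.symm hq)) h)
  obtain ⟨T, hTcount, hT, hTcover⟩ := ht.exists_countable_injOn_cover fun y => by
    refine MapsTo.countable_of_injOn (f := s) (t := {x | E y x}) ?_ ?_ (hCtble y)
    · rintro p rfl
      exact hEquiv.symm (hst p)
    · exact fun p hp q hq h => Subtype.ext (Prod.ext h (Eq.trans hp (Eq.symm hq)))
  obtain ⟨A, hA, hAsep⟩ := exists_seq_separating X (p := MeasurableSet) MeasurableSet.empty univ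
  have : Countable S := hScount.to_subtype
  have : Countable T := hTcount.to_subtype
  have hinv : ∀ i : S × T × ℕ, ∃ φ : X → X, Measurable φ ∧ Function.Involutive φ ∧
      (∀ p ∈ i.1.1 ∩ i.2.1.1 ∩ (s ⁻¹' A i.2.2 ∩ t ⁻¹' (A i.2.2)ᶜ), φ (s p) = t p) ∧
      ∀ x, E x (φ x) := by
    rintro ⟨B, C, n⟩
    obtain ⟨φ, h₁, h₂, h₃, h₄⟩ := exists_measurable_involutive_of_injOn hs ht
      (R := B.1 ∩ C.1 ∩ (s ⁻¹' A n ∩ t ⁻¹' (A n)ᶜ))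
      (((hS B B.2).1.inter (hT C C.2).1).inter ((hs (hA n)).inter (ht (hA n).compl)))
      ((hS B B.2).2.mono fun p hp => hp.1.1) ((hT C C.2).2.mono fun p hp => hp.1.2)
      (by
        rw [disjoint_left]
        rintro _ ⟨p, hp, rfl⟩ ⟨q, hq, hqp⟩
        refine hq.2.2 ?_
        rw [hqp]
        exact hp.2.1)
    refine ⟨φ, h₁, h₂, h₃, fun x => ?_⟩
    rcases h₄ x with h | ⟨p, -, ⟨rfl, h⟩ | ⟨rfl, h⟩⟩
    · rw [h]
      exact hEquiv.refl x
    · rw [h]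
      exact hst p
    · rw [h]
      exact hEquiv.symm (hst p)
  choose φ hφmeas hφinv hφR hφE using hinv
  let σ : S × T × ℕ → Equiv.Perm X := fun i => (hφinv i).toPerm
  have hclosure : ∀ g ∈ Subgroup.closure (range σ),
      Measurable g ∧ Measurable (g⁻¹ : Equiv.Perm X) ∧ ∀ x, E x (g x) := by
    intro g hg
    induction hg using Subgroup.closure_induction with
    | mem g hg =>
      obtain ⟨i, rfl⟩ := hg
      exact ⟨hφmeas i, hφmeas i, hφE i⟩
    | one => exact ⟨measurable_id, measurable_id, hEquiv.refl⟩
    | mul g h _ _ hg hh =>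
      refine ⟨hg.1.comp hh.1, ?_, fun x => hEquiv.trans (hh.2.2 x) (hg.2.2 (h x))⟩
      rw [mul_inv_rev]
      exact hh.2.1.comp hg.2.1
    | inv g _ hg =>
      refine ⟨hg.2.1, by rw [inv_inv]; exact hg.1, fun x => hEquiv.symm ?_⟩
      simpa using hg.2.2 (g⁻¹ x)
  refine ⟨Subgroup.closure (range σ), ?_, fun g hg => (hclosure g hg).1, fun x y => ⟨?_, ?_⟩⟩
  · rw [← FreeGroup.range_lift_eq_closure]
    have : Countable (FreeGroup (S × T × ℕ)) := inferInstanceAs (Countable (Quot _))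
    exact (FreeGroup.lift σ).rangeRestrict_surjective.countable
  · have hmove : ∀ (n : ℕ) (x y : X), E x y → x ∈ A n → y ∉ A n →
        ∃ i, φ i x = y := by
      intro n x y hxy hx hy
      obtain ⟨B, hB, hpB⟩ := mem_sUnion.1 (hScover.symm ▸ mem_univ (⟨(x, y), hxy⟩ : Z))
      obtain ⟨C, hC, hpC⟩ := mem_sUnion.1 (hTcover.symm ▸ mem_univ (⟨(x, y), hxy⟩ : Z))
      exact ⟨⟨⟨B, hB⟩, ⟨C, hC⟩, n⟩, hφR ⟨⟨B, hB⟩, ⟨C, hC⟩, n⟩ ⟨(x, y), hxy⟩ ⟨⟨hpB, hpC⟩, hx, hy⟩⟩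
    intro hxy
    by_cases hne : x = y
    · exact ⟨1, one_mem _, hne⟩
    obtain ⟨n, hn⟩ : ∃ n, ¬(x ∈ A n ↔ y ∈ A n) := by
      by_contra! h
      exact hne (hAsep x (mem_univ x) y (mem_univ y) h)
    obtain ⟨i, hi⟩ : ∃ i, φ i x = y := by
      by_cases hx : x ∈ A n
      · exact hmove n x y hxy hx (by tauto)
      · obtain ⟨i, hi⟩ := hmove n y x (hEquiv.symm hxy) (by tauto) hx
        exact ⟨i, by rw [← hi, hφinv i]⟩
    exact ⟨σ i, Subgroup.subset_closure ⟨i, rfl⟩, hi⟩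
  · rintro ⟨g, hg, rfl⟩
    exact (hclosure g hg).2.2 x
end

section
/- Let X be a standard Borel space and let f : X → X be a Borel function such that f⁻¹({x}) is at most countable for each x ∈ X. Then the smallest equivalence relation E on X containing the pair (x, f(x)) for every x ∈ X is hyperfinite. -/
/-- An equivalence relation on a measurable space is *hyperfinite* if it is the union of an
increasing sequence of equivalence relations, each with Borel graph and finite classes. -/
def Hyperfinite {X : Type*} [MeasurableSpace X] (E : X → X → Prop) : Prop :=
  ∃ F : ℕ → X → X → Prop,
    (∀ n, Equivalence (F n)) ∧
    (∀ n, MeasurableSet {p : X × X | F n p.1 p.2}) ∧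
    (∀ n x, {y | F n x y}.Finite) ∧
    (∀ m n, m ≤ n → ∀ x y, F m x y → F n x y) ∧
    (∀ x y, E x y ↔ ∃ n, F n x y)

open Set Filter Topology MeasureTheory TopologicalSpace

/-- Sequences whose first `k` terms lie in a common fiber of `f`, the `i`-th one in `U i`. -/
def fiberTuples {X Y : Type*} (f : X → Y) (k : ℕ) (U : ℕ → Set X) : Set (ℕ → X) :=
  {x | ∀ i < k, x i ∈ U i ∧ f (x i) = f (x 0)}

/-- The tuples in `fiberTuples f k U` can be hit by countably many Borel sets on which `f` is
injective. -/
def FiberSmall {X Y : Type*} [MeasurableSpace X] (f : X → Y) (k : ℕ) (U : ℕ → Set X) : Prop :=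
  ∃ S : Set (Set X), S.Countable ∧ (∀ Q ∈ S, MeasurableSet Q ∧ InjOn f Q) ∧
    ∀ x ∈ fiberTuples f k U, ∃ i < k, x i ∈ ⋃₀ S

/-- An analytic set on which a Borel map `f` is injective is contained in a Borel set with the same
property. -/
theorem exists_measurableSet_injOn_superset {X Y Z : Type*}
    [MeasurableSpace X] [StandardBorelSpace X] [MeasurableSpace Z] [StandardBorelSpace Z]
    [TopologicalSpace Y] [T2Space Y] [SecondCountableTopology Y] [MeasurableSpace Y]
    [OpensMeasurableSpace Y] {f : X → Y} (hf : Measurable f) {g : Z → X} (hg : Measurable g)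
    {M : Set Z} (hM : MeasurableSet M) (hinj : InjOn f (g '' M)) :
    ∃ Q, MeasurableSet Q ∧ InjOn f Q ∧ g '' M ⊆ Q := by
  obtain ⟨V, hVm, hV⟩ := exists_seq_separating X (p := MeasurableSet) MeasurableSet.empty univ
  have hsep : ∀ m, MeasurablySeparable ((f ∘ g) '' (M ∩ g ⁻¹' V m))
      ((f ∘ g) '' (M ∩ g ⁻¹' (V m)ᶜ)) := fun m => by
    refine AnalyticSet.measurablySeparable
      ((hM.inter (hg (hVm m))).analyticSet_image (hf.comp hg))
      ((hM.inter (hg (hVm m).compl)).analyticSet_image (hf.comp hg)) ?_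
    rw [Set.disjoint_left]
    rintro _ ⟨a, ⟨haM, haV⟩, rfl⟩ ⟨b, ⟨hbM, hbV⟩, hab⟩
    have := hinj (mem_image_of_mem g hbM) (mem_image_of_mem g haM) hab
    exact hbV (by simpa [this] using haV)
  choose B hB₁ hB₂ hBm using hsep
  refine ⟨{x | ∀ m, x ∈ V m ↔ f x ∈ B m}, ?_, ?_, ?_⟩
  · rw [ofPred_forall]
    exact MeasurableSet.iInter fun m => (hVm m).iff (hf (hBm m))
  · intro x hx y hy hxy
    exact hV x trivial y trivial fun n => by rw [hx n, hy n, hxy]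
  · rintro _ ⟨a, ha, rfl⟩ m
    constructor
    · exact fun h => hB₁ m ⟨a, ⟨ha, h⟩, rfl⟩
    · intro h
      by_contra hn
      exact Set.disjoint_left.1 (hB₂ m) ⟨a, ⟨ha, hn⟩, rfl⟩ h

section LusinNovikov

variable {X Y : Type*} [MetricSpace X] [CompleteSpace X] [SecondCountableTopology X]
  [MeasurableSpace X] [BorelSpace X] [TopologicalSpace Y] [T2Space Y]
  [SecondCountableTopology Y] [MeasurableSpace Y] [BorelSpace Y] {f : X → Y}

/-- A tuple of open sets that is not `FiberSmall` can be shrunk while splitting one of its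
members. -/
theorem exists_split_of_not_fiberSmall (hf : Continuous f) {k : ℕ} {U : ℕ → Set X}
    (hU : ∀ i < k, IsOpen (U i)) (hlarge : ¬ FiberSmall f k U) {j : ℕ} (hj : j < k) {ε : ℝ}
    (hε : 0 < ε) :
    ∃ V : ℕ → Set X, (∀ i < k + 1, IsOpen (V i)) ∧ ¬ FiberSmall f (k + 1) V ∧
      (∀ i < k, closure (V i) ⊆ U i) ∧ V k ⊆ U j ∧ Disjoint (V j) (V k) ∧
      ∀ i < k + 1, ∀ a ∈ V i, ∀ b ∈ V i, dist a b ≤ ε := by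
  by_contra! hcon
  obtain ⟨b, hbc, -, hb⟩ := exists_countable_basis X
  have : Countable b := hbc.to_subtype
  let W : (Fin (k + 1) → b) → ℕ → Set X := fun v i => if h : i < k + 1 then v ⟨i, h⟩ else ∅
  let good : (Fin (k + 1) → b) → Prop := fun v =>
    (∀ i < k, closure (W v i) ⊆ U i) ∧ W v k ⊆ U j ∧ Disjoint (W v j) (W v k) ∧
      ∀ i < k + 1, ∀ a ∈ W v i, ∀ b ∈ W v i, dist a b ≤ ε
  have hsmall : ∀ v : {v // good v}, FiberSmall f (k + 1) (W v) := by
    rintro ⟨v, h₁, h₂, h₃, h₄⟩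
    by_contra hv
    obtain ⟨i, hi, a, ha, c, hc, hac⟩ := hcon (W v)
      (fun i hi => by simpa only [W, dif_pos hi] using hb.isOpen (v ⟨i, hi⟩).2) hv h₁ h₂ h₃
    exact absurd (h₄ i hi a ha c hc) (not_le.2 hac)
  choose S hSc hSm hS using hsmall
  let T : Set (Set X) := ⋃ v, S v
  have hTc : T.Countable := countable_iUnion hSc
  have hTm : ∀ Q ∈ T, MeasurableSet Q ∧ InjOn f Q := fun Q hQ => by
    obtain ⟨v, hv⟩ := mem_iUnion.1 hQ
    exact hSm v Q hv
  have hTU : MeasurableSet (⋃₀ T) := MeasurableSet.sUnion hTc fun Q hQ => (hTm Q hQ).1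
  let M : Set (ℕ → X) := fiberTuples f k U ∩ {x | ∀ i < k, x i ∉ ⋃₀ T}
  have hM : MeasurableSet M := by
    have h1 : M = ⋂ i, ⋂ (_ : i < k), ((fun x : ℕ → X => x i) ⁻¹' U i ∩
        {x | f (x i) = f (x 0)} ∩ (fun x : ℕ → X => x i) ⁻¹' (⋃₀ T)ᶜ) := by
      ext x
      simp only [M, fiberTuples, mem_inter_iff, mem_ofPred_eq, mem_iInter, mem_preimage,
        mem_compl_iff]
      grind
    rw [h1]
    refine MeasurableSet.iInter fun i => MeasurableSet.iInter fun hi => ?_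
    refine (((measurable_pi_apply i) (hU i hi).measurableSet).inter ?_).inter
      ((measurable_pi_apply i) hTU.compl)
    exact measurableSet_eq_fun (hf.measurable.comp (measurable_pi_apply i))
      (hf.measurable.comp (measurable_pi_apply 0))
  have hinj : InjOn f ((fun x : ℕ → X => x j) '' M) := by
    rintro _ ⟨x, ⟨hx, hxT⟩, rfl⟩ _ ⟨x', ⟨hx', hxT'⟩, rfl⟩ hxx'
    by_contra hne
    obtain ⟨O, O', hO, hO', hxO, hxO', hOO'⟩ := t2_separation hne
    let y : ℕ → X := Function.update x k (x' j)
    have hyk : y k = x' j := by simp [y]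
    have hyi : ∀ i < k, y i = x i := fun i hi => by simp [y, hi.ne]
    let N : ℕ → Set X := fun i =>
      if i = k then U j ∩ O' else if i = j then U j ∩ O else U i
    have hN : ∀ i < k + 1, N i ∩ Metric.ball (y i) (ε / 2) ∈ 𝓝 (y i) := by
      intro i hi
      refine inter_mem ?_ (Metric.ball_mem_nhds _ (half_pos hε))
      rcases Nat.lt_succ_iff_lt_or_eq.1 hi with hi | rfl
      · rw [hyi i hi]
        by_cases hij : i = j
        · subst hij
          simp only [N, hi.ne, if_false, if_true]
          exact ((hU i hi).inter hO).mem_nhds ⟨(hx i hi).1, hxO⟩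
        · simp only [N, hi.ne, hij, if_false]
          exact (hU i hi).mem_nhds (hx i hi).1
      · rw [hyk]
        simp only [N, if_true]
        exact ((hU j hj).inter hO').mem_nhds ⟨(hx' j hj).1, hxO'⟩
    choose t htb hyt ht using fun i : Fin (k + 1) => hb.exists_closure_subset (hN i i.2)
    let v : Fin (k + 1) → b := fun i => ⟨t i, htb i⟩
    have hW : ∀ i (hi : i < k + 1), W v i = t ⟨i, hi⟩ := fun i hi => by simp only [W, v, dif_pos hi]
    have hWN : ∀ i < k + 1, closure (W v i) ⊆ N i := fun i hi => by
      rw [hW i hi]; exact (ht ⟨i, hi⟩).trans inter_subset_left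
    have hNk : N k = U j ∩ O' := by simp [N]
    have hNj : N j = U j ∩ O := by simp [N, hj.ne]
    have hv : good v := by
      refine ⟨fun i hi => (hWN i (by omega)).trans ?_, ?_, ?_, ?_⟩
      · by_cases hij : i = j
        · subst hij; rw [hNj]; exact inter_subset_left
        · simp [N, hi.ne, hij]
      · refine (subset_closure.trans (hWN k (by omega))).trans ?_
        rw [hNk]; exact inter_subset_left
      · refine hOO'.mono ?_ ?_
        · refine (subset_closure.trans (hWN j (by omega))).trans ?_
          rw [hNj]; exact inter_subset_right
        · refine (subset_closure.trans (hWN k (by omega))).trans ?_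
          rw [hNk]; exact inter_subset_right
      · intro i hi a ha c hc
        rw [hW i hi] at ha hc
        have h1 := ((ht ⟨i, hi⟩) (subset_closure ha)).2
        have h2 := ((ht ⟨i, hi⟩) (subset_closure hc)).2
        rw [Metric.mem_ball] at h1 h2
        have := dist_triangle_right a c (y i)
        linarith
    have hy : y ∈ fiberTuples f (k + 1) (W v) := by
      intro i hi
      refine ⟨by rw [hW i hi]; exact hyt ⟨i, hi⟩, ?_⟩
      rw [hyi 0 (by omega)]
      rcases Nat.lt_succ_iff_lt_or_eq.1 hi with hi | rfl
      · rw [hyi i hi]; exact (hx i hi).2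
      · rw [hyk, ← (hx j hj).2]; exact hxx'.symm
    obtain ⟨i, hi, hiT⟩ := hS ⟨v, hv⟩ y hy
    have hiT' : y i ∈ ⋃₀ T := sUnion_mono (subset_iUnion S ⟨v, hv⟩) hiT
    rcases Nat.lt_succ_iff_lt_or_eq.1 hi with hi | rfl
    · exact hxT i hi (hyi i hi ▸ hiT')
    · exact hxT' j hj (hyk ▸ hiT')
  obtain ⟨Q, hQm, hQi, hQ⟩ :=
    exists_measurableSet_injOn_superset hf.measurable (measurable_pi_apply j) hM hinj
  refine hlarge ⟨insert Q T, hTc.insert Q, ?_, fun x hx => ?_⟩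
  · rintro R (rfl | hR)
    · exact ⟨hQm, hQi⟩
    · exact hTm R hR
  · by_cases hxT : ∀ i < k, x i ∉ ⋃₀ T
    · exact ⟨j, hj, Q, mem_insert _ _, hQ ⟨x, ⟨hx, hxT⟩, rfl⟩⟩
    · push Not at hxT
      obtain ⟨i, hi, hiT⟩ := hxT
      exact ⟨i, hi, sUnion_mono (subset_insert _ _) hiT⟩

/-- If the continuous map `f` has countable fibers, then `X` is covered by countably many Borel sets
on which `f` is injective. -/
theorem fiberSmall_univ_of_countable_fibers (hf : Continuous f)
    (hfib : ∀ y, {x | f x = y}.Countable) : FiberSmall f 1 (fun _ => univ) := by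
  by_contra hlarge
  have hstep : ∀ (n : ℕ) (U : ℕ → Set X),
      (∀ i < n + 1, IsOpen (U i)) ∧ ¬ FiberSmall f (n + 1) U → ∃ V : ℕ → Set X,
      ((∀ i < n + 1 + 1, IsOpen (V i)) ∧ ¬ FiberSmall f (n + 1 + 1) V) ∧
      (∀ i < n + 1, closure (V i) ⊆ U i) ∧ V (n + 1) ⊆ U n.unpair.1 ∧
      Disjoint (V n.unpair.1) (V (n + 1)) ∧
      ∀ i < n + 1 + 1, ∀ a ∈ V i, ∀ b ∈ V i, dist a b ≤ (1 / 2 : ℝ) ^ n := fun n U hU => by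
    obtain ⟨V, h₁, h₂, h₃⟩ := exists_split_of_not_fiberSmall hf hU.1 hU.2
      (Nat.lt_succ_of_le (Nat.unpair_left_le n)) (ε := (1 / 2 : ℝ) ^ n) (by positivity)
    exact ⟨V, ⟨h₁, h₂⟩, h₃⟩
  choose g hg hg' using hstep
  let u : ∀ n : ℕ, {U : ℕ → Set X // (∀ i < n + 1, IsOpen (U i)) ∧ ¬ FiberSmall f (n + 1) U} :=
    fun n => Nat.rec ⟨fun _ => univ, fun _ _ => isOpen_univ, hlarge⟩
      (fun n u => ⟨g n u.1 u.2, hg n u.1 u.2⟩) n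
  have hclos : ∀ n, ∀ i < n + 1, closure ((u (n + 1)).1 i) ⊆ (u n).1 i :=
    fun n => (hg' n (u n).1 (u n).2).1
  have hsub : ∀ n, (u (n + 1)).1 (n + 1) ⊆ (u n).1 n.unpair.1 :=
    fun n => (hg' n (u n).1 (u n).2).2.1
  have hdisj : ∀ n, Disjoint ((u (n + 1)).1 n.unpair.1) ((u (n + 1)).1 (n + 1)) :=
    fun n => (hg' n (u n).1 (u n).2).2.2.1
  have hdist : ∀ n, ∀ i < n + 1 + 1, ∀ a ∈ (u (n + 1)).1 i, ∀ b ∈ (u (n + 1)).1 i,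
      dist a b ≤ (1 / 2 : ℝ) ^ n := fun n => (hg' n (u n).1 (u n).2).2.2.2
  have hanti : ∀ i m n, i ≤ m → m ≤ n → (u n).1 i ⊆ (u m).1 i := by
    intro i m n him hmn
    induction n, hmn using Nat.le_induction with
    | base => exact subset_rfl
    | succ n hmn ih => exact (subset_closure.trans (hclos n i (by omega))).trans ih
  have hne : ∀ n, ∃ z, z ∈ fiberTuples f (n + 1) (u n).1 := by
    intro n
    by_contra! h
    exact (u n).2.2 ⟨∅, countable_empty, by simp, fun x hx => absurd hx (h x)⟩
  choose z hz using hne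
  have hzmem : ∀ i m n, i ≤ m → m ≤ n → z n i ∈ (u m).1 i := fun i m n him hmn =>
    hanti i m n him hmn (hz n i (by omega)).1
  have hpow : Tendsto (fun n : ℕ => (1 / 2 : ℝ) ^ n) atTop (𝓝 0) :=
    tendsto_pow_atTop_nhds_zero_of_lt_one (by norm_num) (by norm_num)
  have hcauchy : ∀ i, CauchySeq fun n => z n i := by
    intro i
    rw [Metric.cauchySeq_iff]
    intro ε hε
    obtain ⟨N, hN, hiN⟩ := ((hpow.eventually_lt_const hε).and (eventually_ge_atTop i)).exists
    refine ⟨N + 1, fun m hm n hn => (hdist N i (by omega) _ ?_ _ ?_).trans_lt hN⟩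
    · exact hzmem i (N + 1) m (by omega) hm
    · exact hzmem i (N + 1) n (by omega) hn
  choose x hx using fun i => cauchySeq_tendsto_of_complete (hcauchy i)
  have hxmem : ∀ i n, i ≤ n → x i ∈ (u n).1 i := fun i n hin =>
    hclos n i (by omega) (mem_closure_of_tendsto (hx i)
      ((eventually_ge_atTop (n + 1)).mono fun m hm => hzmem i (n + 1) m (by omega) hm))
  have hfx : ∀ i, f (x i) = f (x 0) := by
    intro i
    refine tendsto_nhds_unique ((hf.tendsto _).comp (hx i))
      (((hf.tendsto _).comp (hx 0)).congr' ?_)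
    filter_upwards [eventually_ge_atTop i] with n hn
    exact (hz n i (by omega)).2.symm
  have hperf : Perfect (closure (range x)) := by
    refine Preperfect.perfect_closure ?_
    rintro _ ⟨i, rfl⟩
    rw [accPt_iff_nhds]
    intro O hO
    obtain ⟨ε, hε, hεO⟩ := Metric.mem_nhds_iff.1 hO
    obtain ⟨N, hN, hiN⟩ := ((hpow.eventually_lt_const hε).and (eventually_ge_atTop i)).exists
    let n := Nat.pair i (N + 1)
    have hn : N + 1 ≤ n := Nat.right_le_pair _ _
    have hni : n.unpair.1 = i := by simp [n]
    refine ⟨x (n + 1), ⟨hεO ?_, mem_range_self _⟩, ?_⟩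
    · have h1 : x (n + 1) ∈ (u n).1 i := hni ▸ hsub n (hxmem (n + 1) (n + 1) le_rfl)
      rw [Metric.mem_ball]
      refine (hdist N i (by omega) _ (hanti i (N + 1) n (by omega) hn h1) _ ?_).trans_lt hN
      exact hxmem i (N + 1) (by omega)
    · intro h
      refine Set.disjoint_left.1 (hdisj n) ?_ (hxmem (n + 1) (n + 1) le_rfl)
      rw [h, hni]
      exact hxmem i (n + 1) (by omega)
  obtain ⟨φ, hφ, -, hφi⟩ := hperf.exists_nat_bool_injection (range_nonempty x).closure
  have hcl : closure (range x) ⊆ {a | f a = f (x 0)} :=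
    closure_minimal (range_subset_iff.2 hfx) (isClosed_eq hf continuous_const)
  have hcount : (range φ).Countable := (hfib (f (x 0))).mono (hφ.trans hcl)
  have : Countable (ℕ → Bool) := by
    have := hcount.to_subtype
    exact (rangeFactorization_injective.2 hφi).countable
  obtain ⟨e, he⟩ := exists_surjective_nat (ℕ → Bool)
  obtain ⟨n, hn⟩ := he fun n => !e n n
  simpa using congrFun hn n

end LusinNovikov

/-- A Borel map with countable fibers is injective on each piece of some countable Borel
partition, given here by a labelling. -/
theorem exists_measurable_labelling {X : Type*} [MeasurableSpace X] [StandardBorelSpace X]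
    {f : X → X} (hf : Measurable f) (hfib : ∀ y, {x | f x = y}.Countable) :
    ∃ c : X → ℕ, Measurable c ∧ ∀ x y, f x = f y → c x = c y → x = y := by
  classical
  obtain ⟨S, hSc, hSm, hS⟩ : FiberSmall f 1 (fun _ => univ) := by
    let t := upgradeStandardBorel X
    obtain ⟨t', ht', hft', hpol⟩ := hf.exists_continuous
    have hborel : @BorelSpace X t' _ := by
      refine @BorelSpace.mk X t' _ ?_
      rw [eq_borel_upgradeStandardBorel X]
      exact (borel_eq_borel_of_le hpol t.toPolishSpace ht').symm
    let m := @upgradeIsCompletelyMetrizable X t' hpol.toIsCompletelyMetrizableSpace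
    exact @fiberSmall_univ_of_countable_fibers X X m.toMetricSpace m.toCompleteSpace
      hpol.toSecondCountableTopology _ hborel t.toTopologicalSpace inferInstance inferInstance _
      inferInstance f hft' hfib
  obtain ⟨Q, hQ⟩ := (hSc.insert ∅).exists_eq_range (insert_nonempty _ _)
  have hQm : ∀ n, MeasurableSet (Q n) ∧ InjOn f (Q n) := fun n => by
    have : Q n ∈ insert ∅ S := hQ ▸ mem_range_self n
    rcases this with h | h
    · simp [h]
    · exact hSm _ h
  have hcov : ∀ x, ∃ n, x ∈ Q n := fun x => by
    obtain ⟨i, -, R, hR, hx⟩ := hS (fun _ => x) (fun i _ => ⟨trivial, rfl⟩)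
    obtain ⟨n, rfl⟩ : R ∈ range Q := hQ ▸ mem_insert_of_mem _ hR
    exact ⟨n, hx⟩
  refine ⟨fun x => Nat.find (hcov x), measurable_find hcov fun n => (hQm n).1,
    fun x y hxy hc => ?_⟩
  refine (hQm _).2 (Nat.find_spec (hcov x)) ?_ hxy
  have := Nat.find_spec (hcov y)
  rwa [← show Nat.find (hcov x) = Nat.find (hcov y) from hc] at this

/-- The kernels of a coherent sequence of maps increase. -/
theorem eq_of_coherent_of_le {X : Type*} {s : ℕ → X → X}
    (hcomp : ∀ n x, s (n + 1) (s n x) = s (n + 1) x) {m n : ℕ} {x y : X} (hmn : m ≤ n)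
    (h : s m x = s m y) : s n x = s n y := by
  induction n, hmn using Nat.le_induction with
  | base => exact h
  | succ n _ ih => rw [← hcomp n x, ih, hcomp]

/-- The union of the kernels of a coherent sequence of Borel maps with countable fibers is
hyperfinite. -/
theorem hyperfinite_of_coherent_maps {X : Type*} [MeasurableSpace X] [StandardBorelSpace X]
    (s : ℕ → X → X) (hs : ∀ n, Measurable (s n)) (hfib : ∀ n y, {x | s n x = y}.Countable)
    (hzero : ∀ x, s 0 x = x) (hcomp : ∀ n x, s (n + 1) (s n x) = s (n + 1) x) :
    Hyperfinite fun x y => ∃ n, s n x = s n y := by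
  choose c hcm hc using fun n => exists_measurable_labelling (hs (n + 1)) (hfib (n + 1))
  have hmono {m n : ℕ} {x y : X} := eq_of_coherent_of_le hcomp (m := m) (n := n) (x := x) (y := y)
  refine ⟨fun n x y => ∃ m ≤ n, s m x = s m y ∧ ∀ i < m, c i (s i x) ≤ n ∧ c i (s i y) ≤ n,
    fun n => ⟨?_, ?_, ?_⟩, fun n => ?_, fun n x => ?_, ?_, fun x y => ⟨?_, ?_⟩⟩
  · exact fun x => ⟨0, Nat.zero_le _, rfl, by simp⟩
  · rintro x y ⟨m, hm, h, hl⟩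
    exact ⟨m, hm, h.symm, fun i hi => (hl i hi).symm⟩
  · rintro x y w ⟨m, hm, h, hl⟩ ⟨m', hm', h', hl'⟩
    refine ⟨max m m', max_le hm hm',
      (hmono (le_max_left _ _) h).trans (hmono (le_max_right _ _) h'), fun i hi => ⟨?_, ?_⟩⟩
    · rcases lt_or_ge i m with him | him
      · exact (hl i him).1
      · rw [hmono him h]
        exact (hl' i (by omega)).1
    · rcases lt_or_ge i m' with him | him
      · exact (hl' i him).2
      · rw [← hmono him h']
        exact (hl i (by omega)).2
  · have hlabel : ∀ i, Measurable fun x => c i (s i x) := fun i => (hcm i).comp (hs i)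
    simp only [ofPred_exists, ofPred_and, ofPred_forall]
    refine MeasurableSet.iUnion fun m => (MeasurableSet.const _).inter (.inter ?_ ?_)
    · exact measurableSet_eq_fun ((hs m).comp measurable_fst) ((hs m).comp measurable_snd)
    · refine MeasurableSet.iInter fun i => MeasurableSet.iInter fun _ => .inter ?_ ?_
      · exact measurableSet_le ((hlabel i).comp measurable_fst) measurable_const
      · exact measurableSet_le ((hlabel i).comp measurable_snd) measurable_const
  · have hinj : ∀ m y y', s m y = s m y' → (∀ i < m, c i (s i y) = c i (s i y')) → y = y' := by
      intro m y y' h hl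
      induction m with
      | zero => simpa only [hzero] using h
      | succ m ih =>
        refine ih (hc m _ _ ?_ (hl m (by omega))) fun i hi => hl i (by omega)
        rwa [hcomp, hcomp]
    have hfin : ∀ m, {y | s m x = s m y ∧ ∀ i < m, c i (s i y) ≤ n}.Finite := by
      intro m
      refine Set.Finite.of_injOn (f := fun y (i : Fin m) => c i (s i y))
        (t := {w | ∀ i, w i ∈ Iic n}) (fun y hy i => hy.2 i i.2) ?_
        (Set.Finite.pi' fun _ => finite_Iic n)
      intro y hy y' hy' h
      exact hinj m y y' (hy.1.symm.trans hy'.1) fun i hi => congrFun h ⟨i, hi⟩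
    refine ((finite_Iic n).biUnion fun m _ => hfin m).subset ?_
    rintro y ⟨m, hm, h, hl⟩
    exact mem_biUnion (mem_Iic.2 hm) ⟨h, fun i hi => (hl i hi).2⟩
  · rintro m n hmn x y ⟨k, hk, h, hl⟩
    exact ⟨k, hk.trans hmn, h, fun i hi => ⟨(hl i hi).1.trans hmn, (hl i hi).2.trans hmn⟩⟩
  · rintro ⟨m, h⟩
    obtain ⟨N, hN⟩ := ((finite_Iio m).image fun i => max (c i (s i x)) (c i (s i y))).bddAbove
    refine ⟨max m N, m, le_max_left _ _, h, fun i hi => ?_⟩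
    have := hN (mem_image_of_mem _ (mem_Iio.2 hi))
    exact ⟨(le_max_left _ _).trans (this.trans (le_max_right _ _)),
      (le_max_right _ _).trans (this.trans (le_max_right _ _))⟩
  · rintro ⟨n, m, -, h, -⟩
    exact ⟨m, h⟩

/-- Decreasing Borel sets that every forward orbit meets, and whose intersection consists of
periodic points, at most one in each orbit. -/
theorem exists_vanishing_markers {X : Type*} [MeasurableSpace X] [StandardBorelSpace X]
    {f : X → X} (hf : Measurable f) :
    ∃ A : ℕ → Set X, (∀ n, MeasurableSet (A n)) ∧ (∀ n, A (n + 1) ⊆ A n) ∧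
      (∀ n x, ∃ k, f^[k] x ∈ A n) ∧ (∀ x, (∀ n, x ∈ A n) → ∃ p, 0 < p ∧ f^[p] x = x) ∧
      ∀ x k, (∀ n, x ∈ A n) → (∀ n, f^[k] x ∈ A n) → f^[k] x = x := by
  obtain ⟨e, he⟩ := exists_measurableEmbedding_real X
  let φ : X → ℝ := fun x => Real.arctan (e x)
  have hφm : Measurable φ := Real.measurable_arctan.comp he.measurable
  have hφi : Function.Injective φ := Real.arctan_injective.comp he.injective
  let z : X → ℝ := fun x => liminf (fun k => φ (f^[k] x)) atTop
  have hzm : Measurable z := Measurable.liminf fun k => hφm.comp (hf.iterate k)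
  have hz : ∀ k x, z (f^[k] x) = z x := fun k x => by
    simp only [z, ← Function.iterate_add_apply]
    exact liminf_nat_add (fun i => φ (f^[i] x)) k
  have hfreq : ∀ x ε, 0 < ε → ∃ᶠ k in atTop, |φ (f^[k] x) - z x| < ε := by
    intro x ε hε
    have hbelow : IsBoundedUnder (· ≥ ·) atTop fun k => φ (f^[k] x) :=
      isBoundedUnder_of ⟨-(Real.pi / 2), fun k => (Real.neg_pi_div_two_lt_arctan _).le⟩
    have habove : IsBoundedUnder (· ≤ ·) atTop fun k => φ (f^[k] x) :=
      isBoundedUnder_of ⟨Real.pi / 2, fun k => (Real.arctan_lt_pi_div_two _).le⟩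
    have h₁ : ∃ᶠ k in atTop, φ (f^[k] x) < z x + ε :=
      frequently_lt_of_liminf_lt habove.isCoboundedUnder_ge (by simp only [z]; linarith)
    have h₂ : ∀ᶠ k in atTop, z x - ε < φ (f^[k] x) :=
      eventually_lt_of_lt_liminf (by simp only [z]; linarith) hbelow
    refine (h₁.and_eventually h₂).mono fun k hk => abs_lt.2 ⟨?_, ?_⟩ <;> linarith [hk.1, hk.2]
  have hlim : ∀ x, (∀ n : ℕ, |φ x - z x| < 1 / ((n : ℝ) + 1)) → φ x = z x := by
    intro x hx
    by_contra hne
    obtain ⟨n, hn⟩ := exists_nat_one_div_lt (abs_pos.2 (sub_ne_zero.2 hne))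
    exact absurd (hx n) hn.not_gt
  refine ⟨fun n => {x | |φ x - z x| < 1 / ((n : ℝ) + 1) ∧
    (φ x = z x → ∃ p, 0 < p ∧ f^[p] x = x)}, fun n => ?_, fun n x hx => ⟨?_, hx.2⟩, ?_,
    fun x hx => (hx 0).2 (hlim x fun n => (hx n).1), fun x k hx hx' => ?_⟩
  · have hper : MeasurableSet {x | ∃ p, 0 < p ∧ f^[p] x = x} := by
      simp only [ofPred_exists, ofPred_and]
      exact MeasurableSet.iUnion fun p => (MeasurableSet.const _).inter
        (measurableSet_eq_fun (hf.iterate p) measurable_id)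
    exact (measurableSet_lt (hφm.sub hzm).abs measurable_const).inter
      ((measurableSet_eq_fun hφm hzm).imp hper)
  · exact hx.1.trans_le (one_div_le_one_div_of_le (by positivity) (by push_cast; linarith))
  · intro n x
    by_contra! hcon
    have hA : ∀ k, |φ (f^[k] x) - z x| < 1 / ((n : ℝ) + 1) →
        φ (f^[k] x) = z x ∧ ∀ p, 0 < p → f^[p] (f^[k] x) ≠ f^[k] x := by
      intro k hk
      have := hcon k
      simp only [mem_ofPred_eq, hz, not_and, Classical.not_imp, not_exists] at this
      exact this hk
    have hio := frequently_atTop.1 (hfreq x (1 / ((n : ℝ) + 1)) (by positivity))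
    obtain ⟨k, -, hk⟩ := hio 0
    obtain ⟨l, hl, hl'⟩ := hio (k + 1)
    refine (hA k hk).2 (l - k) (by omega) (hφi ?_)
    rw [← Function.iterate_add_apply, Nat.sub_add_cancel (by omega), (hA k hk).1, (hA l hl').1]
  · refine hφi ?_
    rw [hlim _ fun n => (hx' n).1, hz, hlim _ fun n => (hx n).1]

/-- Let X be a standard Borel space and let f : X → X be a Borel function with
countable fibers.  Then the smallest equivalence relation containing (x, f(x)) for every
x ∈ X is hyperfinite. -/
theorem hyperfinite_of_generated_by_function
    {X : Type*} [MeasurableSpace X] [StandardBorelSpace X]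
    (f : X → X) (hf : Measurable f) (hfib : ∀ x, {y | f y = x}.Countable) :
    Hyperfinite (Relation.EqvGen fun x y => f x = y) := by
  classical
  obtain ⟨A, hAm, hA, hrec, hper, huniq⟩ := exists_vanishing_markers hf
  let hit : ℕ → X → X := fun n x => f^[Nat.find (hrec n x)] x
  let s : ℕ → X → X := fun n => Nat.casesOn n id hit
  have hitm : ∀ n, Measurable (hit n) := fun n =>
    Measurable.find (fun k => hf.iterate k) (fun k => hf.iterate k (hAm n)) (hrec n)
  have hit_self : ∀ n x, x ∈ A n → hit n x = x := fun n x hx => by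
    have : Nat.find (hrec n x) = 0 := (Nat.find_eq_zero _).2 hx
    simp only [hit, this, Function.iterate_zero, id]
  have hit_succ : ∀ n x, x ∉ A n → hit n (f x) = hit n x := fun n x hx => by
    have : Nat.find (hrec n x) = Nat.find (hrec n (f x)) + 1 :=
      Nat.find_comp_succ (hrec n x) (hrec n (f x)) hx
    simp only [hit, this, Function.iterate_succ_apply]
  have hit_iterate : ∀ n k x, (∀ i < k, f^[i] x ∉ A n) → hit n (f^[k] x) = hit n x := by
    intro n k x hk
    induction k with
    | zero => rfl
    | succ k ih =>
      rw [Function.iterate_succ_apply', hit_succ n _ (hk k (by omega)),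
        ih fun i hi => hk i (by omega)]
  have hcomp : ∀ n x, s (n + 1) (s n x) = s (n + 1) x := by
    rintro (_ | n) x
    · rfl
    · exact hit_iterate (n + 1) _ x fun i hi h => Nat.find_min (hrec n x) hi (hA n h)
  have hEs : ∀ n x, Relation.EqvGen (fun x y => f x = y) x (s n x) := by
    have hiter : ∀ k x, Relation.EqvGen (fun x y => f x = y) x (f^[k] x) := by
      intro k x
      induction k with
      | zero => exact .refl _
      | succ k ih =>
        rw [Function.iterate_succ_apply']
        exact ih.trans _ _ _ (.rel _ _ rfl)
    rintro (_ | n) x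
    · exact .refl _
    · exact hiter _ x
  have hcount : ∀ k y, {x | f^[k] x = y}.Countable := by
    intro k
    induction k with
    | zero => exact fun y => by simp
    | succ k ih =>
      intro y
      refine ((hfib y).biUnion fun w _ => ih w).mono fun x hx => ?_
      exact mem_biUnion (x := f^[k] x) (by rwa [mem_ofPred_eq, ← Function.iterate_succ_apply' f])
        rfl
  have hmono {m n : ℕ} {x y : X} := eq_of_coherent_of_le hcomp (m := m) (n := n) (x := x) (y := y)
  have htrans : ∀ {x y w}, (∃ n, s n x = s n y) → (∃ n, s n y = s n w) →
      ∃ n, s n x = s n w := by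
    rintro x y w ⟨m, h⟩ ⟨n, h'⟩
    exact ⟨max m n, (hmono (le_max_left _ _) h).trans (hmono (le_max_right _ _) h')⟩
  have hstep' : ∀ x, (∃ n, x ∉ A n) → ∃ n, s n x = s n (f x) := by
    rintro x ⟨n, hn⟩
    exact ⟨n + 1, (hit_succ n x hn).symm⟩
  have hstep : ∀ x, ∃ n, s n x = s n (f x) := by
    intro x
    by_cases hx : ∃ n, x ∉ A n
    · exact hstep' x hx
    push Not at hx
    have hchain : ∀ i, (∃ n, s n x = s n (f x)) ∨ ∃ n, s n (f x) = s n (f^[i + 1] x) := by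
      intro i
      induction i with
      | zero => exact .inr ⟨0, rfl⟩
      | succ i ih =>
        rcases ih with h | h
        · exact .inl h
        by_cases hi : ∃ n, f^[i + 1] x ∉ A n
        · rw [Function.iterate_succ_apply' f (i + 1)]
          exact .inr (htrans h (hstep' _ hi))
        · push Not at hi
          rw [huniq x (i + 1) hx hi] at h
          exact .inl (h.imp fun _ => Eq.symm)
    obtain ⟨p, hp, hpx⟩ := hper x hx
    rcases hchain (p - 1) with h | h
    · exact h
    · rw [Nat.sub_add_cancel hp, hpx] at h
      exact h.imp fun _ => Eq.symm
  have key : (Relation.EqvGen fun x y => f x = y) = fun x y => ∃ n, s n x = s n y := by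
    ext x y
    constructor
    · intro h
      induction h with
      | rel x y h => exact h ▸ hstep x
      | refl x => exact ⟨0, rfl⟩
      | symm x y _ ih => exact ih.imp fun _ => Eq.symm
      | trans x y w _ _ ih ih' => exact htrans ih ih'
    · rintro ⟨n, h⟩
      exact (h ▸ hEs n x).trans _ _ _ ((hEs n y).symm _ _)
  rw [key]
  refine hyperfinite_of_coherent_maps s ?_ ?_ (fun _ => rfl) hcomp
  · rintro (_ | n)
    · exact measurable_id
    · exact hitm n
  · rintro (_ | n) y
    · simp [s]
    · refine (countable_iUnion fun k => hcount k y).mono fun x hx => ?_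
      exact mem_iUnion.2 ⟨Nat.find (hrec n x), hx⟩
end

section
/- Tail equivalence on the space 2^ℕ of infinite binary sequences — the relation E defined by x E y if and only if there exist m and n such that x(m + i) = y(n + i) for all i — is hyperfinite. -/
open Filter Function Set

section Markers

variable {X : Type*} {f : X → X} {A : ℕ → Set X}

open Classical in
/-- The first time at which the forward `f`-orbit of `x` meets `A m`. -/
noncomputable def hitTime (hA : ∀ m x, ∃ k, f^[k] x ∈ A m) (m : ℕ) (x : X) : ℕ :=
  Nat.find (hA m x)

/-- The first point of `A m` on the forward `f`-orbit of `x`. -/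
noncomputable def hitPoint (hA : ∀ m x, ∃ k, f^[k] x ∈ A m) (m : ℕ) (x : X) : X :=
  f^[hitTime hA m x] x

/-- The time needed to travel from the first point of `A m` to the first point of `A (m + 1)`
on the forward `f`-orbit of `x`. -/
noncomputable def hitGap (hA : ∀ m x, ∃ k, f^[k] x ∈ A m) (m : ℕ) (x : X) : ℕ :=
  hitTime hA (m + 1) (hitPoint hA m x)

/-- Two points are related at stage `n` if, for some `m ≤ n`, their orbits enter `A m` at the same
point, and reach it through `A 0, …, A (m - 1)` with gaps bounded by `n`. -/
def MarkerRel (hA : ∀ m x, ∃ k, f^[k] x ∈ A m) (n : ℕ) (x y : X) : Prop :=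
  ∃ m ≤ n, hitPoint hA m x = hitPoint hA m y ∧
    ∀ i < m, hitGap hA i x ≤ n ∧ hitGap hA i y ≤ n

variable (hA : ∀ m x, ∃ k, f^[k] x ∈ A m)

lemma hitTime_eq_zero {m : ℕ} {x : X} (hx : x ∈ A m) : hitTime hA m x = 0 := by
  classical
  exact (Nat.find_eq_zero _).2 hx

lemma hitPoint_of_mem {m : ℕ} {x : X} (hx : x ∈ A m) : hitPoint hA m x = x := by
  simp [hitPoint, hitTime_eq_zero hA hx]

lemma hitTime_add {m a : ℕ} {x : X} (h : ∀ i < a, f^[i] x ∉ A m) :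
    hitTime hA m x = a + hitTime hA m (f^[a] x) := by
  classical
  refine (Nat.find_eq_iff _).2 ⟨?_, fun k hk => ?_⟩
  · have := Nat.find_spec (hA m (f^[a] x))
    rwa [← iterate_add_apply, add_comm] at this
  · rcases lt_or_ge k a with hka | hka
    · exact h k hka
    · obtain ⟨j, rfl⟩ := Nat.exists_eq_add_of_le hka
      have := Nat.find_min (hA m (f^[a] x)) (m := j) (by unfold hitTime at hk; omega)
      rwa [← iterate_add_apply, add_comm] at this

lemma hitPoint_iterate {m a : ℕ} {x : X} (h : ∀ i < a, f^[i] x ∉ A m) :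
    hitPoint hA m x = hitPoint hA m (f^[a] x) := by
  rw [hitPoint, hitTime_add hA h, hitPoint, ← iterate_add_apply, add_comm]

lemma iterate_notMem_succ (anti : Antitone A) {m : ℕ} {x : X} :
    ∀ i < hitTime hA m x, f^[i] x ∉ A (m + 1) := by
  classical
  exact fun i hi h => Nat.find_min (hA m x) hi (anti m.le_succ h)

lemma hitTime_succ (anti : Antitone A) (m : ℕ) (x : X) :
    hitTime hA (m + 1) x = hitTime hA m x + hitGap hA m x :=
  hitTime_add hA (iterate_notMem_succ hA anti)

lemma hitPoint_succ (anti : Antitone A) (m : ℕ) (x : X) :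
    hitPoint hA (m + 1) x = hitPoint hA (m + 1) (hitPoint hA m x) :=
  hitPoint_iterate hA (iterate_notMem_succ hA anti)

lemma hitPoint_eq_of_le (anti : Antitone A) {m i : ℕ} (hmi : m ≤ i) {x y : X}
    (h : hitPoint hA m x = hitPoint hA m y) : hitPoint hA i x = hitPoint hA i y := by
  induction i, hmi using Nat.le_induction with
  | base => exact h
  | succ i _ ih => rw [hitPoint_succ hA anti, ih, ← hitPoint_succ hA anti]

lemma hitTime_le (h0 : A 0 = univ) (anti : Antitone A) {m n : ℕ} {x : X}
    (h : ∀ i < m, hitGap hA i x ≤ n) : hitTime hA m x ≤ m * n := by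
  induction m with
  | zero => rw [hitTime_eq_zero hA (by simp [h0])]; simp
  | succ m ih =>
    rw [hitTime_succ hA anti, Nat.succ_mul]
    exact Nat.add_le_add (ih fun i hi => h i (by omega)) (h m (by omega))

lemma MarkerRel.symm {n : ℕ} {x y : X} : MarkerRel hA n x y → MarkerRel hA n y x :=
  fun ⟨m, hm, h, hb⟩ => ⟨m, hm, h.symm, fun i hi => (hb i hi).symm⟩

lemma MarkerRel.equivalence (anti : Antitone A) (n : ℕ) : Equivalence (MarkerRel hA n) := by
  have key : ∀ {x y z : X} {m m' : ℕ}, m ≤ m' → m' ≤ n →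
      hitPoint hA m x = hitPoint hA m y → (∀ i < m, hitGap hA i x ≤ n ∧ hitGap hA i y ≤ n) →
      hitPoint hA m' y = hitPoint hA m' z → (∀ i < m', hitGap hA i y ≤ n ∧ hitGap hA i z ≤ n) →
      MarkerRel hA n x z := by
    intro x y z m m' hmm hm' hxy bxy hyz byz
    refine ⟨m', hm', (hitPoint_eq_of_le hA anti hmm hxy).trans hyz,
      fun i hi => ⟨?_, (byz i hi).2⟩⟩
    rcases lt_or_ge i m with him | him
    · exact (bxy i him).1
    · rw [hitGap, hitPoint_eq_of_le hA anti him hxy]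
      exact (byz i hi).1
  refine ⟨fun x => ⟨0, n.zero_le, rfl, by simp⟩, fun h => h.symm, ?_⟩
  rintro x y z ⟨m, hm, hxy, bxy⟩ ⟨m', hm', hyz, byz⟩
  rcases le_total m m' with hmm | hmm
  · exact key hmm hm' hxy bxy hyz byz
  · exact (key hmm hm hyz.symm (fun i hi => (byz i hi).symm) hxy.symm
      fun i hi => (bxy i hi).symm).symm

lemma MarkerRel.mono {m n : ℕ} (hmn : m ≤ n) {x y : X} :
    MarkerRel hA m x y → MarkerRel hA n x y :=
  fun ⟨k, hk, h, hb⟩ => ⟨k, hk.trans hmn, h, fun i hi =>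
    ⟨(hb i hi).1.trans hmn, (hb i hi).2.trans hmn⟩⟩

lemma MarkerRel.exists_iterate_eq {n : ℕ} {x y : X} :
    MarkerRel hA n x y → ∃ a b, f^[a] x = f^[b] y :=
  fun ⟨_, _, h, _⟩ => ⟨_, _, h⟩

lemma MarkerRel.finite (h0 : A 0 = univ) (anti : Antitone A)
    (hf : ∀ y, (f ⁻¹' {y}).Finite) (n : ℕ) (x : X) : {y | MarkerRel hA n x y}.Finite := by
  have hfk : ∀ k y, (f^[k] ⁻¹' {y}).Finite := by
    intro k
    induction k with
    | zero => simp
    | succ k ih =>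
      intro y
      rw [iterate_succ', preimage_comp]
      exact (hf y).preimage' fun z _ => ih z
  refine ((finite_Iic n).biUnion fun m _ => (finite_Iic (n * n)).biUnion fun t _ =>
    hfk t (hitPoint hA m x)).subset ?_
  rintro y ⟨m, hm, h, hb⟩
  simp only [mem_iUnion]
  exact ⟨m, hm, hitTime hA m y,
    (hitTime_le hA h0 anti fun i hi => (hb i hi).2).trans (Nat.mul_le_mul_right n hm), h.symm⟩

lemma exists_markerRel (anti : Antitone A) {x y : X} (hx : ∀ i, ∃ m, f^[i] x ∉ A m)
    (hy : ∀ i, ∃ m, f^[i] y ∉ A m) {a b : ℕ} (h : f^[a] x = f^[b] y) :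
    ∃ n, MarkerRel hA n x y := by
  have leave : ∀ {z : X} (c : ℕ), (∀ i, ∃ m, f^[i] z ∉ A m) →
      ∃ M, ∀ m ≥ M, ∀ i < c, f^[i] z ∉ A m := by
    intro z c hz
    choose M hM using hz
    refine ⟨(Finset.range c).sup M, fun m hm i hi hmem => hM i (anti ?_ hmem)⟩
    exact (Finset.le_sup (Finset.mem_range.2 hi)).trans hm
  obtain ⟨M, hM⟩ := leave a hx
  obtain ⟨N, hN⟩ := leave b hy
  let m := max M N
  let s : Finset ℕ := Finset.range m
  refine ⟨m + s.sup (fun i => hitGap hA i x) + s.sup (fun i => hitGap hA i y), m, by omega, ?_,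
    fun i hi => ⟨?_, ?_⟩⟩
  · rw [hitPoint_iterate hA (hM m (le_max_left _ _)), h,
      ← hitPoint_iterate hA (hN m (le_max_right _ _))]
  · have := Finset.le_sup (f := fun i => hitGap hA i x) (Finset.mem_range.2 hi)
    simp only [s]; omega
  · have := Finset.le_sup (f := fun i => hitGap hA i y) (Finset.mem_range.2 hi)
    simp only [s]; omega

variable [MeasurableSpace X]

lemma measurable_hitTime (hf : Measurable f) (mA : ∀ m, MeasurableSet (A m)) (m : ℕ) :
    Measurable (hitTime hA m) := by
  classical
  exact measurable_find (hA m) fun k => hf.iterate k (mA m)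

lemma measurable_hitPoint (hf : Measurable f) (mA : ∀ m, MeasurableSet (A m)) (m : ℕ) :
    Measurable (hitPoint hA m) := by
  have : Measurable fun p : X × ℕ => f^[p.2] p.1 :=
    measurable_from_prod_countable_left fun k => hf.iterate k
  exact this.comp (measurable_id.prodMk (measurable_hitTime hA hf mA m))

lemma measurable_hitGap (hf : Measurable f) (mA : ∀ m, MeasurableSet (A m)) (m : ℕ) :
    Measurable (hitGap hA m) :=
  (measurable_hitTime hA hf mA (m + 1)).comp (measurable_hitPoint hA hf mA m)

lemma MarkerRel.measurableSet [MeasurableEq X] (hf : Measurable f)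
    (mA : ∀ m, MeasurableSet (A m)) (n : ℕ) :
    MeasurableSet {p : X × X | MarkerRel hA n p.1 p.2} := by
  have hP := measurable_hitPoint hA hf mA
  have hG := measurable_hitGap hA hf mA
  simp only [MarkerRel, ofPred_exists]
  refine MeasurableSet.iUnion fun m => (MeasurableSet.const _).inter <| MeasurableSet.inter
    (measurableSet_eq_fun ((hP m).comp measurable_fst) ((hP m).comp measurable_snd)) ?_
  change MeasurableSet {p : X × X | ∀ i < m, hitGap hA i p.1 ≤ n ∧ hitGap hA i p.2 ≤ n}
  simp only [ofPred_forall]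
  exact MeasurableSet.iInter fun i => MeasurableSet.iInter fun _ => MeasurableSet.inter
    (measurableSet_le ((hG i).comp measurable_fst) measurable_const)
    (measurableSet_le ((hG i).comp measurable_snd) measurable_const)

end Markers

section Shift

/-- The one-sided shift on binary sequences. -/
def shift (x : ℕ → Bool) : ℕ → Bool := fun i => x (i + 1)

lemma shift_iterate (k : ℕ) (x : ℕ → Bool) (i : ℕ) : shift^[k] x i = x (k + i) := by
  induction k generalizing x with
  | zero => simp
  | succ k ih => rw [iterate_succ_apply, ih, shift]; congr 1; omega

lemma measurable_shift : Measurable shift :=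
  measurable_pi_lambda _ fun i => measurable_pi_apply (i + 1)

lemma finite_shift_fiber (y : ℕ → Bool) : (shift ⁻¹' {y}).Finite := by
  refine Set.Finite.of_finite_image (f := fun x => x 0) (toFinite _) ?_
  intro x hx z hz h
  funext i
  cases i with
  | zero => exact h
  | succ i => exact congrFun (hx.trans hz.symm) i

/-- The sequences whose preperiod and period are bounded in terms of `n`. -/
def periodicStage (n : ℕ) : Set (ℕ → Bool) :=
  {x | ∃ a ≤ n, ∃ b ≤ n, shift^[a] x = shift^[a + b + 1] x}

lemma periodicStage_mono : Monotone periodicStage :=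
  fun _ _ h _ ⟨a, ha, b, hb, hx⟩ => ⟨a, ha.trans h, b, hb.trans h, hx⟩

lemma finite_periodicStage (n : ℕ) : (periodicStage n).Finite := by
  have key : ∀ a b, {x : ℕ → Bool | shift^[a] x = shift^[a + b + 1] x}.Finite := by
    intro a b
    refine Set.Finite.of_finite_image (f := fun x (i : Fin (a + b + 1)) => x i) (toFinite _) ?_
    intro x hx y hy hxy
    funext i
    induction i using Nat.strong_induction_on with
    | _ i ih =>
      rcases lt_or_ge i (a + b + 1) with hi | hi
      · exact congrFun hxy ⟨i, hi⟩
      · obtain ⟨j, rfl⟩ := Nat.exists_eq_add_of_le hi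
        have h1 := congrFun hx j
        have h2 := congrFun hy j
        simp only [shift_iterate] at h1 h2
        rw [← h1, ← h2, ih (a + j) (by omega)]
  refine ((finite_Iic n).biUnion fun a _ => (finite_Iic n).biUnion fun b _ => key a b).subset ?_
  rintro x ⟨a, ha, b, hb, hx⟩
  simp only [mem_iUnion]
  exact ⟨a, ha, b, hb, hx⟩

/-- The eventually periodic sequences. -/
def eventuallyPeriodic : Set (ℕ → Bool) := ⋃ n, periodicStage n

lemma mem_eventuallyPeriodic {x : ℕ → Bool} {a b : ℕ} (hab : a < b)
    (h : shift^[a] x = shift^[b] x) : x ∈ eventuallyPeriodic := by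
  obtain ⟨c, rfl⟩ := Nat.exists_eq_add_of_lt hab
  exact mem_iUnion.2 ⟨max a c, a, le_max_left _ _, c, le_max_right _ _, h⟩

lemma measurableSet_eventuallyPeriodic : MeasurableSet eventuallyPeriodic :=
  MeasurableSet.iUnion fun n => (finite_periodicStage n).measurableSet

lemma eventuallyPeriodic_of_iterate_eq {x y : ℕ → Bool} {a b : ℕ}
    (h : shift^[a] x = shift^[b] y) (hx : x ∈ eventuallyPeriodic) : y ∈ eventuallyPeriodic := by
  obtain ⟨n, c, -, d, -, hcd⟩ := mem_iUnion.1 hx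
  refine mem_eventuallyPeriodic (a := c + b) (b := c + d + 1 + b) (by omega) ?_
  rw [iterate_add_apply, ← h, ← iterate_add_apply, add_comm, iterate_add_apply, hcd,
    ← iterate_add_apply, add_comm, iterate_add_apply, h, ← iterate_add_apply]

lemma iterate_mem_eventuallyPeriodic_iff {x : ℕ → Bool} (k : ℕ) :
    shift^[k] x ∈ eventuallyPeriodic ↔ x ∈ eventuallyPeriodic :=
  ⟨eventuallyPeriodic_of_iterate_eq (a := 0) (b := k) rfl,
    eventuallyPeriodic_of_iterate_eq (a := k) (b := 0) rfl⟩

/-- The sequences starting with the lexicographically least word of length `m` among those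
that occur infinitely often in them. -/
def leastWord : ℕ → Set (ℕ → Bool)
  | 0 => univ
  | m + 1 => {x | x ∈ leastWord m ∧
      (x m = false ↔ ∃ᶠ j in atTop, shift^[j] x ∈ leastWord m ∧ shift^[j] x m = false)}

lemma frequently_iterate_shift (S : Set (ℕ → Bool)) (k : ℕ) (x : ℕ → Bool) :
    (∃ᶠ j in atTop, shift^[j] (shift^[k] x) ∈ S) ↔ ∃ᶠ j in atTop, shift^[j] x ∈ S := by
  simp only [← iterate_add_apply]
  rw [← frequently_map (m := fun j => j + k) (P := fun j => shift^[j] x ∈ S), map_add_atTop_eq_nat]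

lemma frequently_iterate_leastWord (m : ℕ) (x : ℕ → Bool) :
    ∃ᶠ j in atTop, shift^[j] x ∈ leastWord m := by
  induction m with
  | zero => exact Eventually.frequently (Eventually.of_forall fun _ => mem_univ _)
  | succ m ih =>
    have inv := fun k => frequently_iterate_shift {y | y ∈ leastWord m ∧ y m = false} k x
    simp only [mem_ofPred_eq] at inv
    simp only [leastWord, mem_ofPred_eq, inv]
    by_cases h : ∃ᶠ j in atTop, shift^[j] x ∈ leastWord m ∧ shift^[j] x m = false
    · simp only [h, iff_true]
    · simp only [h, iff_false]
      refine (ih.and_eventually (not_frequently.1 h)).mono fun j hj => ⟨hj.1, fun h' => ?_⟩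
      exact hj.2 ⟨hj.1, h'⟩

lemma leastWord_antitone : Antitone leastWord :=
  antitone_nat_of_succ_le fun _ _ hx => hx.1

lemma measurableSet_leastWord (m : ℕ) : MeasurableSet (leastWord m) := by
  induction m with
  | zero => exact MeasurableSet.univ
  | succ m ih =>
    have hm : MeasurableSet {x : ℕ → Bool | x m = false} :=
      measurableSet_eq_fun (measurable_pi_apply m) measurable_const
    refine ih.inter (hm.iff ?_)
    simp only [frequently_atTop, ofPred_forall, ofPred_exists]
    refine MeasurableSet.iInter fun a => MeasurableSet.iUnion fun j =>
      (MeasurableSet.const _).inter ?_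
    exact measurable_shift.iterate j (ih.inter hm)

lemma iterate_eq_of_mem_leastWord {x : ℕ → Bool} {k : ℕ} (hx : ∀ m, x ∈ leastWord m)
    (hk : ∀ m, shift^[k] x ∈ leastWord m) : shift^[k] x = x := by
  funext m
  have h1 := (hx (m + 1)).2
  have h2 := (hk (m + 1)).2
  have inv := frequently_iterate_shift {y | y ∈ leastWord m ∧ y m = false} k x
  simp only [mem_ofPred_eq] at inv
  rw [inv, ← h1] at h2
  exact Bool.eq_iff_iff.2 (by simpa using not_congr h2)

/-- Markers for the shift that every orbit meets and that vanish off the eventually periodic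
sequences. -/
def shiftMarker (m : ℕ) : Set (ℕ → Bool) :=
  {x | m = 0 ∨ x ∈ eventuallyPeriodic ∨ (x ∈ leastWord m ∧ ∃ i, x ∉ leastWord i)}

lemma shiftMarker_zero : shiftMarker 0 = univ := by simp [shiftMarker]

lemma shiftMarker_antitone : Antitone shiftMarker := by
  intro m n hmn x hx
  rcases hx with hx | hx | hx
  · exact Or.inl (by omega)
  · exact Or.inr (Or.inl hx)
  · exact Or.inr (Or.inr ⟨leastWord_antitone hmn hx.1, hx.2⟩)

lemma measurableSet_shiftMarker (m : ℕ) : MeasurableSet (shiftMarker m) := by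
  have h : MeasurableSet {x | ∃ i, x ∉ leastWord i} := by
    simp only [ofPred_exists]
    exact MeasurableSet.iUnion fun i => (measurableSet_leastWord i).compl
  exact (MeasurableSet.const _).union (measurableSet_eventuallyPeriodic.union
    ((measurableSet_leastWord m).inter h))

lemma exists_iterate_mem_shiftMarker (m : ℕ) (x : ℕ → Bool) :
    ∃ k, shift^[k] x ∈ shiftMarker m := by
  by_contra! hcon
  have hx : x ∉ eventuallyPeriodic := fun hx => hcon 0 (Or.inr (Or.inl hx))
  have all : ∀ k, shift^[k] x ∈ leastWord m → ∀ i, shift^[k] x ∈ leastWord i := by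
    intro k hk
    by_contra! h
    exact hcon k (Or.inr (Or.inr ⟨hk, h⟩))
  have freq := frequently_atTop.1 (frequently_iterate_leastWord m x)
  obtain ⟨j, -, hj⟩ := freq 0
  obtain ⟨k, hjk, hk⟩ := freq (j + 1)
  have hkj : shift^[k] x = shift^[k - j] (shift^[j] x) := by
    rw [← iterate_add_apply, Nat.sub_add_cancel (by omega)]
  refine hx (mem_eventuallyPeriodic (show j < k by omega) ?_)
  rw [hkj]
  exact (iterate_eq_of_mem_leastWord (all j hj) fun i => hkj ▸ all k hk i).symm

lemma exists_notMem_shiftMarker {x : ℕ → Bool} (hx : x ∉ eventuallyPeriodic) :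
    ∃ m, x ∉ shiftMarker m := by
  by_cases h : ∃ i, x ∉ leastWord i
  · obtain ⟨i, hi⟩ := h
    refine ⟨i + 1, ?_⟩
    rintro (h | h | h)
    · omega
    · exact hx h
    · exact hi (leastWord_antitone i.le_succ h.1)
  · exact ⟨1, by simp [shiftMarker, hx, h]⟩

/-- The stage-`n` relation on the shift obtained from the markers. -/
abbrev ShiftRel : ℕ → (ℕ → Bool) → (ℕ → Bool) → Prop :=
  MarkerRel exists_iterate_mem_shiftMarker

lemma ShiftRel.eq_of_eventuallyPeriodic {n : ℕ} {x y : ℕ → Bool} (h : ShiftRel n x y)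
    (hx : x ∈ eventuallyPeriodic) : x = y := by
  obtain ⟨a, b, hab⟩ := h.exists_iterate_eq
  have hy := eventuallyPeriodic_of_iterate_eq hab hx
  obtain ⟨m, -, h, -⟩ := h
  rwa [hitPoint_of_mem _ (Or.inr (Or.inl hx)), hitPoint_of_mem _ (Or.inr (Or.inl hy))] at h

end Shift

/-- Tail equivalence on the space 2^ℕ of infinite binary sequences — x E y iff
there exist m and n with x(m + i) = y(n + i) for all i — is hyperfinite. -/
theorem tail_equivalence_hyperfinite :
    Hyperfinite (fun x y : ℕ → Bool => ∃ m n : ℕ, ∀ i : ℕ, x (m + i) = y (n + i)) := by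
  have tail_iff : ∀ x y : ℕ → Bool, (∃ m n : ℕ, ∀ i : ℕ, x (m + i) = y (n + i)) ↔
      ∃ m n, shift^[m] x = shift^[n] y := by
    simp only [funext_iff, shift_iterate, implies_true]
  have periodic : ∀ {n x}, x ∈ periodicStage n → x ∈ eventuallyPeriodic :=
    fun h => mem_iUnion.2 ⟨_, h⟩
  have tail_trans : ∀ {x y z : ℕ → Bool}, (∃ m n, shift^[m] x = shift^[n] y) →
      (∃ m n, shift^[m] y = shift^[n] z) → ∃ m n, shift^[m] x = shift^[n] z := by
    rintro x y z ⟨a, b, h⟩ ⟨c, d, h'⟩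
    refine ⟨c + a, b + d, ?_⟩
    rw [iterate_add_apply, h, ← iterate_add_apply, add_comm, iterate_add_apply, h',
      ← iterate_add_apply]
  simp only [tail_iff]
  refine ⟨fun n x y => ShiftRel n x y ∨
    (x ∈ periodicStage n ∧ y ∈ periodicStage n ∧ ∃ a b, shift^[a] x = shift^[b] y),
    fun n => ?_, fun n => ?_, fun n x => ?_, ?_, fun x y => ⟨fun h => ?_, ?_⟩⟩
  · have eqv := MarkerRel.equivalence exists_iterate_mem_shiftMarker shiftMarker_antitone n
    refine ⟨fun x => Or.inl (eqv.refl x), ?_, ?_⟩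
    · rintro x y (h | ⟨hx, hy, a, b, h⟩)
      · exact Or.inl (eqv.symm h)
      · exact Or.inr ⟨hy, hx, b, a, h.symm⟩
    · rintro x y z (h | ⟨hx, hy, h⟩) (h' | ⟨hy', hz, h'⟩)
      · exact Or.inl (eqv.trans h h')
      · obtain rfl := ShiftRel.eq_of_eventuallyPeriodic (eqv.symm h) (periodic hy')
        exact Or.inr ⟨hy', hz, h'⟩
      · obtain rfl := h'.eq_of_eventuallyPeriodic (periodic hy)
        exact Or.inr ⟨hx, hy, h⟩
      · exact Or.inr ⟨hx, hz, tail_trans h h'⟩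
  · refine (MarkerRel.measurableSet _ measurable_shift measurableSet_shiftMarker n).union ?_
    refine (((finite_periodicStage n).prod (finite_periodicStage n)).subset ?_).measurableSet
    exact fun p hp => ⟨hp.1, hp.2.1⟩
  · refine ((MarkerRel.finite exists_iterate_mem_shiftMarker shiftMarker_zero shiftMarker_antitone
      finite_shift_fiber n x).union (finite_periodicStage n)).subset ?_
    exact fun y hy => hy.imp id fun h => h.2.1
  · exact fun m n hmn x y h => h.imp (MarkerRel.mono _ hmn)
      fun ⟨hx, hy, h⟩ => ⟨periodicStage_mono hmn hx, periodicStage_mono hmn hy, h⟩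
  · obtain ⟨a, b, hab⟩ := h
    by_cases hx : x ∈ eventuallyPeriodic
    · obtain ⟨k, hk⟩ := mem_iUnion.1 hx
      obtain ⟨l, hl⟩ := mem_iUnion.1 (eventuallyPeriodic_of_iterate_eq hab hx)
      exact ⟨max k l, Or.inr ⟨periodicStage_mono (le_max_left _ _) hk,
        periodicStage_mono (le_max_right _ _) hl, a, b, hab⟩⟩
    · have hy : y ∉ eventuallyPeriodic :=
        fun hy => hx (eventuallyPeriodic_of_iterate_eq hab.symm hy)
      obtain ⟨n, hn⟩ := exists_markerRel exists_iterate_mem_shiftMarker shiftMarker_antitone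
        (fun i => exists_notMem_shiftMarker (mt (iterate_mem_eventuallyPeriodic_iff i).1 hx))
        (fun i => exists_notMem_shiftMarker (mt (iterate_mem_eventuallyPeriodic_iff i).1 hy)) hab
      exact ⟨n, Or.inl hn⟩
  · rintro ⟨n, h | h⟩
    · exact h.exists_iterate_eq
    · exact h.2.2
end

section
/- (Slaman–Steel, Weiss) If T : X → X is a Borel bijection of a standard Borel space X (equivalently, a Borel action of ℤ on X), then the orbit equivalence relation E = {(x, y) : ∃ n ∈ ℤ, Tⁿ(x) = y} is hyperfinite. -/
open Filter

section ZOrbits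

variable {X : Type*}

lemma Equiv.Perm.zpow_apply_zpow_apply (T : Equiv.Perm X) (a b : ℤ) (x : X) :
    (T ^ a) ((T ^ b) x) = (T ^ (a + b)) x := by
  rw [zpow_add, Equiv.Perm.mul_apply]

lemma Equiv.Perm.finite_range_zpow_apply (T : Equiv.Perm X) (x : X)
    (h : ¬ Function.Injective fun k : ℤ => (T ^ k) x) :
    (Set.range fun k : ℤ => (T ^ k) x).Finite := by
  obtain ⟨p, hp, hpx⟩ : ∃ p : ℤ, 0 < p ∧ (T ^ p) x = x := by
    have key : ∀ a b : ℤ, a < b → (T ^ a) x = (T ^ b) x → ∃ p : ℤ, 0 < p ∧ (T ^ p) x = x := by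
      intro a b hab h
      refine ⟨b - a, by omega, ?_⟩
      have h' := congrArg (T ^ (-a)) h
      rw [T.zpow_apply_zpow_apply, T.zpow_apply_zpow_apply] at h'
      rw [show b - a = -a + b by ring, ← h']
      simp
    simp only [Function.Injective, not_forall] at h
    obtain ⟨a, b, hab, hne⟩ := h
    rcases lt_or_gt_of_ne hne with hlt | hlt
    · exact key a b hlt hab
    · exact key b a hlt hab.symm
  refine ((Set.finite_Ico (0 : ℤ) p).image fun k => (T ^ k) x).subset ?_
  rintro _ ⟨k, rfl⟩
  refine ⟨k % p, ⟨Int.emod_nonneg _ hp.ne', Int.emod_lt_of_pos _ hp⟩, ?_⟩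
  have hper : (T ^ (p * (k / p))) x = x := by
    rw [zpow_mul]
    exact Equiv.Perm.zpow_apply_eq_self_of_apply_eq_self hpx _
  calc (T ^ (k % p)) x = (T ^ (k % p)) ((T ^ (p * (k / p))) x) := by rw [hper]
    _ = (T ^ k) x := by rw [T.zpow_apply_zpow_apply, Int.emod_add_mul_ediv]

/-- `y` is reached from `x` by iterating `T`, starting each step from a point outside `B`. -/
def ReachesAvoiding (T : Equiv.Perm X) (B : Set X) (x y : X) : Prop :=
  ∃ k : ℕ, (T ^ (k : ℤ)) x = y ∧ ∀ i : ℕ, i < k → (T ^ (i : ℤ)) x ∉ B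

lemma ReachesAvoiding.trans {T : Equiv.Perm X} {B : Set X} {x y z : X}
    (hxy : ReachesAvoiding T B x y) (hyz : ReachesAvoiding T B y z) :
    ReachesAvoiding T B x z := by
  obtain ⟨k, rfl, hk⟩ := hxy
  obtain ⟨l, rfl, hl⟩ := hyz
  refine ⟨l + k, by rw [T.zpow_apply_zpow_apply]; push_cast; rfl, fun i hi => ?_⟩
  by_cases hik : i < k
  · exact hk i hik
  · have := hl (i - k) (by omega)
    rwa [T.zpow_apply_zpow_apply, show ((i - k : ℕ) : ℤ) + k = i by omega] at this

lemma ReachesAvoiding.total_of_left {T : Equiv.Perm X} {B : Set X} {x y z : X}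
    (hy : ReachesAvoiding T B x y) (hz : ReachesAvoiding T B x z) :
    ReachesAvoiding T B y z ∨ ReachesAvoiding T B z y := by
  have key : ∀ k l : ℕ, k ≤ l → (∀ i : ℕ, i < l → (T ^ (i : ℤ)) x ∉ B) →
      ReachesAvoiding T B ((T ^ (k : ℤ)) x) ((T ^ (l : ℤ)) x) := by
    intro k l hkl hl
    refine ⟨l - k, ?_, fun i hi => ?_⟩
    · rw [T.zpow_apply_zpow_apply, show ((l - k : ℕ) : ℤ) + k = l by omega]
    · have := hl (i + k) (by omega)
      rwa [T.zpow_apply_zpow_apply, ← Nat.cast_add]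
  obtain ⟨k, rfl, hk⟩ := hy
  obtain ⟨l, rfl, hl⟩ := hz
  rcases le_total k l with h | h
  · exact Or.inl (key k l h hl)
  · exact Or.inr (key l k h hk)

lemma ReachesAvoiding.total_of_right {T : Equiv.Perm X} {B : Set X} {x y z : X}
    (hy : ReachesAvoiding T B y x) (hz : ReachesAvoiding T B z x) :
    ReachesAvoiding T B y z ∨ ReachesAvoiding T B z y := by
  have key : ∀ (y z : X) (k l : ℕ), k ≤ l → (T ^ (k : ℤ)) y = (T ^ (l : ℤ)) z →
      (∀ i : ℕ, i < l → (T ^ (i : ℤ)) z ∉ B) → ReachesAvoiding T B z y := by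
    intro y z k l hkl h hl
    refine ⟨l - k, ?_, fun i hi => hl i (by omega)⟩
    apply (T ^ (k : ℤ)).injective
    rw [h, T.zpow_apply_zpow_apply, show (k : ℤ) + (l - k : ℕ) = l by omega]
  obtain ⟨k, hkx, hk⟩ := hy
  obtain ⟨l, hlx, hl⟩ := hz
  rcases le_total k l with h | h
  · exact Or.inr (key y z k l h (hkx.trans hlx.symm) hl)
  · exact Or.inl (key z y l k h (hlx.trans hkx.symm) hk)

lemma equivalence_reachesAvoiding_or (T : Equiv.Perm X) (B : Set X) :
    Equivalence fun x y => ReachesAvoiding T B x y ∨ ReachesAvoiding T B y x where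
  refl x := Or.inl ⟨0, by simp, by simp⟩
  symm h := h.symm
  trans := by
    rintro x y z (hxy | hyx) (hyz | hzy)
    · exact Or.inl (hxy.trans hyz)
    · exact hxy.total_of_right hzy
    · exact hyx.total_of_left hyz
    · exact Or.inr (hzy.trans hyx)

lemma ReachesAvoiding.mono {T : Equiv.Perm X} {B C : Set X} (h : C ⊆ B) {x y : X}
    (hxy : ReachesAvoiding T B x y) : ReachesAvoiding T C x y := by
  obtain ⟨k, hk, hB⟩ := hxy
  exact ⟨k, hk, fun i hi hC => hB i hi (h hC)⟩

lemma finite_reachesAvoiding_or {T : Equiv.Perm X} {B : Set X} {x : X}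
    (hfwd : ∃ k : ℕ, (T ^ (k : ℤ)) x ∈ B) (hbwd : ∃ k : ℕ, (T ^ (-(k + 1 : ℤ))) x ∈ B) :
    {y | ReachesAvoiding T B x y ∨ ReachesAvoiding T B y x}.Finite := by
  obtain ⟨a, ha⟩ := hfwd
  obtain ⟨b, hb⟩ := hbwd
  refine ((Set.finite_Icc (-(b : ℤ)) a).image fun k => (T ^ k) x).subset ?_
  rintro y (⟨k, rfl, hk⟩ | ⟨k, rfl, hk⟩)
  · refine ⟨k, ⟨by omega, ?_⟩, rfl⟩
    by_contra hlt
    exact hk a (by omega) ha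
  · refine ⟨-k, ⟨?_, by omega⟩, by simp⟩
    by_contra hlt
    apply hk (k - (b + 1)) (by omega)
    rw [T.zpow_apply_zpow_apply] at hb
    rwa [show -((b : ℤ) + 1) + k = (k - (b + 1) : ℕ) by omega] at hb

variable [MeasurableSpace X]

lemma Equiv.Perm.measurable_zpow [StandardBorelSpace X] {T : Equiv.Perm X} (hT : Measurable T)
    (k : ℤ) : Measurable ⇑(T ^ k) := by
  have hpow : ∀ n : ℕ, Measurable ⇑(T ^ n) := by
    intro n
    rw [← Equiv.Perm.iterate_eq_pow]
    exact hT.iterate n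
  have hneg : ∀ n : ℕ, Measurable ⇑(T ^ n)⁻¹ := fun n =>
    ((hpow n).measurableEmbedding (T ^ n).injective).measurable_comp_iff.1 (by
      have : ⇑(T ^ n) ∘ ⇑(T ^ n)⁻¹ = id := by ext; simp
      rw [this]; exact measurable_id)
  cases k with
  | ofNat n => simpa using hpow n
  | negSucc n => simpa [zpow_negSucc] using hneg (n + 1)

/-- A vanishing sequence of markers that are met in both directions on every infinite orbit
witnesses hyperfiniteness. -/
lemma hyperfinite_of_markers [StandardBorelSpace X] {T : Equiv.Perm X} (hT : Measurable T)
    {B : ℕ → Set X} (hB : ∀ n, MeasurableSet (B n)) (hanti : Antitone B)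
    (hvanish : ∀ x, ∃ n, x ∉ B n)
    (hfwd : ∀ x, Function.Injective (fun k : ℤ => (T ^ k) x) → ∀ n, ∃ k : ℕ, (T ^ (k : ℤ)) x ∈ B n)
    (hbwd : ∀ x, Function.Injective (fun k : ℤ => (T ^ k) x) → ∀ n,
      ∃ k : ℕ, (T ^ (-(k + 1 : ℤ))) x ∈ B n) :
    Hyperfinite (fun x y : X => ∃ n : ℤ, (T ^ n) x = y) := by
  have hmeas : ∀ n, MeasurableSet {p : X × X | ReachesAvoiding T (B n) p.1 p.2} := by
    intro n
    simp only [ReachesAvoiding, Set.ofPred_exists, Set.ofPred_and, Set.ofPred_forall]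
    refine .iUnion fun k => .inter ?_ (.iInter fun i => .iInter fun _ => ?_)
    · exact measurableSet_eq_fun ((T.measurable_zpow hT k).comp measurable_fst) measurable_snd
    · exact ((T.measurable_zpow hT i).comp measurable_fst) (hB n).compl
  have hreach : ∀ (x : X) (k : ℕ), ∃ n, ReachesAvoiding T (B n) x ((T ^ (k : ℤ)) x) := by
    intro x k
    choose N hN using hvanish
    refine ⟨(Finset.range k).sup fun i => N ((T ^ (i : ℤ)) x), k, rfl, fun i hi hmem => ?_⟩
    exact hN _ (hanti (Finset.le_sup (f := fun i : ℕ => N ((T ^ (i : ℤ)) x))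
      (Finset.mem_range.2 hi)) hmem)
  refine ⟨fun n x y => ReachesAvoiding T (B n) x y ∨ ReachesAvoiding T (B n) y x,
    fun n => equivalence_reachesAvoiding_or T (B n),
    fun n => (hmeas n).union (measurable_swap (hmeas n)), fun n x => ?_,
    fun m n hmn x y => Or.imp (.mono (hanti hmn)) (.mono (hanti hmn)), fun x y => ⟨?_, ?_⟩⟩
  · by_cases hx : Function.Injective fun k : ℤ => (T ^ k) x
    · exact finite_reachesAvoiding_or (hfwd x hx n) (hbwd x hx n)
    · refine (T.finite_range_zpow_apply x hx).subset ?_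
      rintro y (⟨k, rfl, -⟩ | ⟨k, rfl, -⟩)
      · exact ⟨k, rfl⟩
      · exact ⟨-k, by simp⟩
  · rintro ⟨k, rfl⟩
    obtain ⟨l, rfl | rfl⟩ := k.eq_nat_or_neg
    · obtain ⟨n, hn⟩ := hreach x l
      exact ⟨n, Or.inl hn⟩
    · obtain ⟨n, hn⟩ := hreach ((T ^ (-(l : ℤ))) x) l
      rw [T.zpow_apply_zpow_apply, add_neg_cancel, zpow_zero, Equiv.Perm.one_apply] at hn
      exact ⟨n, Or.inr hn⟩
  · rintro ⟨n, ⟨k, rfl, -⟩ | ⟨k, rfl, -⟩⟩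
    · exact ⟨k, rfl⟩
    · exact ⟨-k, by simp⟩

/-- Markers are obtained as the points at which a bounded injective function is close, but not
equal, to its lower limit along the forward orbit. -/
lemma exists_forward_markers [StandardBorelSpace X] {T : Equiv.Perm X} (hT : Measurable T) :
    ∃ A : ℕ → Set X, (∀ n, MeasurableSet (A n)) ∧ Antitone A ∧ (∀ x, ∃ n, x ∉ A n) ∧
      ∀ x, Function.Injective (fun k : ℤ => (T ^ k) x) → ∀ n, ∃ k : ℕ, (T ^ (k : ℤ)) x ∈ A n := by
  obtain ⟨f, hf⟩ := MeasureTheory.exists_measurableEmbedding_real X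
  set g : X → ℝ := fun x => Real.arctan (f x)
  have hg : Measurable g := Real.measurable_arctan.comp hf.measurable
  have hginj : Function.Injective g := Real.arctan_injective.comp hf.injective
  set L : X → ℝ := fun x => liminf (fun k : ℕ => g ((T ^ (k : ℤ)) x)) atTop
  have hL : Measurable L := .liminf fun k => hg.comp (T.measurable_zpow hT k)
  have hLinv : ∀ x (k : ℕ), L ((T ^ (k : ℤ)) x) = L x := by
    intro x k
    have := liminf_nat_add (fun i : ℕ => g ((T ^ (i : ℤ)) x)) k
    simpa only [L, T.zpow_apply_zpow_apply, ← Nat.cast_add] using this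
  have hclose : ∀ x (ε : ℝ), 0 < ε → ∃ᶠ k : ℕ in atTop, |g ((T ^ (k : ℤ)) x) - L x| < ε := by
    intro x ε hε
    have hbelow : IsBoundedUnder (· ≥ ·) atTop fun k : ℕ => g ((T ^ (k : ℤ)) x) :=
      isBoundedUnder_of ⟨-(Real.pi / 2), fun k => (Real.neg_pi_div_two_lt_arctan _).le⟩
    have habove : IsBoundedUnder (· ≤ ·) atTop fun k : ℕ => g ((T ^ (k : ℤ)) x) :=
      isBoundedUnder_of ⟨Real.pi / 2, fun k => (Real.arctan_lt_pi_div_two _).le⟩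
    have hlow : ∀ᶠ k : ℕ in atTop, L x - ε < g ((T ^ (k : ℤ)) x) :=
      eventually_lt_of_lt_liminf (sub_lt_self _ hε) hbelow
    have hup : ∃ᶠ k : ℕ in atTop, g ((T ^ (k : ℤ)) x) < L x + ε :=
      frequently_lt_of_liminf_lt habove.isCoboundedUnder_ge (lt_add_of_pos_right _ hε)
    refine (hup.and_eventually hlow).mono fun k hk => ?_
    rw [abs_lt]
    constructor <;> linarith [hk.1, hk.2]
  refine ⟨fun n => {x | g x ≠ L x ∧ |g x - L x| < 1 / ((n : ℝ) + 1)}, fun n => ?_, ?_, fun x => ?_,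
    fun x hx n => ?_⟩
  · exact (measurableSet_eq_fun hg hL).compl.inter
      (measurableSet_lt (hg.sub hL).abs measurable_const)
  · rintro m n hmn x ⟨hne, hlt⟩
    exact ⟨hne, hlt.trans_le (Nat.one_div_le_one_div hmn)⟩
  · by_cases hx : g x = L x
    · exact ⟨0, fun h => h.1 hx⟩
    · obtain ⟨n, hn⟩ := exists_nat_one_div_lt (abs_pos.2 (sub_ne_zero.2 hx))
      exact ⟨n, fun h => hn.not_gt h.2⟩
  · have hfreq := hclose x (1 / ((n : ℝ) + 1)) Nat.one_div_pos_of_nat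
    rw [frequently_atTop] at hfreq
    obtain ⟨a, -, ha⟩ := hfreq 0
    obtain ⟨b, hab, hb⟩ := hfreq (a + 1)
    by_cases hga : g ((T ^ (a : ℤ)) x) = L x
    · refine ⟨b, ?_, by rwa [hLinv]⟩
      rw [hLinv]
      intro hgb
      have := hx (hginj (hga.trans hgb.symm))
      omega
    · exact ⟨a, by rwa [hLinv], by rwa [hLinv]⟩

/-- Forward recurrent markers can be enlarged to markers met in both directions: on an orbit where
some `A m` has a first point, add a shrinking sequence of left rays defined from the first point of
the first such `A m`. -/
lemma exists_two_sided_markers [StandardBorelSpace X] {T : Equiv.Perm X} (hT : Measurable T) :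
    ∃ B : ℕ → Set X, (∀ n, MeasurableSet (B n)) ∧ Antitone B ∧ (∀ x, ∃ n, x ∉ B n) ∧
      (∀ x, Function.Injective (fun k : ℤ => (T ^ k) x) → ∀ n,
        ∃ k : ℕ, (T ^ (k : ℤ)) x ∈ B n) ∧
      ∀ x, Function.Injective (fun k : ℤ => (T ^ k) x) → ∀ n,
        ∃ k : ℕ, (T ^ (-(k + 1 : ℤ))) x ∈ B n := by
  obtain ⟨A, hA, hanti, hvanish, hfwd⟩ := exists_forward_markers hT
  set P : ℕ → Set X := fun m => {x | ∀ k : ℕ, (T ^ (-(k : ℤ))) x ∉ A m} with hPdef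
  have hP : ∀ m, MeasurableSet (P m) := by
    intro m
    simp only [hPdef, Set.ofPred_forall]
    exact .iInter fun k => T.measurable_zpow hT _ (hA m).compl
  have hPback : ∀ {m : ℕ} {x : X} {a b : ℤ}, a ≤ b → (T ^ b) x ∈ P m → (T ^ a) x ∈ P m := by
    intro m x a b hab hb k
    have := hb (k + (b - a).toNat)
    rw [T.zpow_apply_zpow_apply] at this ⊢
    rwa [show -((k + (b - a).toNat : ℕ) : ℤ) + b = -(k : ℤ) + a by omega] at this
  set C : ℕ → Set X := fun n => {x | ∃ m, (T ^ (n : ℤ)) x ∈ P m ∧ (∀ j, j < m → x ∉ P j) ∧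
    ∃ k : ℕ, (T ^ (k : ℤ)) x ∈ A m} with hCdef
  have hCanti : Antitone C := by
    rintro a b hab x ⟨m, hm, h⟩
    exact ⟨m, hPback (by omega) hm, h⟩
  have hCvanish : ∀ x, ∃ n, x ∉ C n := by
    intro x
    by_contra! hall
    obtain ⟨m, hm, hmin, k, hk⟩ := hall 0
    obtain ⟨m', hm', hmin', -⟩ := hall k
    have hx : x ∈ P m := by simpa using hm
    have hx' : x ∈ P m' := by simpa using hPback (a := 0) (by omega) hm'
    obtain rfl : m = m' :=
      le_antisymm (not_lt.1 fun h => hmin _ h hx') (not_lt.1 fun h => hmin' _ h hx)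
    exact hm' 0 (by simpa using hk)
  refine ⟨fun n => A n ∪ C n, fun n => (hA n).union ?_,
    fun m n h => Set.union_subset_union (hanti h) (hCanti h), fun x => ?_,
    fun x hx n => (hfwd x hx n).imp fun k hk => Or.inl hk, fun x hx n => ?_⟩
  · simp only [hCdef, Set.ofPred_exists, Set.ofPred_and, Set.ofPred_forall]
    exact .iUnion fun m => (T.measurable_zpow hT n (hP m)).inter
      (.inter (.iInter fun j => .iInter fun _ => (hP j).compl)
        (.iUnion fun k => T.measurable_zpow hT k (hA m)))
  · obtain ⟨a, ha⟩ := hvanish x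
    obtain ⟨b, hb⟩ := hCvanish x
    exact ⟨max a b, fun h => h.elim (fun h => ha (hanti (le_max_left a b) h))
      fun h => hb (hCanti (le_max_right a b) h)⟩
  · by_cases hvisit : ∃ k : ℕ, (T ^ (-(k + 1 : ℤ))) x ∈ A n
    · exact hvisit.imp fun k hk => Or.inl hk
    · push Not at hvisit
      have hex : ∃ m, ∃ K : ℕ, (T ^ (-(K : ℤ))) x ∈ P m := by
        refine ⟨n, 1, fun k => ?_⟩
        rw [T.zpow_apply_zpow_apply, show -(k : ℤ) + -((1 : ℕ) : ℤ) = -(k + 1 : ℤ) by push_cast; ring]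
        exact hvisit k
      classical
      obtain ⟨K, hK⟩ := Nat.find_spec hex
      refine ⟨K + n, Or.inr ⟨Nat.find hex, ?_, fun j hj hmem => ?_, ?_⟩⟩
      · rw [T.zpow_apply_zpow_apply]
        exact hPback (by push_cast; omega) hK
      · exact Nat.find_min hex hj ⟨K + n + 1, by exact_mod_cast hmem⟩
      · obtain ⟨k, hk⟩ := hfwd x hx (Nat.find hex)
        refine ⟨k + (K + n + 1), ?_⟩
        rw [T.zpow_apply_zpow_apply]
        convert hk using 3
        push_cast
        ring

end ZOrbits

/-- Slaman–Steel, Weiss: If T : X → X is a Borel bijection of a standard Borel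
space X, then the orbit equivalence relation {(x, y) : ∃ n ∈ ℤ, Tⁿ(x) = y} is hyperfinite. -/
theorem orbit_equivalence_of_Z_action_hyperfinite
    {X : Type*} [MeasurableSpace X] [StandardBorelSpace X]
    (T : Equiv.Perm X) (hT : Measurable T) :
    Hyperfinite (fun x y : X => ∃ n : ℤ, (T ^ n) x = y) := by
  obtain ⟨B, hB, hanti, hvanish, hfwd, hbwd⟩ := exists_two_sided_markers hT
  exact hyperfinite_of_markers hT hB hanti hvanish hfwd hbwd
end

section
/- Every hyperfinite countable Borel equivalence relation is the orbit equivalence relation of a Borel action of ℤ: if E is a hyperfinite countable Borel equivalence relation on a standard Borel space X, then there exists a Borel bijection T : X → X such that E = {(x, y) : ∃ n ∈ ℤ, Tⁿ(x) = y}. -/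
open MeasureTheory Set

/-- Sets `A i` that can be enlarged to measurable sets with empty intersection. -/
def MeasurablySeparableSeq {X : Type*} [MeasurableSpace X] (A : ℕ → Set X) : Prop :=
  ∃ B : ℕ → Set X, (∀ i, MeasurableSet (B i)) ∧ (∀ i, A i ⊆ B i) ∧ ⋂ i, B i = ∅

theorem MeasurablySeparableSeq.of_update_iUnion {X : Type*} [MeasurableSpace X]
    {A : ℕ → Set X} (i : ℕ) {C : ℕ → Set X} (hA : A i ⊆ ⋃ k, C k)
    (h : ∀ k, MeasurablySeparableSeq (Function.update A i (C k))) :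
    MeasurablySeparableSeq A := by
  choose B hBm hAB hB using h
  refine ⟨fun j => if j = i then ⋃ k, B k i else ⋂ k, B k j, fun j => ?_, fun j => ?_, ?_⟩
  · dsimp only
    split_ifs
    · exact MeasurableSet.iUnion fun k => hBm k i
    · exact MeasurableSet.iInter fun k => hBm k j
  · dsimp only
    split_ifs with hj
    · subst hj
      refine hA.trans (iUnion_mono fun k => ?_)
      simpa using hAB k j
    · refine subset_iInter fun k => ?_
      simpa [hj] using hAB k j
  · refine eq_empty_of_forall_notMem fun x hx => ?_
    rw [mem_iInter] at hx
    have hi := hx i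
    simp only [if_true, mem_iUnion] at hi
    obtain ⟨k, hk⟩ := hi
    have : x ∈ ⋂ j, B k j := by
      refine mem_iInter.2 fun j => ?_
      by_cases hj : j = i
      · exact hj ▸ hk
      · have := hx j
        simp only [hj, if_false, mem_iInter] at this
        exact this k
    rw [hB k] at this
    exact this

/-- **Novikov separation**: a sequence of analytic sets with empty intersection can be enlarged
to a sequence of Borel sets with empty intersection. -/
theorem measurablySeparableSeq_of_analyticSet {X : Type*} [TopologicalSpace X] [T2Space X]
    [MeasurableSpace X] [OpensMeasurableSpace X] {A : ℕ → Set X} (hA : ∀ i, AnalyticSet (A i))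
    (hAe : ⋂ i, A i = ∅) : MeasurablySeparableSeq A := by
  classical
  by_cases hne : ∃ i, A i = ∅
  · obtain ⟨i, hi⟩ := hne
    refine ⟨fun j => if j = i then ∅ else univ, fun j => ?_, fun j => ?_, ?_⟩
    · dsimp only; split_ifs <;> simp
    · dsimp only; split_ifs with hj <;> simp [hj, hi]
    · refine eq_empty_of_forall_notMem fun x hx => ?_
      simpa using mem_iInter.1 hx i
  push Not at hne
  have hf : ∀ i, ∃ f : (ℕ → ℕ) → X, Continuous f ∧ range f = A i := fun i => by
    have := hA i
    rw [AnalyticSet] at this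
    exact this.resolve_left (hne i).ne_empty
  choose f hfc hfr using hf
  by_contra hsep
  let S : ℕ → (ℕ → ℕ) → ℕ → Set X := fun t w i =>
    f i '' {z | ∀ k, Nat.pair i k < t → z k = w (Nat.pair i k)}
  have hstep : ∀ t w, ¬ MeasurablySeparableSeq (S t w) →
      ∃ v, ¬ MeasurablySeparableSeq (S (t + 1) (Function.update w t v)) := by
    intro t w h
    by_contra! hv
    refine h (MeasurablySeparableSeq.of_update_iUnion (Nat.unpair t).1
      (C := fun v => S (t + 1) (Function.update w t v) (Nat.unpair t).1) ?_ fun v => ?_)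
    · rintro _ ⟨z, hz, rfl⟩
      refine mem_iUnion.2 ⟨z (Nat.unpair t).2, z, fun k hk => ?_, rfl⟩
      rcases Nat.lt_succ_iff_lt_or_eq.1 hk with hk | hk
      · rw [Function.update_of_ne hk.ne]
        exact hz k hk
      · have : k = (Nat.unpair t).2 := by rw [← hk]; simp
        rw [hk, Function.update_self, this]
    · convert hv v using 1
      funext j
      by_cases hj : j = (Nat.unpair t).1
      · subst hj; simp
      · rw [Function.update_of_ne hj]
        have hne : ∀ k, Nat.pair j k ≠ t := fun k hk => hj (by rw [← hk]; simp)
        simp only [S]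
        congr 1
        ext z
        refine forall_congr' fun k => ?_
        rw [Function.update_of_ne (hne k), Nat.lt_succ_iff_lt_or_eq, or_iff_left (hne k)]
  choose! V hV using hstep
  let W : ℕ → ℕ → ℕ := fun t => Nat.rec 0 (fun t w => Function.update w t (V t w)) t
  have hWs : ∀ t, W (t + 1) = Function.update (W t) t (V t (W t)) := fun _ => rfl
  have hW : ∀ t, ¬ MeasurablySeparableSeq (S t (W t)) := by
    intro t
    induction t with
    | zero =>
      have h0 : S 0 (W 0) = A := by
        funext i
        simp [S, hfr]
      rwa [h0]
    | succ t ih => rw [hWs]; exact hV t _ ih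
  let w : ℕ → ℕ := fun t => W (t + 1) t
  have hWw : ∀ t, ∀ j < t, W t j = w j := by
    intro t
    induction t with
    | zero => simp
    | succ t ih =>
      intro j hj
      rcases Nat.lt_succ_iff_lt_or_eq.1 hj with hj | rfl
      · rw [hWs, Function.update_of_ne hj.ne, ih j hj]
      · rfl
  have hSw : ∀ t, S t (W t) = S t w := by
    intro t
    funext i
    simp only [S]
    congr 1
    ext z
    exact forall_congr' fun k => imp_congr_right fun hk => by rw [hWw t _ hk]
  have hnear : ∀ i, ∀ U ∈ nhds (f i (fun k => w (Nat.pair i k))), ∃ N, ∀ t ≥ N, S t w i ⊆ U := by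
    intro i U hU
    have h1 := (hfc i).continuousAt.preimage_mem_nhds hU
    rw [nhds_pi, Filter.mem_pi] at h1
    obtain ⟨I, hI, s, hs, hsub⟩ := h1
    obtain ⟨N, hN⟩ := (hI.image (Nat.pair i)).bddAbove
    refine ⟨N + 1, fun t ht => ?_⟩
    rintro _ ⟨z, hz, rfl⟩
    refine hsub fun k hk => ?_
    rw [hz k (Nat.lt_of_le_of_lt (hN (mem_image_of_mem _ hk)) ht)]
    exact mem_of_mem_nhds (hs k)
  obtain ⟨i, j, hij⟩ : ∃ i j, f i (fun k => w (Nat.pair i k)) ≠ f j (fun k => w (Nat.pair j k)) := by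
    by_contra! h
    have : f 0 (fun k => w (Nat.pair 0 k)) ∈ ⋂ i, A i :=
      mem_iInter.2 fun i => by rw [h 0 i, ← hfr i]; exact mem_range_self _
    rw [hAe] at this
    exact this
  obtain ⟨U, U', hU, hU', hmU, hmU', hd⟩ := t2_separation hij
  obtain ⟨N, hN⟩ := hnear i U (hU.mem_nhds hmU)
  obtain ⟨N', hN'⟩ := hnear j U' (hU'.mem_nhds hmU')
  have hne : i ≠ j := by rintro rfl; exact hij rfl
  refine hW (max N N') ?_
  rw [hSw]
  refine ⟨fun l => if l = i then U else if l = j then U' else univ,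
    fun l => ?_, fun l => ?_, ?_⟩
  · dsimp only
    split_ifs
    exacts [hU.measurableSet, hU'.measurableSet, MeasurableSet.univ]
  · dsimp only
    split_ifs with h1 h2
    · exact h1 ▸ hN _ (le_max_left _ _)
    · exact h2 ▸ hN' _ (le_max_right _ _)
    · exact subset_univ _
  · refine eq_empty_of_forall_notMem fun x hx => ?_
    have h1 := mem_iInter.1 hx i
    have h2 := mem_iInter.1 hx j
    simp only [if_true, hne.symm, if_false] at h1 h2
    exact disjoint_left.1 hd h1 h2
theorem measurableSet_setOf_tuple_mem {X Y : Type*} [MeasurableSpace X] [MeasurableSpace Y]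
    {P : Set (X × Y)} (hP : MeasurableSet P) (n : ℕ) :
    MeasurableSet {p : X × (Fin n → Y) | ∀ i, (p.1, p.2 i) ∈ P} := by
  rw [ofPred_forall]
  exact MeasurableSet.iInter fun i =>
    (measurable_fst.prodMk ((measurable_pi_apply i).comp measurable_snd)) hP

theorem measurableSet_setOf_injective {Y : Type*} [MeasurableSpace Y] [StandardBorelSpace Y]
    (n : ℕ) : MeasurableSet {t : Fin n → Y | Function.Injective t} := by
  simp only [Function.Injective, ofPred_forall]
  refine MeasurableSet.iInter fun i => MeasurableSet.iInter fun j => ?_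
  by_cases hij : i = j
  · simp [hij]
  · simp only [hij, imp_false]
    exact (measurableSet_eq_fun (measurable_pi_apply i) (measurable_pi_apply j)).compl

/-- A finite set has at least `n` elements iff there is an injective `n`-tuple in it. -/
theorem le_ncard_iff_exists_injective {Y : Type*} {s : Set Y} (hs : s.Finite) (n : ℕ) :
    n ≤ s.ncard ↔ ∃ t : Fin n → Y, Function.Injective t ∧ ∀ i, t i ∈ s := by
  constructor
  · intro h
    have := hs.fintype
    have hc : Fintype.card (Fin n) ≤ Fintype.card s := by
      rwa [Fintype.card_fin, ← Nat.card_eq_fintype_card, Nat.card_coe_set_eq]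
    obtain ⟨g⟩ := Function.Embedding.nonempty_of_card_le hc
    exact ⟨fun i => g i, Subtype.val_injective.comp g.injective, fun i => (g i).2⟩
  · rintro ⟨t, ht, hts⟩
    have h1 : (range t).ncard = n := by
      rw [← image_univ, ncard_image_of_injective _ ht, ncard_univ, Nat.card_fin]
    rw [← h1]
    exact ncard_le_ncard (range_subset_iff.2 hts) hs

theorem setOf_le_ncard_section_eq {X Y : Type*} {P : Set (X × Y)}
    (hfin : ∀ x, {y | (x, y) ∈ P}.Finite) (n : ℕ) :
    {x | n ≤ {y | (x, y) ∈ P}.ncard} = Prod.fst ''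
      ({p : X × (Fin n → Y) | ∀ i, (p.1, p.2 i) ∈ P} ∩
        Prod.snd ⁻¹' {t | Function.Injective t}) := by
  ext x
  rw [mem_ofPred_eq, le_ncard_iff_exists_injective (hfin x)]
  constructor
  · rintro ⟨t, ht, hm⟩
    exact ⟨(x, t), ⟨hm, ht⟩, rfl⟩
  · rintro ⟨p, ⟨hm, ht⟩, rfl⟩
    exact ⟨p.2, ht, hm⟩

theorem measurableSet_image_fst_of_ncard_le {X Y : Type*} [MeasurableSpace X]
    [StandardBorelSpace X] [MeasurableSpace Y] [StandardBorelSpace Y] (k : ℕ) :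
    ∀ P : Set (X × Y), MeasurableSet P → (∀ x, {y | (x, y) ∈ P}.Finite) →
      (∀ x, {y | (x, y) ∈ P}.ncard ≤ k) → MeasurableSet (Prod.fst '' P) := by
  let := upgradeStandardBorel X
  induction k with
  | zero =>
    intro P _ hfin hcard
    have : P = ∅ := by
      refine eq_empty_of_forall_notMem fun p hp => ?_
      have h0 := (ncard_eq_zero (hfin p.1)).1 (Nat.le_zero.1 (hcard p.1))
      exact (h0 ▸ (show p.2 ∈ {y | (p.1, y) ∈ P} from hp) : p.2 ∈ (∅ : Set Y))
    simp [this]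
  | succ k ih =>
    intro P hP hfin hcard
    let e := embeddingReal Y
    have he : MeasurableEmbedding e := measurableEmbedding_embeddingReal Y
    let Q : Set (X × (Fin (k + 1) → Y)) :=
      {p | ∀ i, (p.1, p.2 i) ∈ P} ∩ {p | StrictMono (e ∘ p.2)}
    have hQ : MeasurableSet Q := by
      refine (measurableSet_setOf_tuple_mem hP _).inter ?_
      simp only [StrictMono, ofPred_forall]
      refine MeasurableSet.iInter fun i => MeasurableSet.iInter fun j =>
        MeasurableSet.iInter fun _ => measurableSet_lt ?_ ?_
      · exact he.measurable.comp ((measurable_pi_apply i).comp measurable_snd)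
      · exact he.measurable.comp ((measurable_pi_apply j).comp measurable_snd)
    have hrange : ∀ p ∈ Q, range p.2 = {y | (p.1, y) ∈ P} := by
      intro p hp
      have hinj : Function.Injective p.2 := Function.Injective.of_comp hp.2.injective
      refine eq_of_subset_of_ncard_le (range_subset_iff.2 hp.1) ?_ (hfin p.1)
      rw [← image_univ, ncard_image_of_injective _ hinj, ncard_univ, Nat.card_fin]
      exact hcard p.1
    have hinj : InjOn Prod.fst Q := by
      rintro ⟨x, t⟩ hp ⟨x', t'⟩ hp' (rfl : x = x')
      have h1 : range (e ∘ t) = range (e ∘ t') := by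
        rw [range_comp, range_comp, hrange _ hp, hrange _ hp']
      have h2 := (StrictMono.range_inj hp.2 hp'.2).1 h1
      exact Prod.ext rfl (he.injective.comp_left h2)
    have hA : MeasurableSet (Prod.fst '' Q) := hQ.image_of_measurable_injOn measurable_fst hinj
    have hmemA : ∀ x, k + 1 ≤ {y | (x, y) ∈ P}.ncard → x ∈ Prod.fst '' Q := by
      intro x hx
      have hx' : ((hfin x).toFinset.image e).card = k + 1 := by
        rw [Finset.card_image_of_injective _ he.injective, ← ncard_eq_toFinset_card _ (hfin x)]
        exact le_antisymm (hcard x) hx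
      have hmem : ∀ i, ∃ y, (x, y) ∈ P ∧ e y = Finset.orderEmbOfFin _ hx' i := by
        intro i
        have := Finset.orderEmbOfFin_mem _ hx' i
        rw [Finset.mem_image] at this
        obtain ⟨y, hy, hye⟩ := this
        exact ⟨y, (hfin x).mem_toFinset.1 hy, hye⟩
      choose t ht hte using hmem
      refine ⟨(x, t), ⟨ht, ?_⟩, rfl⟩
      have : e ∘ t = Finset.orderEmbOfFin _ hx' := funext hte
      change StrictMono (e ∘ t)
      rw [this]
      exact (Finset.orderEmbOfFin _ hx').strictMono
    have hsplit : Prod.fst '' P =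
        Prod.fst '' Q ∪ Prod.fst '' (P ∩ Prod.fst ⁻¹' (Prod.fst '' Q)ᶜ) := by
      ext x
      constructor
      · rintro ⟨p, hp, rfl⟩
        by_cases h : p.1 ∈ Prod.fst '' Q
        · exact Or.inl h
        · exact Or.inr ⟨p, ⟨hp, h⟩, rfl⟩
      · rintro (⟨p, hp, rfl⟩ | ⟨p, hp, rfl⟩)
        · exact ⟨(p.1, p.2 0), hp.1 0, rfl⟩
        · exact ⟨p, hp.1, rfl⟩
    rw [hsplit]
    refine hA.union (ih _ (hP.inter (measurable_fst hA.compl))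
      (fun x => (hfin x).subset fun y hy => hy.1) fun x => ?_)
    by_cases hx : x ∈ Prod.fst '' Q
    · have : {y | (x, y) ∈ P ∩ Prod.fst ⁻¹' (Prod.fst '' Q)ᶜ} = ∅ :=
        eq_empty_of_forall_notMem fun y hy => hy.2 hx
      rw [this, ncard_empty]
      exact Nat.zero_le _
    · refine (ncard_le_ncard (fun y hy => hy.1) (hfin x)).trans ?_
      by_contra! h
      exact hx (hmemA x h)

/-- **Lusin–Novikov** for finite sections: the projection of a Borel set with finite sections
is Borel. -/
theorem measurableSet_image_fst_of_finite {X Y : Type*} [MeasurableSpace X]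
    [StandardBorelSpace X] [MeasurableSpace Y] [StandardBorelSpace Y] {P : Set (X × Y)}
    (hP : MeasurableSet P) (hfin : ∀ x, {y | (x, y) ∈ P}.Finite) :
    MeasurableSet (Prod.fst '' P) := by
  let := upgradeStandardBorel X
  have hA : ∀ n, AnalyticSet {x | n ≤ {y | (x, y) ∈ P}.ncard} := by
    intro n
    rw [setOf_le_ncard_section_eq hfin]
    exact ((measurableSet_setOf_tuple_mem hP n).inter
      (measurable_snd (measurableSet_setOf_injective n))).analyticSet_image measurable_fst
  obtain ⟨B, hBm, hAB, hB⟩ := measurablySeparableSeq_of_analyticSet hA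
    (eq_empty_of_forall_notMem fun x hx =>
      absurd (mem_iInter.1 hx ({y | (x, y) ∈ P}.ncard + 1)) (Nat.not_succ_le_self _))
  have hsplit : Prod.fst '' P = ⋃ n, Prod.fst '' (P ∩ Prod.fst ⁻¹' (B n)ᶜ) := by
    rw [← image_iUnion, ← inter_iUnion, ← preimage_iUnion, ← compl_iInter, hB]
    simp
  rw [hsplit]
  refine MeasurableSet.iUnion fun n => measurableSet_image_fst_of_ncard_le n _
    (hP.inter (measurable_fst (hBm n).compl)) (fun x => (hfin x).subset fun y hy => hy.1)
    fun x => ?_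
  by_cases hx : x ∈ B n
  · have : {y | (x, y) ∈ P ∩ Prod.fst ⁻¹' (B n)ᶜ} = ∅ :=
      eq_empty_of_forall_notMem fun y hy => hy.2 hx
    rw [this, ncard_empty]
    exact Nat.zero_le _
  · refine (ncard_le_ncard (fun y hy => hy.1) (hfin x)).trans ?_
    by_contra! h
    exact hx (hAB n h.le)

theorem measurable_ncard_section {X Y : Type*} [MeasurableSpace X]
    [StandardBorelSpace X] [MeasurableSpace Y] [StandardBorelSpace Y] {P : Set (X × Y)}
    (hP : MeasurableSet P) (hfin : ∀ x, {y | (x, y) ∈ P}.Finite) :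
    Measurable fun x => {y | (x, y) ∈ P}.ncard := by
  refine measurable_of_Ici fun n => ?_
  change MeasurableSet {x | n ≤ {y | (x, y) ∈ P}.ncard}
  rw [setOf_le_ncard_section_eq hfin]
  refine measurableSet_image_fst_of_finite ((measurableSet_setOf_tuple_mem hP n).inter
    (measurable_snd (measurableSet_setOf_injective n))) fun x => ?_
  exact (Set.Finite.pi' fun _ => hfin x).subset fun t ht => ht.1

theorem measurableSet_exists_of_finite {W X : Type*} [MeasurableSpace W] [StandardBorelSpace W]
    [MeasurableSpace X] [StandardBorelSpace X] {R : X → X → Prop}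
    (hR : MeasurableSet {p : X × X | R p.1 p.2}) (hfin : ∀ x, {y | R x y}.Finite)
    {f : W → X} (hf : Measurable f) {Q : Set (W × X)} (hQ : MeasurableSet Q) :
    MeasurableSet {w | ∃ z, R (f w) z ∧ (w, z) ∈ Q} := by
  have hP : MeasurableSet {p : W × X | R (f p.1) p.2 ∧ p ∈ Q} :=
    (((hf.comp measurable_fst).prodMk measurable_snd) hR).inter hQ
  convert measurableSet_image_fst_of_finite hP
    (fun w => (hfin (f w)).subset fun y hy => hy.1) using 1
  ext w
  simp

/-- Quantifying over the classes of a hyperfinite equivalence relation preserves measurability. -/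
theorem Hyperfinite.measurableSet_exists {W X : Type*} [MeasurableSpace W]
    [StandardBorelSpace W] [MeasurableSpace X] [StandardBorelSpace X] {E : X → X → Prop}
    (hE : Hyperfinite E) {f : W → X} (hf : Measurable f) {Q : Set (W × X)}
    (hQ : MeasurableSet Q) : MeasurableSet {w | ∃ z, E (f w) z ∧ (w, z) ∈ Q} := by
  obtain ⟨F, -, hFm, hFf, -, hFE⟩ := hE
  have : {w | ∃ z, E (f w) z ∧ (w, z) ∈ Q} = ⋃ n, {w | ∃ z, F n (f w) z ∧ (w, z) ∈ Q} := by
    ext w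
    simp only [hFE, mem_iUnion, mem_ofPred_eq]
    constructor
    · rintro ⟨z, ⟨n, hn⟩, hz⟩
      exact ⟨n, z, hn, hz⟩
    · rintro ⟨n, z, hn, hz⟩
      exact ⟨z, ⟨n, hn⟩, hz⟩
  rw [this]
  exact MeasurableSet.iUnion fun n => measurableSet_exists_of_finite (hFm n) (hFf n) hf hQ

theorem measurable_of_measurableSet_graph {X Y : Type*} [MeasurableSpace X]
    [StandardBorelSpace X] [MeasurableSpace Y] [StandardBorelSpace Y] {f : X → Y}
    (hf : MeasurableSet {p : X × Y | f p.1 = p.2}) : Measurable f := by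
  intro B hB
  convert measurableSet_image_fst_of_finite (hf.inter (measurable_snd hB))
    (fun x => (finite_singleton (f x)).subset fun y hy => (hy.1 : f x = y).symm) using 1
  ext x
  simp

/-- A Borel relation that linearly orders each `E`-class with finite intervals. -/
structure IsBorelClassOrder {X : Type*} [MeasurableSpace X] (E lt : X → X → Prop) : Prop where
  rel : ∀ {x y}, lt x y → E x y
  irrefl : ∀ x, ¬ lt x x
  trans : ∀ {x y z}, lt x y → lt y z → lt x z
  total : ∀ {x y}, E x y → x ≠ y → lt x y ∨ lt y x
  finite : ∀ x y, {z | lt x z ∧ lt z y}.Finite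
  measurable : MeasurableSet {p : X × X | lt p.1 p.2}

namespace IsBorelClassOrder

variable {X : Type*} [MeasurableSpace X] {E lt : X → X → Prop}

theorem swap (h : IsBorelClassOrder E lt) (hE : Equivalence E) :
    IsBorelClassOrder E fun x y => lt y x where
  rel hxy := hE.symm (h.rel hxy)
  irrefl := h.irrefl
  trans hxy hyz := h.trans hyz hxy
  total hxy hne := (h.total hxy hne).symm
  finite x y := (h.finite y x).subset fun _ hz => ⟨hz.2, hz.1⟩
  measurable := measurable_swap h.measurable

theorem ncard_interval_lt (h : IsBorelClassOrder E lt) {x y a b z : X}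
    (hsub : {w | lt a w ∧ lt w b} ⊆ {w | lt x w ∧ lt w y}) (hz : lt x z ∧ lt z y)
    (hz' : ¬ (lt a z ∧ lt z b)) :
    {w | lt a w ∧ lt w b}.ncard < {w | lt x w ∧ lt w y}.ncard :=
  ncard_lt_ncard ((ssubset_iff_of_subset hsub).2 ⟨z, hz, hz'⟩) (h.finite x y)

theorem exists_succ (h : IsBorelClassOrder E lt) {x y : X} (hxy : lt x y) :
    ∃ x', lt x x' ∧ (∀ z, ¬ (lt x z ∧ lt z x')) ∧ (x' = y ∨ lt x' y) := by
  induction hk : {z | lt x z ∧ lt z y}.ncard using Nat.strong_induction_on generalizing y with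
  | _ k ih =>
    by_cases hz : ∃ z, lt x z ∧ lt z y
    · obtain ⟨z, hz⟩ := hz
      obtain ⟨x', h1, h2, h3⟩ := ih _ (hk ▸ h.ncard_interval_lt
        (fun w hw => ⟨hw.1, h.trans hw.2 hz.2⟩) hz fun hzz => h.irrefl z hzz.2) hz.1 rfl
      refine ⟨x', h1, h2, Or.inr ?_⟩
      rcases h3 with rfl | h3
      · exact hz.2
      · exact h.trans h3 hz.2
    · exact ⟨y, hxy, fun z hz' => hz ⟨z, hz'⟩, Or.inl rfl⟩

theorem finite_below_of_rel (h : IsBorelClassOrder E lt) (hE : Equivalence E) {x y : X}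
    (hxy : E x y) (hx : {z | lt z x}.Finite) : {z | lt z y}.Finite := by
  refine ((hx.union (finite_singleton x)).union (h.finite x y)).subset fun z hz => ?_
  by_cases hzx : z = x
  · exact Or.inl (Or.inr hzx)
  · rcases h.total (hE.trans (h.rel hz) (hE.symm hxy)) hzx with h1 | h1
    · exact Or.inl (Or.inl h1)
    · exact Or.inr ⟨h1, hz⟩

theorem ncard_below_lt (h : IsBorelClassOrder E lt) {x y : X} (hxy : lt x y)
    (hy : {z | lt z y}.Finite) : {z | lt z x}.ncard < {z | lt z y}.ncard :=
  ncard_lt_ncard ((ssubset_iff_of_subset fun _ hz => h.trans hz hxy).2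
    ⟨x, hxy, h.irrefl x⟩) hy

theorem exists_min (h : IsBorelClassOrder E lt) (hE : Equivalence E) {x : X}
    (hx : {z | lt z x}.Finite) : ∃ y, E x y ∧ ∀ z, ¬ lt z y := by
  induction hk : {z | lt z x}.ncard using Nat.strong_induction_on generalizing x with
  | _ k ih =>
    by_cases hz : ∃ z, lt z x
    · obtain ⟨z, hz⟩ := hz
      have hxz : E x z := hE.symm (h.rel hz)
      obtain ⟨y, hy, hmin⟩ := ih _ (hk ▸ h.ncard_below_lt hz hx)
        (h.finite_below_of_rel hE hxz hx) rfl
      exact ⟨y, hE.trans hxz hy, hmin⟩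
    · exact ⟨x, hE.refl x, fun z hz' => hz ⟨z, hz'⟩⟩

/-- On a class of order type `ω`, counting predecessors is a bijection onto `ℕ`. -/
theorem bijOn_ncard_below (h : IsBorelClassOrder E lt) (hE : Equivalence E) {x : X}
    (hx : {z | lt z x}.Finite) (hx' : ¬ {z | lt x z}.Finite) :
    BijOn (fun y => {z | lt z y}.ncard) {y | E x y} univ := by
  have hbelow : ∀ {y}, E x y → {z | lt z y}.Finite := fun hy => h.finite_below_of_rel hE hy hx
  refine ⟨fun _ _ => mem_univ _, fun y hy y' hy' heq => ?_, fun k _ => ?_⟩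
  · by_contra hne
    rcases h.total (hE.trans (hE.symm hy) hy') hne with h1 | h1
    · exact (h.ncard_below_lt h1 (hbelow hy')).ne heq
    · exact (h.ncard_below_lt h1 (hbelow hy)).ne' heq
  · induction k with
    | zero =>
      obtain ⟨y, hy, hmin⟩ := h.exists_min hE hx
      refine ⟨y, hy, ?_⟩
      have : {z | lt z y} = ∅ := eq_empty_of_forall_notMem hmin
      simp only [this, ncard_empty]
    | succ k ih =>
      obtain ⟨y, hy, hyk⟩ := ih (mem_univ _)
      obtain ⟨u, hu⟩ : ∃ u, lt y u := by
        by_contra! hu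
        have : {z | lt y z} = ∅ := eq_empty_of_forall_notMem hu
        exact hx' ((h.swap hE).finite_below_of_rel hE (hE.symm hy) (this ▸ finite_empty))
      obtain ⟨y', h1, h2, -⟩ := h.exists_succ hu
      refine ⟨y', hE.trans hy (h.rel h1), ?_⟩
      have : {z | lt z y'} = insert y {z | lt z y} := by
        ext z
        constructor
        · intro hz
          by_cases hzy : z = y
          · exact Or.inl hzy
          · refine Or.inr ((h.total (hE.trans (h.rel hz) (hE.symm (h.rel h1))) hzy).resolve_right
              fun h3 => h2 z ⟨h3, hz⟩)
        · rintro (rfl | hz)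
          · exact h1
          · exact h.trans hz h1
      simp only at hyk ⊢
      rw [this, ncard_insert_of_notMem (s := {z | lt z y}) (h.irrefl y) (hbelow hy), hyk]

theorem measurableSet_finite_below [StandardBorelSpace X] (h : IsBorelClassOrder E lt)
    (hE : Equivalence E) (hyp : Hyperfinite E) : MeasurableSet {x | {z | lt z x}.Finite} := by
  obtain ⟨F, -, hFm, hFf, hFmono, hFE⟩ := id hyp
  have : {x | {z | lt z x}.Finite} =
      ⋃ n, {x | ∃ z, E x z ∧ (x, z) ∈ {p : X × X | lt p.2 p.1 ∧ ¬ F n p.1 p.2}}ᶜ := by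
    ext x
    simp only [mem_iUnion, mem_compl_iff, mem_ofPred_eq, not_exists, not_and, not_not]
    constructor
    · intro hx
      have hN : ∀ z, ∃ n, lt z x → F n x z := fun z => by
        by_cases hz : lt z x
        · obtain ⟨n, hn⟩ := (hFE x z).1 (hE.symm (h.rel hz))
          exact ⟨n, fun _ => hn⟩
        · exact ⟨0, fun hz' => absurd hz' hz⟩
      choose N hN using hN
      obtain ⟨n, hn⟩ := (hx.image N).bddAbove
      exact ⟨n, fun z _ hz => hFmono _ _ (hn (mem_image_of_mem _ hz)) _ _ (hN z hz)⟩
    · rintro ⟨n, hn⟩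
      exact (hFf n x).subset fun z hz => hn z (hE.symm (h.rel hz)) hz
  rw [this]
  exact MeasurableSet.iUnion fun n => (hyp.measurableSet_exists measurable_id
    ((measurable_swap h.measurable).inter (hFm n).compl)).compl

/-- The classes of order type `ω` can be reordered in type `ℤ`. -/
theorem exists_reorder [StandardBorelSpace X] (h : IsBorelClassOrder E lt) (hE : Equivalence E)
    (hBorel : MeasurableSet {p : X × X | E p.1 p.2}) (hyp : Hyperfinite E) :
    ∃ lt' : X → X → Prop, IsBorelClassOrder E lt' ∧
      (∀ x, {z | lt' z x}.Finite → {z | lt' x z}.Finite) ∧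
      ((∀ x, {z | lt x z}.Finite → {z | lt z x}.Finite) →
        ∀ x, {z | lt' x z}.Finite → {z | lt' z x}.Finite) := by
  let C : Set X := {x | {z | lt z x}.Finite} ∩ {x | {z | lt x z}.Finite}ᶜ
  have hC : MeasurableSet C := (h.measurableSet_finite_below hE hyp).inter
    ((h.swap hE).measurableSet_finite_below hE hyp).compl
  have hCE : ∀ {x y}, E x y → x ∈ C → y ∈ C := fun hxy hx =>
    ⟨h.finite_below_of_rel hE hxy hx.1,
      fun hy => hx.2 ((h.swap hE).finite_below_of_rel hE (hE.symm hxy) hy)⟩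
  let P : Set (X × X) := {p | p.1 ∈ C ∧ lt p.2 p.1}
  have hP : MeasurableSet P := (measurable_fst hC).inter (measurable_swap h.measurable)
  have hPfin : ∀ x, {y | (x, y) ∈ P}.Finite := by
    intro x
    by_cases hx : x ∈ C
    · exact hx.1.subset fun z hz => hz.2
    · exact finite_empty.subset fun z hz => hx hz.1
  let K : X → ℤ := fun x => Equiv.intEquivNat.symm {y | (x, y) ∈ P}.ncard
  have hK : Measurable K := (measurable_from_top).comp (measurable_ncard_section hP hPfin)
  have hKbij : ∀ x ∈ C, BijOn K {y | E x y} univ := by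
    intro x hx
    have h1 := (Equiv.intEquivNat.symm.bijective.bijOn_univ).comp
      (h.bijOn_ncard_below hE hx.1 hx.2)
    refine h1.congr fun y hy => ?_
    have : {z | (y, z) ∈ P} = {z | lt z y} := by
      ext z
      exact ⟨fun hz => hz.2, fun hz => ⟨hCE hy hx, hz⟩⟩
    simp only [K, this, Function.comp]
  let lt' : X → X → Prop := fun x y => (x ∈ C ∧ E x y ∧ K x < K y) ∨ (x ∉ C ∧ lt x y)
  have hlt'C : ∀ {x y}, x ∈ C → (lt' x y ↔ E x y ∧ K x < K y) := fun hx => by simp [lt', hx]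
  have hlt'N : ∀ {x y}, x ∉ C → (lt' x y ↔ lt x y) := fun hx => by simp [lt', hx]
  have hrel : ∀ {x y}, lt' x y → E x y := by
    rintro x y (hxy | hxy)
    exacts [hxy.2.1, h.rel hxy.2]
  have hCinv : ∀ {x y}, E x y → (x ∈ C ↔ y ∈ C) := fun hxy => ⟨hCE hxy, hCE (hE.symm hxy)⟩
  have hupC : ∀ x ∈ C, ¬ {z | lt' x z}.Finite := fun x hx hfin => by
    refine (Ioi_infinite (K x)) ((hfin.image K).subset fun k hk => ?_)
    obtain ⟨y, hy, rfl⟩ := (hKbij x hx).surjOn (mem_univ k)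
    exact mem_image_of_mem _ ((hlt'C hx).2 ⟨hy, hk⟩)
  have hdownC : ∀ x ∈ C, ¬ {z | lt' z x}.Finite := fun x hx hfin => by
    refine (Iio_infinite (K x)) ((hfin.image K).subset fun k hk => ?_)
    obtain ⟨y, hy, rfl⟩ := (hKbij x hx).surjOn (mem_univ k)
    exact mem_image_of_mem _ ((hlt'C (hCE hy hx)).2 ⟨hE.symm hy, hk⟩)
  have hupN : ∀ x ∉ C, {z | lt' x z} = {z | lt x z} := fun x hx => by
    ext z
    exact hlt'N hx
  have hdownN : ∀ x ∉ C, {z | lt' z x} = {z | lt z x} := fun x hx => by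
    ext z
    constructor
    · exact fun hz => (hlt'N (mt (hCinv (hrel hz)).1 hx)).1 hz
    · exact fun hz => (hlt'N (mt (hCinv (h.rel hz)).1 hx)).2 hz
  refine ⟨lt', ⟨hrel, fun x => ?_, fun {x y z} hxy hyz => ?_, fun {x y} hxy hne => ?_,
    fun x y => ?_, ?_⟩, fun x hx => ?_, fun hbal x hx => ?_⟩
  · rintro (hx | hx)
    exacts [lt_irrefl _ hx.2.2, h.irrefl x hx.2]
  · by_cases hx : x ∈ C
    · have hy := hCE (hrel hxy) hx
      rw [hlt'C hx] at hxy ⊢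
      rw [hlt'C hy] at hyz
      exact ⟨hE.trans hxy.1 hyz.1, hxy.2.trans hyz.2⟩
    · have hy := mt (hCinv (hrel hxy)).2 hx
      rw [hlt'N hx] at hxy ⊢
      rw [hlt'N hy] at hyz
      exact h.trans hxy hyz
  · by_cases hx : x ∈ C
    · rw [hlt'C hx, hlt'C (hCE hxy hx)]
      have hKne : K x ≠ K y := fun heq => hne ((hKbij x hx).injOn (hE.refl x) hxy heq)
      exact hKne.lt_or_gt.imp (fun hk => ⟨hxy, hk⟩) fun hk => ⟨hE.symm hxy, hk⟩
    · rw [hlt'N hx, hlt'N (mt (hCinv hxy).2 hx)]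
      exact h.total hxy hne
  · by_cases hx : x ∈ C
    · refine Finite.of_finite_image ((finite_Ioo (K x) (K y)).subset ?_)
        ((hKbij x hx).injOn.mono fun z hz => hrel hz.1)
      rintro _ ⟨z, ⟨hz1, hz2⟩, rfl⟩
      exact ⟨((hlt'C hx).1 hz1).2, ((hlt'C (hCE (hrel hz1) hx)).1 hz2).2⟩
    · refine (h.finite x y).subset fun z hz => ⟨(hlt'N hx).1 hz.1, ?_⟩
      exact (hlt'N (mt (hCinv (hrel hz.1)).2 hx)).1 hz.2
  · exact ((measurable_fst hC).inter (hBorel.inter (measurableSet_lt (hK.comp measurable_fst)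
      (hK.comp measurable_snd)))).union ((measurable_fst hC.compl).inter h.measurable)
  · have hxC : x ∉ C := fun hxC => hdownC x hxC hx
    rw [hdownN x hxC] at hx
    rw [hupN x hxC]
    by_contra hx'
    exact hxC ⟨hx, hx'⟩
  · have hxC : x ∉ C := fun hxC => hupC x hxC hx
    rw [hupN x hxC] at hx
    rw [hdownN x hxC]
    exact hbal x hx

/-- If, moreover, each class has a maximum iff it has a minimum, then the (cyclic) successor
map generates `E`. -/
theorem exists_perm [StandardBorelSpace X] (h : IsBorelClassOrder E lt) (hE : Equivalence E)
    (hBorel : MeasurableSet {p : X × X | E p.1 p.2}) (hyp : Hyperfinite E)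
    (hmin : ∀ x, (∀ z, ¬ lt x z) → ∃ y, E x y ∧ ∀ z, ¬ lt z y)
    (hmax : ∀ x, (∀ z, ¬ lt z x) → ∃ y, E x y ∧ ∀ z, ¬ lt y z) :
    ∃ T : Equiv.Perm X, Measurable T ∧ ∀ x y, E x y ↔ ∃ n : ℤ, (T ^ n) x = y := by
  let G : X → X → Prop := fun x y => E x y ∧
    ((lt x y ∧ ∀ z, ¬ (lt x z ∧ lt z y)) ∨ ((∀ z, ¬ lt x z) ∧ ∀ z, ¬ lt z y))
  have hex : ∀ x, ∃ y, G x y := by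
    intro x
    by_cases hx : ∃ y, lt x y
    · obtain ⟨y, hy⟩ := hx
      obtain ⟨x', h1, h2, -⟩ := h.exists_succ hy
      exact ⟨x', h.rel h1, Or.inl ⟨h1, h2⟩⟩
    · push Not at hx
      obtain ⟨y, hxy, hy⟩ := hmin x hx
      exact ⟨y, hxy, Or.inr ⟨hx, hy⟩⟩
  have hex' : ∀ y, ∃ x, G x y := by
    intro y
    by_cases hy : ∃ x, lt x y
    · obtain ⟨x, hx⟩ := hy
      obtain ⟨y', h1, h2, -⟩ := (h.swap hE).exists_succ hx
      exact ⟨y', h.rel h1, Or.inl ⟨h1, fun z hz => h2 z ⟨hz.2, hz.1⟩⟩⟩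
    · push Not at hy
      obtain ⟨x, hxy, hx⟩ := hmax y hy
      exact ⟨x, hE.symm hxy, Or.inr ⟨hx, hy⟩⟩
  have hright : ∀ {x y y'}, G x y → G x y' → y = y' := by
    rintro x y y' ⟨hE1, h1⟩ ⟨hE2, h2⟩
    by_contra hne
    have ht := h.total (hE.trans (hE.symm hE1) hE2) hne
    rcases h1 with ⟨h1, h1'⟩ | ⟨h1, h1'⟩ <;> rcases h2 with ⟨h2, h2'⟩ | ⟨h2, h2'⟩
    · exact ht.elim (fun ht => h2' _ ⟨h1, ht⟩) fun ht => h1' _ ⟨h2, ht⟩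
    · exact h2 _ h1
    · exact h1 _ h2
    · exact ht.elim (h2' _) (h1' _)
  have hleft : ∀ {x x' y}, G x y → G x' y → x = x' := by
    rintro x x' y ⟨hE1, h1⟩ ⟨hE2, h2⟩
    by_contra hne
    have ht := h.total (hE.trans hE1 (hE.symm hE2)) hne
    rcases h1 with ⟨h1, h1'⟩ | ⟨h1, h1'⟩ <;> rcases h2 with ⟨h2, h2'⟩ | ⟨h2, h2'⟩
    · exact ht.elim (fun ht => h1' _ ⟨ht, h2⟩) fun ht => h2' _ ⟨ht, h1⟩
    · exact h2' _ h1
    · exact h1' _ h2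
    · exact ht.elim (h1 _) (h2 _)
  choose f hf using hex
  have hfG : ∀ {x y}, f x = y ↔ G x y := fun {x y} =>
    ⟨fun hxy => hxy ▸ hf x, fun hxy => hright (hf x) hxy⟩
  have hbij : Function.Bijective f :=
    ⟨fun x x' hxx => hleft (hf x) (hxx ▸ hf x'), fun y => (hex' y).imp fun x hx => hfG.2 hx⟩
  have hnoUp : MeasurableSet {x | ∀ z, ¬ lt x z} := by
    convert (hyp.measurableSet_exists measurable_id h.measurable).compl using 1
    ext x
    simp only [mem_ofPred_eq, mem_compl_iff, not_exists, id]
    exact forall_congr' fun z => ⟨fun hz hz' => hz hz'.2, fun hz hz' => hz ⟨h.rel hz', hz'⟩⟩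
  have hnoDown : MeasurableSet {x | ∀ z, ¬ lt z x} := by
    convert (hyp.measurableSet_exists measurable_id
      (measurable_swap h.measurable)).compl using 1
    ext x
    simp only [mem_ofPred_eq, mem_compl_iff, not_exists, id]
    exact forall_congr' fun z =>
      ⟨fun hz hz' => hz hz'.2, fun hz hz' => hz ⟨hE.symm (h.rel hz'), hz'⟩⟩
  have hnoBtw : MeasurableSet {p : X × X | ∀ z, ¬ (lt p.1 z ∧ lt z p.2)} := by
    have hQ : MeasurableSet {q : (X × X) × X | lt q.1.1 q.2 ∧ lt q.2 q.1.2} :=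
      (((measurable_fst.comp measurable_fst).prodMk measurable_snd) h.measurable).inter
        ((measurable_snd.prodMk (measurable_snd.comp measurable_fst)) h.measurable)
    convert (hyp.measurableSet_exists measurable_fst hQ).compl using 1
    ext p
    simp only [mem_ofPred_eq, mem_compl_iff, not_exists]
    exact forall_congr' fun z => ⟨fun hz hz' => hz hz'.2, fun hz hz' => hz ⟨h.rel hz'.1, hz'⟩⟩
  have hfm : Measurable f := by
    refine measurable_of_measurableSet_graph ?_
    simp only [hfG]
    exact hBorel.inter ((h.measurable.inter hnoBtw).union
      ((measurable_fst hnoUp).inter (measurable_snd hnoDown)))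
  have hiter : ∀ {x y}, lt x y → ∃ n : ℕ, (Equiv.ofBijective f hbij ^ n) x = y := by
    intro x y hxy
    induction hk : {z | lt x z ∧ lt z y}.ncard using Nat.strong_induction_on generalizing x with
    | _ k ih =>
      obtain ⟨x', h1, h2, h3⟩ := h.exists_succ hxy
      have hfx : f x = x' := hfG.2 ⟨h.rel h1, Or.inl ⟨h1, h2⟩⟩
      rcases h3 with rfl | h3
      · exact ⟨1, by simpa using hfx⟩
      · obtain ⟨n, hn⟩ := ih _ (hk ▸ h.ncard_interval_lt
          (fun w hw => ⟨h.trans h1 hw.1, hw.2⟩) ⟨h1, h3⟩ fun hz => h.irrefl _ hz.1) h3 rfl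
        refine ⟨n + 1, ?_⟩
        rw [pow_succ, Equiv.Perm.mul_apply, Equiv.ofBijective_apply, hfx, hn]
  have hstep : ∀ (n : ℕ) x, E x ((Equiv.ofBijective f hbij ^ n) x) := by
    intro n
    induction n with
    | zero => exact fun x => hE.refl x
    | succ n ih =>
      intro x
      rw [pow_succ, Equiv.Perm.mul_apply, Equiv.ofBijective_apply]
      exact hE.trans (hf x).1 (ih _)
  refine ⟨Equiv.ofBijective f hbij, hfm, fun x y => ⟨fun hxy => ?_, ?_⟩⟩
  · by_cases hne : x = y
    · exact ⟨0, by simpa using hne⟩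
    rcases h.total hxy hne with hlt | hlt
    · obtain ⟨n, hn⟩ := hiter hlt
      exact ⟨n, by rwa [zpow_natCast]⟩
    · obtain ⟨n, hn⟩ := hiter hlt
      exact ⟨-n, by rw [zpow_neg, zpow_natCast, Equiv.Perm.inv_eq_iff_eq, hn]⟩
  · rintro ⟨n, rfl⟩
    obtain ⟨n, rfl | rfl⟩ := n.eq_nat_or_neg
    · rw [zpow_natCast]
      exact hstep n x
    · rw [zpow_neg, zpow_natCast]
      have := hstep n ((Equiv.ofBijective f hbij ^ n)⁻¹ x)
      rw [← Equiv.Perm.mul_apply, mul_inv_cancel, Equiv.Perm.one_apply] at this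
      exact hE.symm this

end IsBorelClassOrder

theorem Hyperfinite.exists_seq_zero_eq {X : Type*} [MeasurableSpace X] [StandardBorelSpace X]
    {E : X → X → Prop} (hE : Equivalence E) (hyp : Hyperfinite E) :
    ∃ F : ℕ → X → X → Prop, (∀ x y, F 0 x y ↔ x = y) ∧
      (∀ n, Equivalence (F n)) ∧
      (∀ n, MeasurableSet {p : X × X | F n p.1 p.2}) ∧
      (∀ n x, {y | F n x y}.Finite) ∧
      (∀ m n, m ≤ n → ∀ x y, F m x y → F n x y) ∧
      (∀ x y, E x y ↔ ∃ n, F n x y) := by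
  obtain ⟨F, hFe, hFm, hFf, hFmono, hFE⟩ := hyp
  refine ⟨fun n => Nat.casesOn n Eq F, fun x y => Iff.rfl, ?_, ?_, ?_, ?_, fun x y => ?_⟩
  · rintro (_ | n)
    exacts [eq_equivalence, hFe n]
  · rintro (_ | n)
    exacts [measurableSet_eq_fun measurable_fst measurable_snd, hFm n]
  · rintro (_ | n) x
    exacts [(finite_singleton x).subset fun y hy => Eq.symm hy, hFf n x]
  · rintro (_ | m) (_ | n) hmn x y hxy
    · exact hxy
    · cases hxy
      exact (hFe n).refl x
    · simp at hmn
    · exact hFmono m n (Nat.le_of_succ_le_succ hmn) x y hxy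
  · rw [hFE]
    constructor
    · rintro ⟨n, hn⟩
      exact ⟨n + 1, hn⟩
    · rintro ⟨_ | n, hn⟩
      · cases hn
        exact (hFE x x).1 (hE.refl x)
      · exact ⟨n, hn⟩

/-- On the classes of a hyperfinite `E = ⋃ n, F n`, points are compared at the largest level `n`
at which the minima of their `F n`-classes differ. -/
theorem Hyperfinite.exists_isBorelClassOrder {X : Type*} [MeasurableSpace X]
    [StandardBorelSpace X] {E : X → X → Prop} (hE : Equivalence E) (hyp : Hyperfinite E) :
    ∃ lt : X → X → Prop, IsBorelClassOrder E lt := by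
  obtain ⟨F, hF0, hFe, hFm, hFf, hFmono, hFE⟩ := hyp.exists_seq_zero_eq hE
  let e := embeddingReal X
  have he : MeasurableEmbedding e := measurableEmbedding_embeddingReal X
  let m : ℕ → X → ℝ := fun n x => sInf (e '' {y | F n x y})
  have hne : ∀ n x, (e '' {y | F n x y}).Nonempty := fun n x => ⟨e x, x, (hFe n).refl x, rfl⟩
  have hfin : ∀ n x, (e '' {y | F n x y}).Finite := fun n x => (hFf n x).image e
  have hm : ∀ n, Measurable (m n) := by
    intro n
    refine measurable_of_Iio fun q => ?_
    convert measurableSet_exists_of_finite (hFm n) (hFf n) measurable_id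
      (measurable_snd (he.measurable (measurableSet_Iio (a := q)))) using 1
    ext x
    simp [m, csInf_lt_iff (hfin n x).bddBelow (hne n x)]
  have hmF : ∀ {n x y}, m n x = m n y ↔ F n x y := by
    intro n x y
    constructor
    · intro hxy
      obtain ⟨a, ha, hae⟩ := (hne n x).csInf_mem (hfin n x)
      obtain ⟨b, hb, hbe⟩ := (hne n y).csInf_mem (hfin n y)
      have hab : a = b := he.injective (hae.trans (hxy.trans hbe.symm))
      subst hab
      exact (hFe n).trans ha ((hFe n).symm hb)
    · intro hxy
      have : {z | F n x z} = {z | F n y z} := by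
        ext z
        exact ⟨(hFe n).trans ((hFe n).symm hxy), (hFe n).trans hxy⟩
      simp only [m, this]
  refine ⟨fun x y => ∃ n, F (n + 1) x y ∧ m n x < m n y, ?_, ?_, ?_, ?_, ?_, ?_⟩
  · rintro x y ⟨n, hn, -⟩
    exact (hFE x y).2 ⟨n + 1, hn⟩
  · rintro x ⟨n, -, hn⟩
    exact lt_irrefl _ hn
  · rintro x y z ⟨n, hn, hn'⟩ ⟨k, hk, hk'⟩
    rcases lt_trichotomy n k with hnk | rfl | hnk
    · refine ⟨k, (hFe _).trans (hFmono _ _ (by omega) _ _ hn) hk, ?_⟩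
      rwa [hmF.2 (hFmono _ _ hnk _ _ hn)]
    · exact ⟨n, (hFe _).trans hn hk, hn'.trans hk'⟩
    · refine ⟨n, (hFe _).trans hn (hFmono _ _ (by omega) _ _ hk), ?_⟩
      rwa [← hmF.2 (hFmono _ _ hnk _ _ hk)]
  · intro x y hxy hne
    classical
    have hxy' := (hFE x y).1 hxy
    obtain ⟨n, hn⟩ : ∃ n, Nat.find hxy' = n + 1 := by
      refine Nat.exists_eq_succ_of_ne_zero fun h0 => hne ?_
      have := Nat.find_spec hxy'
      rwa [h0, hF0] at this
    have h1 : F (n + 1) x y := hn ▸ Nat.find_spec hxy'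
    have h2 : m n x ≠ m n y := fun h => Nat.find_min hxy' (m := n) (by omega) (hmF.1 h)
    exact h2.lt_or_gt.imp (fun h => ⟨n, h1, h⟩) fun h => ⟨n, (hFe _).symm h1, h⟩
  · intro x y
    by_cases hxy : ∃ N, F N x y
    · obtain ⟨N, hN⟩ := hxy
      refine (hFf N x).subset ?_
      rintro z ⟨⟨n, hn, hn'⟩, ⟨k, hk, hk'⟩⟩
      by_contra hz
      have hNn : N ≤ n := by
        by_contra! hlt
        exact hz (hFmono _ _ hlt _ _ hn)
      have hNk : N ≤ k := by
        by_contra! hlt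
        exact hz ((hFe N).trans hN ((hFe N).symm (hFmono _ _ hlt _ _ hk)))
      have hxyn := hmF.2 (hFmono _ _ hNn _ _ hN)
      have hxyk := hmF.2 (hFmono _ _ hNk _ _ hN)
      rcases lt_trichotomy n k with hnk | rfl | hnk
      · rw [← hmF.2 (hFmono _ _ hnk _ _ hn), hxyk] at hk'
        exact lt_irrefl _ hk'
      · rw [hxyn] at hn'
        exact lt_asymm hn' hk'
      · rw [hmF.2 (hFmono _ _ hnk _ _ hk), hxyn] at hn'
        exact lt_irrefl _ hn'
    · refine finite_empty.subset ?_
      rintro z ⟨⟨n, hn, -⟩, ⟨k, hk, -⟩⟩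
      exact hxy ((hFE x y).1 (hE.trans ((hFE x z).2 ⟨_, hn⟩) ((hFE z y).2 ⟨_, hk⟩)))
  · simp only [ofPred_exists]
    exact MeasurableSet.iUnion fun n => (hFm (n + 1)).inter
      (measurableSet_lt ((hm n).comp measurable_fst) ((hm n).comp measurable_snd))

/-- Every hyperfinite countable Borel equivalence relation on a standard Borel
space is the orbit equivalence relation of a Borel action of ℤ, i.e. there is a Borel
bijection T : X → X with E = {(x, y) : ∃ n ∈ ℤ, Tⁿ(x) = y}. -/
theorem hyperfinite_is_Z_orbit_equivalence
    {X : Type*} [MeasurableSpace X] [StandardBorelSpace X]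
    (E : X → X → Prop) (hEquiv : Equivalence E)
    (hBorel : MeasurableSet {p : X × X | E p.1 p.2})
    (hCtble : ∀ x, {y | E x y}.Countable)
    (hhyp : Hyperfinite E) :
    ∃ T : Equiv.Perm X, Measurable T ∧ ∀ x y, E x y ↔ ∃ n : ℤ, (T ^ n) x = y := by
  obtain ⟨lt₀, h₀⟩ := hhyp.exists_isBorelClassOrder hEquiv
  obtain ⟨lt₁, h₁, hb₁, -⟩ := h₀.exists_reorder hEquiv hBorel hhyp
  obtain ⟨lt₂, h₂, hb₂, hb₂'⟩ := (h₁.swap hEquiv).exists_reorder hEquiv hBorel hhyp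
  refine h₂.exists_perm hEquiv hBorel hhyp (fun x hx => ?_) fun x hx => ?_
  · have : {z | lt₂ x z} = ∅ := eq_empty_of_forall_notMem hx
    exact h₂.exists_min hEquiv (hb₂' hb₁ x (this ▸ finite_empty))
  · have : {z | lt₂ z x} = ∅ := eq_empty_of_forall_notMem hx
    exact (h₂.swap hEquiv).exists_min hEquiv (hb₂ x (this ▸ finite_empty))
end

section
/- (Dye, Krieger) Let X be a standard Borel space, let μ be a σ-finite Borel measure on X, and let (Eₙ) be an increasing sequence of countable Borel equivalence relations on X. If each Eₙ is μ-hyperfinite, then ⋃ₙ Eₙ is μ-hyperfinite. -/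
open MeasureTheory

/-- E is *μ-hyperfinite* if its restriction to the complement of some Borel μ-null set is
hyperfinite. -/
def MuHyperfinite {X : Type*} [MeasurableSpace X] (μ : Measure X) (E : X → X → Prop) : Prop :=
  ∃ Y : Set X, MeasurableSet Y ∧ μ Y = 0 ∧
    Hyperfinite (fun x y : {z : X // z ∉ Y} => E x.1 y.1)

open Set Filter Topology

universe u

/-- A sequence of sets is Borel separable if it can be enlarged to a sequence of measurable sets
with empty intersection. -/
def SeqSeparable {X : Type*} [MeasurableSpace X] (A : ℕ → Set X) : Prop :=
  ∃ C : ℕ → Set X, (∀ n, A n ⊆ C n) ∧ (∀ n, MeasurableSet (C n)) ∧ ⋂ n, C n = ∅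

theorem SeqSeparable.of_iUnion {X : Type*} [MeasurableSpace X] {A : ℕ → Set X}
    {B : ℕ → ℕ → Set X} (i : ℕ) (hi : A i ⊆ ⋃ k, B k i) (hB : ∀ k n, n ≠ i → A n ⊆ B k n)
    (h : ∀ k, SeqSeparable (B k)) : SeqSeparable A := by
  choose C hBC hC hemp using h
  refine ⟨fun n => if n = i then ⋃ k, C k i else ⋂ k, C k n, fun n => ?_, fun n => ?_, ?_⟩
  · by_cases hn : n = i
    · subst hn
      simpa using hi.trans (iUnion_mono fun k => hBC k n)
    · simpa [hn] using fun k => (hB k n hn).trans (hBC k n)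
  · dsimp only
    split_ifs
    · exact MeasurableSet.iUnion fun k => hC k i
    · exact MeasurableSet.iInter fun k => hC k n
  · refine eq_empty_of_forall_notMem fun x hx => ?_
    rw [mem_iInter] at hx
    have hxi := hx i
    simp only [if_true, mem_iUnion] at hxi
    obtain ⟨k, hk⟩ := hxi
    have : x ∈ ⋂ n, C k n := by
      refine mem_iInter.2 fun n => ?_
      by_cases hn : n = i
      · exact hn ▸ hk
      · have hxn := hx n
        simp only [hn, if_false, mem_iInter] at hxn
        exact hxn k
    simp [hemp] at this

open PiNat in
theorem seqSeparable_range {X : Type*} [TopologicalSpace X] [T2Space X] [MeasurableSpace X]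
    [OpensMeasurableSpace X] {f : ℕ → (ℕ → ℕ) → X} (hf : ∀ n, Continuous (f n))
    (hemp : ⋂ n, range (f n) = ∅) : SeqSeparable fun n => range (f n) := by
  by_contra hsep
  let g : ℕ → (ℕ → ℕ) → X := fun n w => f n fun j => w (Nat.pair n j)
  have hg : ∀ n, Continuous (g n) := fun n =>
    (hf n).comp (continuous_pi fun j => continuous_apply _)
  have hrange : ∀ n, range (g n) = range (f n) := fun n => by
    refine Subset.antisymm (range_subset_iff.2 fun w => mem_range_self _)
      (range_subset_iff.2 fun z => ⟨fun m => z m.unpair.2, ?_⟩)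
    simp [g]
  let Q : ℕ → (ℕ → ℕ) → Prop := fun s w => ¬ SeqSeparable fun n => g n '' cylinder w s
  have step : ∀ s w, Q s w → ∃ k, Q (s + 1) (Function.update w s k) := by
    intro s w
    simp only [Q]
    contrapose!
    refine SeqSeparable.of_iUnion s.unpair.1 ?_ fun k n hn => ?_
    · rw [← image_iUnion, iUnion_cylinder_update w s]
    · rintro _ ⟨z, hz, rfl⟩
      refine ⟨Function.update z s k, fun j hj => ?_, ?_⟩
      · rcases Nat.lt_succ_iff_lt_or_eq.1 hj with h | rfl
        · simp [h.ne, hz j h]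
        · simp
      · simp only [g]
        congr 1
        ext j
        refine Function.update_of_ne (fun h => hn ?_) _ _
        rw [← h, Nat.unpair_pair]
  choose! k hk using step
  let W : ℕ → ℕ → ℕ := fun s => Nat.rec 0 (fun s w => Function.update w s (k s w)) s
  have hW : ∀ s, W (s + 1) = Function.update (W s) s (k s (W s)) := fun s => rfl
  have hQ : ∀ s, Q s (W s) := by
    intro s
    induction s with
    | zero => simpa [Q, hrange] using hsep
    | succ s ih => rw [hW]; exact hk s _ ih
  let w : ℕ → ℕ := fun m => W (m + 1) m
  have hstab : ∀ m s, m + 1 ≤ s → W s m = w m := by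
    intro m
    refine Nat.le_induction rfl fun s hs ih => ?_
    rw [hW, Function.update_of_ne (by lia), ih]
  have hQw : ∀ s, Q s w := fun s => by
    have : cylinder (W s) s = cylinder w s :=
      mem_cylinder_iff_eq.1 fun j hj => hstab j s hj
    simpa only [Q, this] using hQ s
  obtain ⟨i, j, hij⟩ : ∃ i j, g i w ≠ g j w := by
    by_contra! h
    have : g 0 w ∈ ⋂ n, range (f n) := mem_iInter.2 fun n => by
      rw [← hrange, h 0 n]
      exact mem_range_self _
    simp [hemp] at this
  obtain ⟨U, V, hU, hV, hwU, hwV, hUV⟩ := t2_separation hij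
  have hnhds : g i ⁻¹' U ∩ g j ⁻¹' V ∈ 𝓝 w :=
    inter_mem ((hg i).continuousAt (hU.mem_nhds hwU)) ((hg j).continuousAt (hV.mem_nhds hwV))
  obtain ⟨s, hs⟩ : ∃ s, cylinder w s ⊆ g i ⁻¹' U ∩ g j ⁻¹' V := by
    let _ := PiNat.metricSpaceNatNat
    obtain ⟨ε, hε, hball⟩ := Metric.mem_nhds_iff.1 hnhds
    obtain ⟨s, hs⟩ := exists_pow_lt_of_lt_one hε (one_half_lt_one (α := ℝ))
    exact ⟨s, fun z hz => hball (lt_of_le_of_lt (mem_cylinder_iff_dist_le.1 hz) hs)⟩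
  have hne : i ≠ j := fun h => hij (by rw [h])
  refine hQw s ⟨fun n => if n = i then U else if n = j then V else univ, fun n => ?_, fun n => ?_,
    ?_⟩
  · rintro _ ⟨z, hz, rfl⟩
    dsimp only
    split_ifs with h₁ h₂
    · exact h₁ ▸ (hs hz).1
    · exact h₂ ▸ (hs hz).2
    · trivial
  · dsimp only
    split_ifs
    exacts [hU.measurableSet, hV.measurableSet, MeasurableSet.univ]
  · refine eq_empty_of_forall_notMem fun x hx => ?_
    rw [mem_iInter] at hx
    have hxi := hx i
    have hxj := hx j
    simp only [if_true, hne.symm, if_false] at hxi hxj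
    exact disjoint_left.1 hUV hxi hxj

/-- **Novikov's separation theorem** for a sequence of analytic sets with empty intersection. -/
theorem seqSeparable_of_analyticSet {X : Type*} [TopologicalSpace X] [T2Space X]
    [MeasurableSpace X] [OpensMeasurableSpace X] {A : ℕ → Set X} (hA : ∀ n, AnalyticSet (A n))
    (hemp : ⋂ n, A n = ∅) : SeqSeparable A := by
  by_cases h : ∃ i, A i = ∅
  · obtain ⟨i, hi⟩ := h
    refine ⟨fun n => if n = i then ∅ else univ, fun n => ?_, fun n => ?_, ?_⟩
    · by_cases hn : n = i
      · simp [hn, hi]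
      · simp [hn]
    · dsimp only
      split_ifs <;> simp
    · refine eq_empty_of_forall_notMem fun x hx => ?_
      simpa using mem_iInter.1 hx i
  · push Not at h
    have : ∀ n, ∃ f : (ℕ → ℕ) → X, Continuous f ∧ range f = A n := fun n => by
      have := hA n
      rw [AnalyticSet] at this
      exact this.resolve_left (h n).ne_empty
    choose f hf hfA using this
    obtain rfl : (fun n => range (f n)) = A := funext hfA
    exact seqSeparable_range hf hemp

theorem measurableSet_fst_image_of_encard_le {Y : Type u} [MeasurableSpace Y]
    [StandardBorelSpace Y] (n : ℕ) :
    ∀ {X : Type u} [MeasurableSpace X] [StandardBorelSpace X] {B : Set (X × Y)},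
      MeasurableSet B → (∀ x, {y | (x, y) ∈ B}.encard ≤ n) → MeasurableSet (Prod.fst '' B) := by
  obtain ⟨f, hf⟩ := MeasureTheory.exists_measurableEmbedding_real Y
  induction n with
  | zero =>
    intro X _ _ B hB hcard
    have : B = ∅ := by
      refine eq_empty_of_forall_notMem fun p hp => ?_
      have := hcard p.1
      simp only [Nat.cast_zero, nonpos_iff_eq_zero, encard_eq_zero] at this
      exact eq_empty_iff_forall_notMem.1 this p.2 hp
    simp [this]
  | succ n ih =>
    intro X _ _ B hB hcard
    let D : Set ((X × Y) × Y) := {q | q.1 ∈ B ∧ (q.1.1, q.2) ∈ B ∧ f q.2 < f q.1.2}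
    have hfm := hf.measurable
    have hD : MeasurableSet D := by
      refine (measurable_fst hB).inter (MeasurableSet.inter ?_ ?_)
      · exact (measurable_fst.fst.prodMk measurable_snd) hB
      · exact measurableSet_lt (hfm.comp measurable_snd) (hfm.comp measurable_fst.snd)
    have hDm : MeasurableSet (Prod.fst '' D) := by
      refine ih hD fun p => ?_
      by_cases hp : p ∈ B
      · have hsub : insert p.2 {y | (p, y) ∈ D} ⊆ {y | (p.1, y) ∈ B} := by
          rintro y (rfl | hy)
          · exact hp
          · exact hy.2.1
        have hnot : p.2 ∉ {y | (p, y) ∈ D} := fun h => lt_irrefl _ h.2.2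
        have := (encard_le_encard hsub).trans (hcard p.1)
        rw [encard_insert_of_notMem hnot] at this
        push_cast at this
        exact (ENat.add_le_add_iff_right (by simp)).1 this
      · have : {y | (p, y) ∈ D} = ∅ := eq_empty_of_forall_notMem fun y hy => hp hy.1
        simp [this]
    have himage : Prod.fst '' B = Prod.fst '' (B \ Prod.fst '' D) := by
      refine Subset.antisymm ?_ (image_mono sdiff_subset)
      rintro _ ⟨p, hp, rfl⟩
      have hfin : {y | (p.1, y) ∈ B}.Finite :=
        finite_of_encard_le_coe (hcard p.1)
      obtain ⟨y, hy, hmin⟩ := exists_min_image _ f hfin ⟨p.2, hp⟩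
      refine ⟨(p.1, y), ⟨hy, ?_⟩, rfl⟩
      rintro ⟨⟨q, z⟩, hq, rfl⟩
      exact (hmin z hq.2.1).not_gt hq.2.2
    rw [himage]
    refine (hB.diff hDm).image_of_measurable_injOn measurable_fst ?_
    rintro ⟨x, y⟩ ⟨hy, hy'⟩ ⟨x', z⟩ ⟨hz, hz'⟩ h
    obtain rfl : x = x' := h
    rcases lt_trichotomy (f y) (f z) with h | h | h
    · exact (hz' ⟨((x, z), y), ⟨hz, hy, h⟩, rfl⟩).elim
    · rw [hf.injective h]
    · exact (hy' ⟨((x, y), z), ⟨hy, hz, h⟩, rfl⟩).elim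

/-- The projection of a Borel set with finite sections is Borel. -/
theorem measurableSet_fst_image_of_finite {X Y : Type u} [MeasurableSpace X]
    [StandardBorelSpace X] [MeasurableSpace Y] [StandardBorelSpace Y] {B : Set (X × Y)}
    (hB : MeasurableSet B) (hfin : ∀ x, {y | (x, y) ∈ B}.Finite) :
    MeasurableSet (Prod.fst '' B) := by
  let _ := upgradeStandardBorel X
  let D : (n : ℕ) → Set (X × (Fin n → Y)) :=
    fun n => {q | (∀ i, (q.1, q.2 i) ∈ B) ∧ ∀ i j, q.2 i = q.2 j → i = j}
  have hD : ∀ n, MeasurableSet (D n) := fun n => by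
    simp only [D, ofPred_and, ofPred_forall]
    refine MeasurableSet.inter (MeasurableSet.iInter fun i => ?_)
      (MeasurableSet.iInter fun i => MeasurableSet.iInter fun j => ?_)
    · exact (measurable_fst.prodMk ((measurable_pi_apply i).comp measurable_snd)) hB
    · by_cases hij : i = j
      · simp [hij]
      · simp only [hij, imp_false]
        exact (measurableSet_eq_fun ((measurable_pi_apply i).comp measurable_snd)
          ((measurable_pi_apply j).comp measurable_snd)).compl
  have hemp : ⋂ n, Prod.fst '' D n = ∅ := by
    refine eq_empty_of_forall_notMem fun x hx => ?_
    rw [mem_iInter] at hx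
    obtain ⟨⟨x', t⟩, ⟨ht, hinj⟩, h⟩ := hx ((hfin x).toFinset.card + 1)
    simp only at h ht hinj
    rw [h] at ht
    have := Finset.card_le_card_of_injOn (s := Finset.univ) (t := (hfin x).toFinset) t
      (fun i _ => by simpa using ht i) (fun i _ j _ h => hinj i j h)
    simp at this
  obtain ⟨C, hDC, hC, hCemp⟩ :=
    seqSeparable_of_analyticSet (fun n => (hD n).analyticSet_image measurable_fst) hemp
  have hunion : Prod.fst '' B = ⋃ n, Prod.fst '' (B ∩ Prod.fst ⁻¹' (C n)ᶜ) := by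
    rw [← image_iUnion, ← inter_iUnion, ← preimage_iUnion, ← compl_iInter, hCemp]
    simp
  rw [hunion]
  refine MeasurableSet.iUnion fun n => measurableSet_fst_image_of_encard_le n
    (hB.inter (measurable_fst (hC n).compl)) fun x => ?_
  by_contra! hlt
  obtain ⟨t, hts, htn⟩ := exists_subset_encard_eq hlt.le
  have htfin : t.Finite := finite_of_encard_eq_coe htn
  have hcard : htfin.toFinset.card = n := by
    rw [htfin.encard_eq_coe_toFinset_card] at htn
    exact_mod_cast htn
  obtain ⟨y, hy⟩ : {y | (x, y) ∈ B ∩ Prod.fst ⁻¹' (C n)ᶜ}.Nonempty := by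
    rw [← encard_pos]
    exact zero_le.trans_lt hlt
  refine hy.2 (hDC n ⟨(x, fun i => (htfin.toFinset.equivFinOfCardEq hcard).symm i),
    ⟨fun i => ?_, fun i j h => ?_⟩, rfl⟩)
  · exact (hts (htfin.mem_toFinset.1
      ((htfin.toFinset.equivFinOfCardEq hcard).symm i).2)).1
  · exact (htfin.toFinset.equivFinOfCardEq hcard).symm.injective (Subtype.ext h)

/-- A finite Borel equivalence relation admits a Borel selector. -/
theorem exists_measurable_selector {X : Type*} [MeasurableSpace X] [StandardBorelSpace X]
    {F : X → X → Prop} (hF : Equivalence F) (hFm : MeasurableSet {p : X × X | F p.1 p.2})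
    (hfin : ∀ x, {y | F x y}.Finite) :
    ∃ s : X → X, Measurable s ∧ (∀ x, F x (s x)) ∧ ∀ x y, F x y → s x = s y := by
  obtain ⟨f, hf⟩ := MeasureTheory.exists_measurableEmbedding_real X
  have hfm := hf.measurable
  choose s hs hmin using fun x => exists_min_image _ f (hfin x) ⟨x, hF.refl x⟩
  refine ⟨s, fun U hU => ?_, hs, fun x y hxy => hf.injective (le_antisymm ?_ ?_)⟩
  · let D : Set ((X × X) × X) := {q | F q.1.1 q.2 ∧ f q.2 < f q.1.2}
    have hD : MeasurableSet (Prod.fst '' D) := by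
      refine measurableSet_fst_image_of_finite (MeasurableSet.inter ?_ ?_)
        fun p => (hfin p.1).subset fun y hy => hy.1
      · exact (measurable_fst.fst.prodMk measurable_snd) hFm
      · exact measurableSet_lt (hfm.comp measurable_snd) (hfm.comp measurable_fst.snd)
    have hpre : s ⁻¹' U =
        Prod.fst '' (({p : X × X | F p.1 p.2} \ Prod.fst '' D) ∩ Prod.snd ⁻¹' U) := by
      ext x
      constructor
      · intro hx
        refine ⟨(x, s x), ⟨⟨hs x, ?_⟩, hx⟩, rfl⟩
        rintro ⟨⟨p, z⟩, hq, rfl⟩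
        exact (hmin _ z hq.1).not_gt hq.2
      · rintro ⟨⟨x, y⟩, ⟨⟨hxy, hy⟩, hyU⟩, rfl⟩
        have : s x = y := by
          refine hf.injective (le_antisymm (hmin x y hxy) (not_lt.1 fun h => hy ?_))
          exact ⟨((x, y), s x), ⟨hs x, h⟩, rfl⟩
        rwa [mem_preimage, this]
    rw [hpre]
    exact measurableSet_fst_image_of_finite ((hFm.diff hD).inter (measurable_snd hU))
      fun x => (hfin x).subset fun y hy => hy.1.1
  · exact hmin x _ (hF.trans hxy (hs y))
  · exact hmin y _ (hF.trans (hF.symm hxy) (hs x))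

/-- A Borel relation with finite sections contained in an increasing union of Borel relations is,
outside a set of small measure, contained in one of them. -/
theorem exists_measure_not_subset_le {X : Type*} [MeasurableSpace X] [StandardBorelSpace X]
    (μ : Measure X) [IsFiniteMeasure μ] {S : X → X → Prop} {T : ℕ → X → X → Prop}
    (hS : MeasurableSet {p : X × X | S p.1 p.2}) (hSfin : ∀ x, {y | S x y}.Finite)
    (hT : ∀ n, MeasurableSet {p : X × X | T n p.1 p.2})
    (hTmono : ∀ m n, m ≤ n → ∀ x y, T m x y → T n x y)
    (hST : ∀ x y, S x y → ∃ n, T n x y) {ε : ENNReal} (hε : 0 < ε) :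
    ∃ n, μ {x | ∃ y, S x y ∧ ¬ T n x y} ≤ ε := by
  have hmeas : ∀ n, MeasurableSet {x | ∃ y, S x y ∧ ¬ T n x y} := fun n => by
    have : {x | ∃ y, S x y ∧ ¬ T n x y} =
        Prod.fst '' ({p : X × X | S p.1 p.2} \ {p : X × X | T n p.1 p.2}) := by
      ext x
      constructor
      · rintro ⟨y, hy⟩
        exact ⟨(x, y), hy, rfl⟩
      · rintro ⟨⟨x, y⟩, hy, rfl⟩
        exact ⟨y, hy⟩
    rw [this]
    exact measurableSet_fst_image_of_finite (hS.diff (hT n))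
      fun x => (hSfin x).subset fun y hy => hy.1
  have hanti : Antitone fun n => {x | ∃ y, S x y ∧ ¬ T n x y} :=
    fun m n hmn x ⟨y, hy, hny⟩ => ⟨y, hy, fun h => hny (hTmono m n hmn x y h)⟩
  have hemp : ⋂ n, {x | ∃ y, S x y ∧ ¬ T n x y} = ∅ := by
    refine eq_empty_of_forall_notMem fun x hx => ?_
    rw [mem_iInter] at hx
    have hev : ∀ᶠ n in atTop, ∀ y ∈ {y | S x y}, T n x y :=
      ((hSfin x).eventually_all).2 fun y hy => by
        obtain ⟨n, hn⟩ := hST x y hy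
        exact eventually_atTop.2 ⟨n, fun m hm => hTmono n m hm x y hn⟩
    obtain ⟨n, hn⟩ := hev.exists
    obtain ⟨y, hy, hny⟩ := hx n
    exact hny (hn y hy)
  have hlim := tendsto_measure_iInter_atTop (μ := μ) (fun n => (hmeas n).nullMeasurableSet) hanti
    ⟨0, measure_ne_top _ _⟩
  rw [hemp, measure_empty] at hlim
  exact (hlim.eventually_le_const hε).exists

/-- A finite Borel equivalence relation. -/
structure IsFiniteBorelEquiv {X : Type*} [MeasurableSpace X] (F : X → X → Prop) : Prop where
  equivalence : Equivalence F
  measurableSet : MeasurableSet {p : X × X | F p.1 p.2}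
  finite : ∀ x, {y | F x y}.Finite

/-- A finite Borel subrelation of an increasing union of hyperfinite equivalence relations can be
enlarged to one that contains most of a given Borel relation with finite sections. -/
theorem exists_isFiniteBorelEquiv_extension {X : Type*} [MeasurableSpace X]
    [StandardBorelSpace X] (μ : Measure X) [IsFiniteMeasure μ] {E : ℕ → X → X → Prop}
    (hE : Equivalence fun x y => ∃ n, E n x y)
    (hmono : ∀ m n, m ≤ n → ∀ x y, E m x y → E n x y)
    {G : ℕ → ℕ → X → X → Prop} (hG : ∀ n m, IsFiniteBorelEquiv (G n m))
    (hGmono : ∀ n m k, m ≤ k → ∀ x y, G n m x y → G n k x y)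
    (hGE : ∀ n x y, E n x y ↔ ∃ m, G n m x y)
    {S : X → X → Prop} (hS : MeasurableSet {p : X × X | S p.1 p.2})
    (hSfin : ∀ x, {y | S x y}.Finite) (hSE : ∀ x y, S x y → ∃ n, E n x y)
    {F : X → X → Prop} (hF : IsFiniteBorelEquiv F) (hFE : ∀ x y, F x y → ∃ n, E n x y)
    {ε : ENNReal} (hε : 0 < ε) :
    ∃ F' : X → X → Prop, (IsFiniteBorelEquiv F' ∧ ∀ x y, F' x y → ∃ n, E n x y) ∧
      (∀ x y, F x y → F' x y) ∧ μ {x | ∃ y, S x y ∧ ¬ F' x y} ≤ ε := by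
  obtain ⟨s, hs, hFs, hsF⟩ := exists_measurable_selector hF.equivalence hF.measurableSet hF.finite
  have hEs : ∀ x, ∃ n, E n x (s x) := fun x => hFE _ _ (hFs x)
  have hpair : Measurable fun p : X × X => (s p.1, s p.2) :=
    (hs.comp measurable_fst).prodMk (hs.comp measurable_snd)
  have hGs : ∀ n m, MeasurableSet {p : X × X | G n m (s p.1) (s p.2)} :=
    fun n m => hpair (hG n m).measurableSet
  have hEm : ∀ n, MeasurableSet {p : X × X | E n (s p.1) (s p.2)} := fun n => by
    simp only [hGE, ofPred_exists]
    exact MeasurableSet.iUnion fun m => hGs n m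
  obtain ⟨n, hn⟩ := exists_measure_not_subset_le μ (T := fun n x y => E n (s x) (s y)) hS hSfin hEm
    (fun m n hmn x y h => hmono m n hmn _ _ h)
    (fun x y h => hE.trans (hE.trans (hE.symm (hEs x)) (hSE x y h)) (hEs y))
    (ENNReal.half_pos hε.ne')
  obtain ⟨m, hm⟩ := exists_measure_not_subset_le μ (S := fun x y => S x y ∧ E n (s x) (s y))
    (T := fun m x y => G n m (s x) (s y)) (hS.inter (hEm n))
    (fun x => (hSfin x).subset fun y hy => hy.1) (hGs n)
    (fun m k hmk x y h => hGmono n m k hmk _ _ h) (fun x y h => (hGE n _ _).1 h.2)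
    (ENNReal.half_pos hε.ne')
  have hGeq := (hG n m).equivalence
  refine ⟨fun x y => G n m (s x) (s y), ⟨⟨⟨fun x => hGeq.refl _, fun h => hGeq.symm h,
    fun h h' => hGeq.trans h h'⟩, hGs n m, fun x => ?_⟩, fun x y h => ?_⟩, fun x y h => ?_, ?_⟩
  · refine (((hG n m).finite (s x)).biUnion fun t _ => hF.finite t).subset fun y hy => ?_
    exact mem_biUnion (x := s y) hy (hF.equivalence.symm (hFs y))
  · exact hE.trans (hE.trans (hEs x) ⟨n, (hGE n _ _).2 ⟨m, h⟩⟩) (hE.symm (hEs y))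
  · simpa only [hsF x y h] using hGeq.refl (s y)
  · calc μ {x | ∃ y, S x y ∧ ¬ G n m (s x) (s y)}
        ≤ μ ({x | ∃ y, S x y ∧ ¬ E n (s x) (s y)} ∪
            {x | ∃ y, (S x y ∧ E n (s x) (s y)) ∧ ¬ G n m (s x) (s y)}) := by
          refine measure_mono fun x ⟨y, hy, hny⟩ => ?_
          by_cases h : E n (s x) (s y)
          · exact Or.inr ⟨y, ⟨hy, h⟩, hny⟩
          · exact Or.inl ⟨y, hy, h⟩
      _ ≤ ε / 2 + ε / 2 := (measure_union_le _ _).trans (add_le_add hn hm)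
      _ = ε := ENNReal.add_halves ε

theorem Hyperfinite.comap {X Z : Type*} [MeasurableSpace X] [MeasurableSpace Z]
    {E : X → X → Prop} (hE : Hyperfinite E) {f : Z → X} (hf : Measurable f)
    (hinj : Function.Injective f) : Hyperfinite fun x y => E (f x) (f y) := by
  obtain ⟨F, hF, hFm, hfin, hmono, hFE⟩ := hE
  refine ⟨fun n x y => F n (f x) (f y), fun n => (hF n).comap f, fun n => ?_,
    fun n x => (hfin n (f x)).preimage hinj.injOn, fun m n h x y => hmono m n h _ _,
    fun x y => hFE _ _⟩
  exact ((hf.comp measurable_fst).prodMk (hf.comp measurable_snd)) (hFm n)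

/-- The Dye–Krieger theorem for relations that are hyperfinite everywhere and a finite measure. -/
theorem muHyperfinite_iUnion_of_hyperfinite {X : Type*} [MeasurableSpace X]
    [StandardBorelSpace X] (μ : Measure X) [IsFiniteMeasure μ] (E : ℕ → X → X → Prop)
    (hEquiv : ∀ n, Equivalence (E n)) (hmono : ∀ m n, m ≤ n → ∀ x y, E m x y → E n x y)
    (hhyp : ∀ n, Hyperfinite (E n)) : MuHyperfinite μ fun x y => ∃ n, E n x y := by
  have hE : Equivalence fun x y => ∃ n, E n x y := by
    refine ⟨fun x => ⟨0, (hEquiv 0).refl x⟩, fun ⟨n, h⟩ => ⟨n, (hEquiv n).symm h⟩, ?_⟩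
    rintro x y z ⟨m, h⟩ ⟨n, h'⟩
    exact ⟨max m n, (hEquiv _).trans (hmono _ _ (le_max_left m n) _ _ h)
      (hmono _ _ (le_max_right m n) _ _ h')⟩
  choose G hGeq hGm hGfin hGmono hGE using hhyp
  have hG : ∀ n m, IsFiniteBorelEquiv (G n m) := fun n m => ⟨hGeq n m, hGm n m, hGfin n m⟩
  let S : ℕ → X → X → Prop := fun k x y => ∃ i ≤ k, G i.unpair.1 i.unpair.2 x y
  have hSm : ∀ k, MeasurableSet {p : X × X | S k p.1 p.2} := fun k => by
    simp only [S, ofPred_exists, ofPred_and]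
    exact MeasurableSet.iUnion fun i => (MeasurableSet.const _).inter (hGm _ _)
  have hSfin : ∀ k x, {y | S k x y}.Finite := fun k x => by
    refine ((finite_Iic k).biUnion fun i _ => hGfin i.unpair.1 i.unpair.2 x).subset ?_
    rintro y ⟨i, hi, h⟩
    exact mem_biUnion hi h
  have hSE : ∀ k x y, S k x y → ∃ n, E n x y := fun k x y ⟨i, _, h⟩ => ⟨_, (hGE _ _ _).2 ⟨_, h⟩⟩
  obtain ⟨ε, hε, hsum⟩ := ENNReal.exists_pos_sum_of_countable' one_ne_zero ℕ
  choose next hnext hle hbad using fun (k : ℕ)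
      (F : {F : X → X → Prop // IsFiniteBorelEquiv F ∧ ∀ x y, F x y → ∃ n, E n x y}) =>
    exists_isFiniteBorelEquiv_extension μ hE hmono hG hGmono hGE (hSm k) (hSfin k) (hSE k)
      F.2.1 F.2.2 (hε k)
  let F : ℕ → {F : X → X → Prop // IsFiniteBorelEquiv F ∧ ∀ x y, F x y → ∃ n, E n x y} :=
    fun k => Nat.rec ⟨Eq, ⟨eq_equivalence, measurableSet_eq_fun measurable_fst measurable_snd,
      fun x => by simp⟩, fun x y h => h ▸ hE.refl x⟩ (fun k F => ⟨next k F, hnext k F⟩) k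
  have hFsucc : ∀ k, (F (k + 1)).1 = next k (F k) := fun k => rfl
  have hFmono : ∀ m n, m ≤ n → ∀ x y, (F m).1 x y → (F n).1 x y := by
    intro m
    refine Nat.le_induction (fun x y h => h) fun n _ ih x y h => ?_
    rw [hFsucc]
    exact hle n _ _ _ (ih x y h)
  have hae : ∀ᵐ x ∂μ, ∀ᶠ k in atTop, x ∉ {x | ∃ y, S k x y ∧ ¬ (F (k + 1)).1 x y} := by
    refine ae_eventually_notMem (ne_top_of_le_ne_top ?_
      (ENNReal.tsum_le_tsum fun k => hbad k (F k)))
    exact (hsum.trans ENNReal.one_lt_top).ne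
  obtain ⟨N, hsub, hNm, hN⟩ := exists_measurable_superset_of_null (ae_iff.1 hae)
  refine ⟨N, hNm, hN, fun k x y => (F k).1 x.1 y.1, fun k => (F k).2.1.equivalence.comap _,
    fun k => ?_, fun k x => ((F k).2.1.finite x.1).preimage Subtype.val_injective.injOn,
    fun m n h x y => hFmono m n h _ _, fun x y => ⟨?_, fun ⟨k, h⟩ => (F k).2.2 _ _ h⟩⟩
  · exact ((measurable_subtype_coe.comp measurable_fst).prodMk
      (measurable_subtype_coe.comp measurable_snd)) (F k).2.1.measurableSet
  · rintro ⟨n, h⟩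
    obtain ⟨m, hm⟩ := (hGE n _ _).1 h
    have hx : ∀ᶠ k in atTop, x.1 ∉ {x | ∃ y, S k x y ∧ ¬ (F (k + 1)).1 x y} := by
      by_contra hx
      exact x.2 (hsub hx)
    obtain ⟨k, hk, hkx⟩ := ((eventually_ge_atTop (Nat.pair n m)).and hx).exists
    refine ⟨k + 1, by_contra fun hF => hkx ⟨y.1, ⟨Nat.pair n m, hk, ?_⟩, hF⟩⟩
    simpa using hm

/-- Dye, Krieger: If (Eₙ) is an increasing sequence of countable Borel
equivalence relations on a standard Borel space X with σ-finite Borel measure μ and each Eₙ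
is μ-hyperfinite, then ⋃ₙ Eₙ is μ-hyperfinite. -/
theorem union_mu_hyperfinite
    {X : Type*} [MeasurableSpace X] [StandardBorelSpace X]
    (μ : Measure X) [SigmaFinite μ]
    (E : ℕ → X → X → Prop) (hEquiv : ∀ n, Equivalence (E n))
    (hBorel : ∀ n, MeasurableSet {p : X × X | E n p.1 p.2})
    (hCtble : ∀ n x, {y | E n x y}.Countable)
    (hmono : ∀ m n, m ≤ n → ∀ x y, E m x y → E n x y)
    (hhyp : ∀ n, MuHyperfinite μ (E n)) :
    MuHyperfinite μ (fun x y => ∃ n, E n x y) := by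
  choose Y hYm hY0 hYhyp using hhyp
  have hZm : MeasurableSet (⋃ n, Y n) := MeasurableSet.iUnion hYm
  have hZ0 : μ (⋃ n, Y n) = 0 := measure_iUnion_null hY0
  let X' := {z : X // z ∉ ⋃ n, Y n}
  have : StandardBorelSpace X' := hZm.compl.standardBorel
  have hemb : MeasurableEmbedding (Subtype.val : X' → X) :=
    MeasurableEmbedding.subtype_coe hZm.compl
  have : IsFiniteMeasure (μ.toFinite.comap (Subtype.val : X' → X)) :=
    ⟨by rw [hemb.comap_apply]; exact measure_lt_top _ _⟩
  obtain ⟨N, hNm, hN0, hN⟩ := muHyperfinite_iUnion_of_hyperfinite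
    (μ.toFinite.comap (Subtype.val : X' → X)) (fun n x y => E n x.1 y.1)
    (fun n => (hEquiv n).comap _) (fun m n h x y => hmono m n h _ _) fun n =>
      (hYhyp n).comap (f := fun x : X' => ⟨x.1, fun h => x.2 (mem_iUnion_of_mem n h)⟩)
        measurable_subtype_coe.subtype_mk fun x y h => Subtype.ext (congrArg (fun z => z.1) h)
  rw [hemb.comap_apply, toFinite_apply_eq_zero_iff] at hN0
  refine ⟨(⋃ n, Y n) ∪ Subtype.val '' N, hZm.union (hemb.measurableSet_image.2 hNm),
    measure_union_null hZ0 hN0, ?_⟩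
  exact hN.comap (f := fun x : {z : X // z ∉ (⋃ n, Y n) ∪ Subtype.val '' N} =>
      ⟨⟨x.1, fun h => x.2 (Or.inl h)⟩, fun h => x.2 (Or.inr ⟨_, h, rfl⟩)⟩)
    measurable_subtype_coe.subtype_mk.subtype_mk
    fun x y h => Subtype.ext (congrArg (fun z => z.1.1) h)
end
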